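/- Assume 0 < p < 1 is real and the family Ψ_n satisfies properties (P1)–(P6). Define S_n(μ) = ((⟨↑↓| + μ⟨↓↑|)^{⊗n} ⊗ ⟨↑|) ψ_n. Then for each k ≥ 0, S_{2k} and S_{2k+1} are polynomials in μ whose coefficients are polynomials in ζ with: for all μ ≠ 0, S_{2k}(μ) = (2μ)^k · H_{2k} · H_{2(k+1)}(J₂, μ̄) and S_{2k+1}(μ) = (2μ)^k (μ+1) · H_{2(k+1)}(J₂) · H_{2(k+1)}(μ̄), where μ̄ = (μ−1)²/((ζ²−1)μ), J₂ = −1/2, and the polynomials H are evaluated at the parameter ζ = (ϑ₁(η,p²)/ϑ₄(η,p²))². -/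

import Mathlib

noncomputable section

open Complex
open scoped BigOperators

/-- Jacobi theta function `ϑ₁(z|τ)` with nome `p = e^{iπτ}` (Whittaker–Watson convention). -/
def th1 (z τ : ℂ) : ℂ :=
  -Complex.I * ∑' n : ℤ, (-1 : ℂ) ^ n *
    Complex.exp ((Real.pi : ℂ) * Complex.I * τ * ((n : ℂ) + 1/2) ^ 2 + (2 * (n : ℂ) + 1) * Complex.I * z)

/-- Jacobi theta function `ϑ₂(z|τ)`. -/
def th2 (z τ : ℂ) : ℂ :=
  ∑' n : ℤ,
    Complex.exp ((Real.pi : ℂ) * Complex.I * τ * ((n : ℂ) + 1/2) ^ 2 + (2 * (n : ℂ) + 1) * Complex.I * z)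

/-- Jacobi theta function `ϑ₃(z|τ)`. -/
def th3 (z τ : ℂ) : ℂ :=
  ∑' n : ℤ, Complex.exp ((Real.pi : ℂ) * Complex.I * τ * (n : ℂ) ^ 2 + 2 * (n : ℂ) * Complex.I * z)

/-- Jacobi theta function `ϑ₄(z|τ)`. -/
def th4 (z τ : ℂ) : ℂ :=
  ∑' n : ℤ, (-1 : ℂ) ^ n *
    Complex.exp ((Real.pi : ℂ) * Complex.I * τ * (n : ℂ) ^ 2 + 2 * (n : ℂ) * Complex.I * z)

/-- The crossing parameter `η = π/3`. -/
def ηc : ℂ := (Real.pi : ℂ) / 3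

/-- The elliptic nome `p = e^{iπτ}`. -/
def pnome (τ : ℂ) : ℂ := Complex.exp ((Real.pi : ℂ) * Complex.I * τ)

/-- `ζ = (ϑ₁(η,p²)/ϑ₄(η,p²))²`. -/
def zet (τ : ℂ) : ℂ := (th1 ηc (2 * τ) / th4 ηc (2 * τ)) ^ 2

/-- The nome `p` is real with `0 < p < 1`. -/
def preal (τ : ℂ) : Prop := (pnome τ).im = 0 ∧ 0 < (pnome τ).re ∧ (pnome τ).re < 1

/-- A tuple given by a list of prescribed entries, padded by zeros. -/
def padded {n : ℕ} (l : List ℂ) : Fin n → ℂ := fun j => l.getD (j : ℕ) 0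

/-- Extension of a tuple by a list of prescribed further entries (padded by zeros). -/
def extL {m n : ℕ} (w : Fin m → ℂ) (l : List ℂ) : Fin n → ℂ :=
  fun j => if h : (j : ℕ) < m then w ⟨j, h⟩ else l.getD ((j : ℕ) - m) 0

/-- First `k` entries of a `2k`-tuple. -/
def firstHalf {k : ℕ} (x : Fin (2 * k) → ℂ) : Fin k → ℂ :=
  fun i => x ⟨(i : ℕ), by have := i.2; omega⟩

/-- Last `k` entries of a `2k`-tuple. -/
def secondHalf {k : ℕ} (x : Fin (2 * k) → ℂ) : Fin k → ℂ :=
  fun i => x ⟨k + (i : ℕ), by have := i.2; omega⟩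

/-- `𝕙(x,y) = ϑ₁(x−y+η)ϑ₁(x−y−η)ϑ₁(x+y+η)ϑ₁(x+y−η)`. -/
def hh (τ x y : ℂ) : ℂ :=
  th1 (x - y + ηc) τ * th1 (x - y - ηc) τ * th1 (x + y + ηc) τ * th1 (x + y - ηc) τ

/-- `𝔻(x₁,…,x_k) = ∏_{i<j} ϑ₁(x_j−x_i)ϑ₁(x_j+x_i)`. -/
def vdTheta (τ : ℂ) {k : ℕ} (y : Fin k → ℂ) : ℂ :=
  ∏ i : Fin k, ∏ j : Fin k, if i < j then th1 (y j - y i) τ * th1 (y j + y i) τ else 1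

/-- The elliptic Tsuchiya determinant `ℍ_{2k}(x₁,…,x_k; x_{k+1},…,x_{2k})`. -/
def tsuchiya (τ : ℂ) (k : ℕ) (x : Fin (2 * k) → ℂ) : ℂ :=
  (∏ i : Fin k, ∏ j : Fin k, hh τ (firstHalf x i) (secondHalf x j))
    / (vdTheta τ (firstHalf x) * vdTheta τ (secondHalf x))
    * Matrix.det (Matrix.of fun i j : Fin k => (hh τ (firstHalf x i) (secondHalf x j))⁻¹)

/-- The expression defining the elliptic Tsuchiya determinant is well defined:
the Vandermonde-type denominators and the entries `𝕙(x_i,x_{j+k})` are nonzero. -/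
def tsuDefined (τ : ℂ) (k : ℕ) (x : Fin (2 * k) → ℂ) : Prop :=
  (∀ i j : Fin k, i ≠ j →
    th1 (firstHalf x j - firstHalf x i) τ ≠ 0 ∧ th1 (firstHalf x j + firstHalf x i) τ ≠ 0) ∧
  (∀ i j : Fin k, i ≠ j →
    th1 (secondHalf x j - secondHalf x i) τ ≠ 0 ∧ th1 (secondHalf x j + secondHalf x i) τ ≠ 0) ∧
  (∀ i j : Fin k, hh τ (firstHalf x i) (secondHalf x j) ≠ 0)

/-- `h(w,w') = 1 − (3+ζ²)ww' + (1−ζ²)ww'(w+w')`. -/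
def hpol (ζ w w' : ℂ) : ℂ := 1 - (3 + ζ ^ 2) * w * w' + (1 - ζ ^ 2) * w * w' * (w + w')

/-- Vandermonde product `Δ(w₁,…,w_k) = ∏_{i<j}(w_j − w_i)`. -/
def vdm {k : ℕ} (y : Fin k → ℂ) : ℂ :=
  ∏ i : Fin k, ∏ j : Fin k, if i < j then y j - y i else 1

/-- The determinant-ratio expression defining the polynomial `H_{2k}`. -/
def Hratio (ζ : ℂ) (k : ℕ) (w : Fin (2 * k) → ℂ) : ℂ :=
  (∏ i : Fin k, ∏ j : Fin k, hpol ζ (firstHalf w i) (secondHalf w j))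
    / (vdm (firstHalf w) * vdm (secondHalf w))
    * Matrix.det (Matrix.of fun i j : Fin k => (hpol ζ (firstHalf w i) (secondHalf w j))⁻¹)

/-- The expression `Hratio` is well defined at `w`. -/
def HratioDefined (ζ : ℂ) (k : ℕ) (w : Fin (2 * k) → ℂ) : Prop :=
  (∀ i j : Fin k, i ≠ j → firstHalf w i ≠ firstHalf w j) ∧
  (∀ i j : Fin k, i ≠ j → secondHalf w i ≠ secondHalf w j) ∧
  (∀ i j : Fin k, hpol ζ (firstHalf w i) (secondHalf w j) ≠ 0)

/-- `H` is the family of Rosengren–Zinn-Justin polynomials `H_{2k}` for parameter `ζ`: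
for each `k`, `H k` is a polynomial function of the `2k` variables agreeing with the
determinant-ratio formula wherever the latter is defined, and `H 0 = 1`. -/
def IsHFamily (ζ : ℂ) (H : (k : ℕ) → (Fin (2 * k) → ℂ) → ℂ) : Prop :=
  (∀ w, H 0 w = 1) ∧
  (∀ k : ℕ, ∃ P : MvPolynomial (Fin (2 * k)) ℂ, ∀ w, H k w = MvPolynomial.eval w P) ∧
  (∀ (k : ℕ) (w : Fin (2 * k) → ℂ), HratioDefined ζ k w → H k w = Hratio ζ k w)

/-- Vertex weight `a(u)`. -/
def av (τ u : ℂ) : ℂ := th4 (2*ηc) (2*τ) * th1 (u + 2*ηc) (2*τ) * th4 u (2*τ)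
/-- Vertex weight `b(u)`. -/
def bv (τ u : ℂ) : ℂ := th4 (2*ηc) (2*τ) * th4 (u + 2*ηc) (2*τ) * th1 u (2*τ)
/-- Vertex weight `c(u)`. -/
def cv (τ u : ℂ) : ℂ := th1 (2*ηc) (2*τ) * th4 (u + 2*ηc) (2*τ) * th4 u (2*τ)
/-- Vertex weight `d(u)`. -/
def dv (τ u : ℂ) : ℂ := th1 (2*ηc) (2*τ) * th1 (u + 2*ηc) (2*τ) * th1 u (2*τ)
/-- `r(u) = a(u) + b(u)`. -/
def rv (τ u : ℂ) : ℂ := av τ u + bv τ u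

/-- Entries of the `R`-matrix of the eight-vertex model, in the basis `{↑↑,↑↓,↓↑,↓↓}`
identified with `Fin 2 × Fin 2` (`↑ = 0`, `↓ = 1`). -/
def Rent (τ u : ℂ) (p q : Fin 2 × Fin 2) : ℂ :=
  if p = q then (if p.1 = p.2 then av τ u else bv τ u)
  else if q = (p.2, p.1) then cv τ u
  else if p.1 = p.2 ∧ q.1 = q.2 then dv τ u
  else 0

/-- Entries of `Ř(u) = 𝒫 R(u)`. -/
def Rcheckent (τ u : ℂ) (p q : Fin 2 × Fin 2) : ℂ := Rent τ u (p.2, p.1) q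

/-- The boundary vector `χ(x) ∈ ℂ²⊗ℂ²`. -/
def chiV (τ lam x : ℂ) : Fin 2 × Fin 2 → ℂ := fun p =>
  if p = ((0 : Fin 2), (1 : Fin 2)) then th1 (x + lam) (2*τ) * th4 (x - lam - 2*ηc) (2*τ)
  else if p = ((1 : Fin 2), (0 : Fin 2)) then th1 (x - lam - 2*ηc) (2*τ) * th4 (x + lam) (2*τ)
  else 0

/-- The boundary vector `χ̄(x) ∈ ℂ²⊗ℂ²`. -/
def chibarV (τ lam x : ℂ) : Fin 2 × Fin 2 → ℂ := fun p =>
  if p = ((0 : Fin 2), (0 : Fin 2)) then th1 (x + lam) (2*τ) * th1 (x - lam - 2*ηc) (2*τ)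
  else if p = ((1 : Fin 2), (1 : Fin 2)) then th4 (x - lam - 2*ηc) (2*τ) * th4 (x + lam) (2*τ)
  else 0

/-- A family `Ψ_n(u₁,…,u_{2n+1}) ∈ (ℂ²)^{⊗(2n+1)}`, represented by its components
with respect to spin configurations `α : Fin (2n+1) → Fin 2` (`↑ = 0`, `↓ = 1`). -/
abbrev PsiFam := (n : ℕ) → (Fin (2 * n + 1) → ℂ) → (Fin (2 * n + 1) → Fin 2) → ℂ

/-- The action of `Ř(u)` on tensor factors `i`, `j` of `(ℂ²)^{⊗L}`. -/
def applyRc (τ u : ℂ) {L : ℕ} (i j : Fin L) (ψ : (Fin L → Fin 2) → ℂ) :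
    (Fin L → Fin 2) → ℂ := fun α =>
  ∑ s : Fin 2, ∑ t : Fin 2,
    Rcheckent τ u (α i, α j) (s, t) * ψ (Function.update (Function.update α i s) j t)

/-- Spin flip. -/
def flipS : Fin 2 → Fin 2 := fun s => if s = 0 then 1 else 0

/-- Components of the singlet `s = ↑↓ − ↓↑`. -/
def singletC : Fin 2 → Fin 2 → ℂ := fun s t =>
  if s = 0 ∧ t = 1 then 1 else if s = 1 ∧ t = 0 then -1 else 0

/-- Delete the entries at positions `i`, `i+1` from a tuple. -/
def delTwo {α : Type*} {n : ℕ} (i : ℕ) (u : Fin (2 * (n + 1) + 1) → α) : Fin (2 * n + 1) → α :=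
  fun j => if _h : (j : ℕ) < i then u ⟨j, by have := j.2; omega⟩
           else u ⟨(j : ℕ) + 2, by have := j.2; omega⟩

/-- The components of `Ψ_n` are entire functions of each `u_i`. -/
def PsiEntire (Ψ : PsiFam) : Prop :=
  ∀ (n : ℕ) (u : Fin (2*n+1) → ℂ) (i : Fin (2*n+1)) (α : Fin (2*n+1) → Fin 2),
    Differentiable ℂ fun z => Ψ n (Function.update u i z) α

/-- (P1): the exchange relations. -/
def PsiP1 (τ : ℂ) (Ψ : PsiFam) : Prop :=
  ∀ (n : ℕ) (u : Fin (2*n+1) → ℂ) (i j : Fin (2*n+1)), (j : ℕ) = (i : ℕ) + 1 →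
    applyRc τ (u j - u i) i j (Ψ n u)
      = fun α => rv τ (u j - u i) * Ψ n (fun l => u (Equiv.swap i j l)) α

/-- (P2): local spin flips. -/
def PsiP2 (τ : ℂ) (Ψ : PsiFam) : Prop :=
  ∀ (n : ℕ) (u : Fin (2*n+1) → ℂ) (i : Fin (2*n+1)) (α : Fin (2*n+1) → Fin 2),
    Ψ n u (Function.update α i (flipS (α i)))
      = (-(pnome τ)) ^ n * Complex.exp (-Complex.I * ∑ j, (u j - u i))
        * Ψ n (Function.update u i (u i + Real.pi * τ)) α

/-- (P3): quasi-periodicity of `Ψ_n` in each `u_i`. -/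
def PsiP3 (τ : ℂ) (Ψ : PsiFam) : Prop :=
  ∀ (n : ℕ) (u : Fin (2*n+1) → ℂ) (i : Fin (2*n+1)),
    (Ψ n (Function.update u i (u i + Real.pi))
      = fun α => (∏ j ∈ Finset.univ.erase i, (if α j = 0 then (1:ℂ) else -1)) * Ψ n u α) ∧
    (Ψ n (Function.update u i (u i + 2 * Real.pi * τ))
      = fun α => (pnome τ ^ (4*n))⁻¹ *
          Complex.exp (-2 * Complex.I * ∑ j, (u i - u j)) * Ψ n u α)

/-- (P4): the wheel condition. -/
def PsiP4 (Ψ : PsiFam) : Prop :=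
  ∀ (n : ℕ) (u : Fin (2*n+1) → ℂ),
    (∃ i j k : Fin (2*n+1), i < j ∧ j < k ∧ u j = u i + 2*ηc ∧ u k = u i + 4*ηc) →
    Ψ n u = 0

/-- (P5): the reduction relations. -/
def PsiP5 (τ : ℂ) (Ψ : PsiFam) : Prop :=
  ∀ (n : ℕ) (u : Fin (2*(n+1)+1) → ℂ) (i : ℕ) (hi : i + 1 < 2*(n+1)+1),
    u ⟨i+1, hi⟩ = u ⟨i, by omega⟩ + 2*ηc →
    Ψ (n+1) u = fun α =>
      (∏ j ∈ (Finset.univ.erase (⟨i, by omega⟩ : Fin (2*(n+1)+1))).erase ⟨i+1, hi⟩,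
          th1 (u ⟨i, by omega⟩ - u j - 2*ηc) τ)
        * singletC (α ⟨i, by omega⟩) (α ⟨i+1, hi⟩)
        * Ψ n (delTwo i u) (delTwo i α)

/-- (P6): `Ψ₀ = ↑ + ↓`. -/
def PsiP6 (Ψ : PsiFam) : Prop := ∀ u α, Ψ 0 u α = 1

/-- The inhomogeneity parameters `(x₁,−x₁,…,x_n,−x_n,0)`. -/
def interleave {n : ℕ} (x : Fin n → ℂ) : Fin (2*n+1) → ℂ := fun j =>
  if h : (j : ℕ) < 2*n then
    (if (j : ℕ) % 2 = 0 then x ⟨(j:ℕ)/2, by omega⟩ else -x ⟨(j:ℕ)/2, by omega⟩)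
  else 0

/-- Components of `χ(x)`. -/
def chiC (τ lam x : ℂ) (s t : Fin 2) : ℂ :=
  if s = 0 ∧ t = 1 then th1 (x + lam) (2*τ) * th4 (x - lam - 2*ηc) (2*τ)
  else if s = 1 ∧ t = 0 then th1 (x - lam - 2*ηc) (2*τ) * th4 (x + lam) (2*τ)
  else 0

/-- Components of `χ̄(x)`. -/
def chibarC (τ lam x : ℂ) (s t : Fin 2) : ℂ :=
  if s = 0 ∧ t = 0 then th1 (x + lam) (2*τ) * th1 (x - lam - 2*ηc) (2*τ)
  else if s = 1 ∧ t = 1 then th4 (x - lam - 2*ηc) (2*τ) * th4 (x + lam) (2*τ)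
  else 0

/-- The scalar product `Z_n(x₁,…,x_n) = ⟨ξ_n(x₁,…,x_n), Ψ_n(x₁,−x₁,…,x_n,−x_n,0)⟩`. -/
def Zfun (τ lam : ℂ) (Ψ : PsiFam) (n : ℕ) (x : Fin n → ℂ) : ℂ :=
  ∑ α : Fin (2*n+1) → Fin 2,
    (∏ m : Fin n, chiC τ lam (x m)
        (α ⟨2*(m:ℕ), by have := m.2; omega⟩) (α ⟨2*(m:ℕ)+1, by have := m.2; omega⟩))
      * (if α ⟨2*n, by omega⟩ = 0 then (1:ℂ) else 0)
      * Ψ n (interleave x) α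

/-- The scalar product `Z̄_n^±(x₁,…,x_n)`, with `ε = ±1`. -/
def Zbarfun (τ lam ε : ℂ) (Ψ : PsiFam) (n : ℕ) (x : Fin n → ℂ) : ℂ :=
  ∑ α : Fin (2*n+1) → Fin 2,
    (∏ m : Fin n, chibarC τ lam (x m)
        (α ⟨2*(m:ℕ), by have := m.2; omega⟩) (α ⟨2*(m:ℕ)+1, by have := m.2; omega⟩))
      * (if α ⟨2*n, by omega⟩ = 0 then (1:ℂ) else ε)
      * Ψ n (interleave x) α

/-- The normalisation constant `𝒩_n`. -/
def Ncoef (τ : ℂ) (n : ℕ) : ℂ :=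
  (-1 : ℂ) ^ ((n+1)/2) * (th1 ηc τ ^ (n^2))⁻¹ * (th4 0 (2*τ) / th4 ηc (2*τ)) ^ (n*(n+1)/2)

/-- The vector `ψ_n = 𝒩_n Ψ_n(0,…,0)`. -/
def psiH (τ : ℂ) (Ψ : PsiFam) (n : ℕ) (α : Fin (2*n+1) → Fin 2) : ℂ :=
  Ncoef τ n * Ψ n (fun _ => 0) α

/-- The scalar product `S_n(μ) = ((⟨↑↓| + μ⟨↓↑|)^{⊗n} ⊗ ⟨↑|) ψ_n`. -/
def Sfun (τ : ℂ) (Ψ : PsiFam) (n : ℕ) (μ : ℂ) : ℂ :=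
  ∑ α : Fin (2*n+1) → Fin 2,
    (∏ m : Fin n,
      (if α ⟨2*(m:ℕ), by have := m.2; omega⟩ = 0 ∧ α ⟨2*(m:ℕ)+1, by have := m.2; omega⟩ = 1
        then (1:ℂ)
       else if α ⟨2*(m:ℕ), by have := m.2; omega⟩ = 1 ∧ α ⟨2*(m:ℕ)+1, by have := m.2; omega⟩ = 0
        then μ
       else 0))
      * (if α ⟨2*n, by omega⟩ = 0 then (1:ℂ) else 0) * psiH τ Ψ n α

/-- The scalar product `S̄_n^±(ν) = ((⟨↑↑| + ν⟨↓↓|)^{⊗n} ⊗ (⟨↑| ± ⟨↓|)) ψ_n`, with `ε = ±1`. -/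
def Sbarfun (τ ε : ℂ) (Ψ : PsiFam) (n : ℕ) (ν : ℂ) : ℂ :=
  ∑ α : Fin (2*n+1) → Fin 2,
    (∏ m : Fin n,
      (if α ⟨2*(m:ℕ), by have := m.2; omega⟩ = 0 ∧ α ⟨2*(m:ℕ)+1, by have := m.2; omega⟩ = 0
        then (1:ℂ)
       else if α ⟨2*(m:ℕ), by have := m.2; omega⟩ = 1 ∧ α ⟨2*(m:ℕ)+1, by have := m.2; omega⟩ = 1
        then ν
       else 0))
      * (if α ⟨2*n, by omega⟩ = 0 then (1:ℂ) else ε) * psiH τ Ψ n α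

/-- The alternating spin configuration `↑↓↑↓⋯↑`. -/
def altConf {L : ℕ} : Fin L → Fin 2 := fun j => if (j : ℕ) % 2 = 0 then 0 else 1

/-- The fully polarised spin configuration `↓⋯↓`. -/
def downConf {L : ℕ} : Fin L → Fin 2 := fun _ => 1

/-- The spin configuration `↑⋯↑↓` with a single `↓` at the last site. -/
def lastDownConf {n : ℕ} : Fin (2*n+1) → Fin 2 := fun j => if (j : ℕ) = 2*n then 1 else 0

/-- `J₂ = −1/2`. -/
def J2c : ℂ := -(1/2)
/-- `J₃ = 1/(1+ζ)`. -/
def J3c (ζ : ℂ) : ℂ := 1/(1+ζ)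
/-- `J₄ = 1/(1−ζ)`. -/
def J4c (ζ : ℂ) : ℂ := 1/(1-ζ)
/-- `μ̄ = (μ−1)²/((ζ²−1)μ)`. -/
def mubar (ζ μ : ℂ) : ℂ := (μ - 1)^2 / ((ζ^2 - 1)*μ)
/-- `ν̄ = (ν−ζ)(νζ−1)/((ζ²−1)ν)`. -/
def nubar (ζ ν : ℂ) : ℂ := (ν - ζ)*(ν*ζ - 1) / ((ζ^2 - 1)*ν)

/-- The elliptic function `w(x)`. -/
def wfun (τ x : ℂ) : ℂ :=
  th4 ηc (2*τ) / th4 0 (2*τ) * th1 x τ ^ 2 / (th1 (x - ηc) τ * th1 (x + ηc) τ)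

/-- `β₂ = η + π/2`. -/
def β2c : ℂ := ηc + (Real.pi : ℂ)/2
/-- `β₃ = η + π/2 + πτ/2`. -/
def β3c (τ : ℂ) : ℂ := ηc + (Real.pi : ℂ)/2 + (Real.pi : ℂ)*τ/2
/-- `β₄ = η + πτ/2`. -/
def β4c (τ : ℂ) : ℂ := ηc + (Real.pi : ℂ)*τ/2

/-- `f` is an (even) theta function of degree `m`, nome `p = e^{iπτ}` and norm `0`
with respect to each of its variables. -/
def ThetaLike (τ : ℂ) (m : ℕ) {n : ℕ} (X : (Fin n → ℂ) → ℂ) : Prop :=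
  ∀ (x : Fin n → ℂ) (i : Fin n),
    Differentiable ℂ (fun z => X (Function.update x i z)) ∧
    (∀ z, X (Function.update x i (z + Real.pi)) = X (Function.update x i z)) ∧
    (∀ z, X (Function.update x i (z + Real.pi * τ))
        = ((-(pnome τ)) ^ m)⁻¹ * Complex.exp (-2 * Complex.I * ((m : ℂ) * z))
            * X (Function.update x i z)) ∧
    (∀ z, X (Function.update x i (-z)) = X (Function.update x i z))

/-! ### Elementary properties of the theta functions -/

lemma th3_eq_jacobi (z τ : ℂ) : th3 z τ = jacobiTheta₂ (z / Real.pi) τ := by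
  have hpi : (Real.pi : ℂ) ≠ 0 := by exact_mod_cast Real.pi_ne_zero
  unfold th3 jacobiTheta₂ jacobiTheta₂_term
  refine tsum_congr fun n => ?_
  congr 1
  field_simp
  ring

lemma th4_eq_th3 (z τ : ℂ) : th4 z τ = th3 (z + Real.pi / 2) τ := by
  unfold th4 th3
  refine tsum_congr fun n => ?_
  rw [← Complex.exp_pi_mul_I, ← Complex.exp_int_mul, ← Complex.exp_add]
  congr 1
  ring

lemma th2_eq_th3 (z τ : ℂ) :
    th2 z τ = cexp (Real.pi * I * τ / 4 + I * z) * th3 (z + Real.pi * τ / 2) τ := by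
  unfold th2 th3
  rw [← tsum_mul_left]
  refine tsum_congr fun n => ?_
  rw [← Complex.exp_add]
  congr 1
  ring

lemma th1_eq_th2 (z τ : ℂ) : th1 z τ = - th2 (z + Real.pi / 2) τ := by
  unfold th1 th2
  rw [← tsum_mul_left, ← tsum_neg]
  refine tsum_congr fun n => ?_
  have h : cexp (Real.pi / 2 * I) = I := Complex.exp_pi_div_two_mul_I
  rw [show (Real.pi : ℂ) * I * τ * ((n : ℂ) + 1 / 2) ^ 2
      + (2 * (n : ℂ) + 1) * I * (z + Real.pi / 2)
      = (Real.pi * I * τ * ((n : ℂ) + 1 / 2) ^ 2 + (2 * (n : ℂ) + 1) * I * z)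
        + (n * (Real.pi * I) + Real.pi / 2 * I) by ring, Complex.exp_add _ (_ + Real.pi / 2 * I),
    Complex.exp_add (n * (Real.pi * I)), h, Complex.exp_int_mul, Complex.exp_pi_mul_I]
  ring

lemma th3_add_pi (z τ : ℂ) : th3 (z + Real.pi) τ = th3 z τ := by
  have hpi : (Real.pi : ℂ) ≠ 0 := by exact_mod_cast Real.pi_ne_zero
  rw [th3_eq_jacobi, th3_eq_jacobi, add_div, div_self hpi, jacobiTheta₂_add_left]

lemma th3_neg (z τ : ℂ) : th3 (-z) τ = th3 z τ := by
  rw [th3_eq_jacobi, th3_eq_jacobi, neg_div, jacobiTheta₂_neg_left]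

lemma th3_add_tau (z τ : ℂ) :
    th3 (z + Real.pi * τ) τ = cexp (-(Real.pi * I * τ) - 2 * I * z) * th3 z τ := by
  have hpi : (Real.pi : ℂ) ≠ 0 := by exact_mod_cast Real.pi_ne_zero
  rw [th3_eq_jacobi, th3_eq_jacobi, add_div, mul_div_cancel_left₀ _ hpi, jacobiTheta₂_add_left']
  congr 2
  field_simp
  ring

lemma th3_add_half_pi (z τ : ℂ) : th3 (z + Real.pi / 2) τ = th4 z τ := (th4_eq_th3 z τ).symm

lemma th4_add_half_pi (z τ : ℂ) : th4 (z + Real.pi / 2) τ = th3 z τ := by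
  rw [th4_eq_th3, add_assoc, add_halves, th3_add_pi]

lemma th4_add_pi (z τ : ℂ) : th4 (z + Real.pi) τ = th4 z τ := by
  rw [th4_eq_th3, th4_eq_th3, add_right_comm, th3_add_pi]

lemma th4_neg (z τ : ℂ) : th4 (-z) τ = th4 z τ := by
  rw [th4_eq_th3, th4_eq_th3, ← th3_neg, ← th3_add_pi]
  ring_nf

lemma th2_add_pi (z τ : ℂ) : th2 (z + Real.pi) τ = - th2 z τ := by
  rw [th2_eq_th3, th2_eq_th3, add_right_comm, th3_add_pi,
    show (Real.pi : ℂ) * I * τ / 4 + I * (z + Real.pi)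
      = (Real.pi * I * τ / 4 + I * z) + Real.pi * I by ring, Complex.exp_add,
    Complex.exp_pi_mul_I]
  ring

lemma th2_add_half_pi (z τ : ℂ) : th2 (z + Real.pi / 2) τ = - th1 z τ := by
  rw [th1_eq_th2, neg_neg]

lemma th1_add_half_pi (z τ : ℂ) : th1 (z + Real.pi / 2) τ = th2 z τ := by
  rw [th1_eq_th2, add_assoc, add_halves, th2_add_pi, neg_neg]

lemma th1_add_pi (z τ : ℂ) : th1 (z + Real.pi) τ = - th1 z τ := by
  rw [th1_eq_th2, th1_eq_th2, add_right_comm, th2_add_pi]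

lemma th2_neg (z τ : ℂ) : th2 (-z) τ = th2 z τ := by
  rw [th2_eq_th3, th2_eq_th3, ← th3_neg,
    show -(-z + (Real.pi : ℂ) * τ / 2) = (z - Real.pi * τ / 2) by ring,
    show z + (Real.pi : ℂ) * τ / 2 = (z - Real.pi * τ / 2) + Real.pi * τ by ring, th3_add_tau,
    ← mul_assoc, ← Complex.exp_add]
  ring_nf

lemma th1_neg (z τ : ℂ) : th1 (-z) τ = - th1 z τ := by
  rw [th1_eq_th2, th1_eq_th2, ← th2_neg, ← neg_neg (th2 (-(-z + _)) τ), ← th2_add_pi]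
  ring_nf

lemma th1_zero (τ : ℂ) : th1 0 τ = 0 := by
  have h := th1_neg 0 τ
  rw [neg_zero] at h
  linear_combination h / 2

lemma th2_add_half_tau (z τ : ℂ) :
    th2 (z + Real.pi * τ / 2) τ = cexp (-(Real.pi * I * τ / 4) - I * z) * th3 z τ := by
  rw [th2_eq_th3, add_assoc, add_halves, th3_add_tau, ← mul_assoc, ← Complex.exp_add]
  ring_nf

lemma th3_add_half_tau (z τ : ℂ) :
    th3 (z + Real.pi * τ / 2) τ = cexp (-(Real.pi * I * τ / 4) - I * z) * th2 z τ := by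
  rw [th2_eq_th3, ← mul_assoc, ← Complex.exp_add]
  ring_nf
  simp

lemma th4_add_half_tau (z τ : ℂ) :
    th4 (z + Real.pi * τ / 2) τ = I * cexp (-(Real.pi * I * τ / 4) - I * z) * th1 z τ := by
  have h : cexp (Real.pi / 2 * I) = I := Complex.exp_pi_div_two_mul_I
  rw [th4_eq_th3, add_right_comm, th3_add_half_tau, th1_eq_th2,
    show -((Real.pi : ℂ) * I * τ / 4) - I * (z + Real.pi / 2)
      = (-(Real.pi * I * τ / 4) - I * z) + - (Real.pi / 2 * I) by ring, Complex.exp_add,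
    Complex.exp_neg, h, Complex.inv_I]
  ring

lemma th1_add_half_tau (z τ : ℂ) :
    th1 (z + Real.pi * τ / 2) τ = I * cexp (-(Real.pi * I * τ / 4) - I * z) * th4 z τ := by
  have h : cexp (Real.pi / 2 * I) = I := Complex.exp_pi_div_two_mul_I
  rw [th1_eq_th2, add_right_comm, th2_add_half_tau, th4_eq_th3,
    show -((Real.pi : ℂ) * I * τ / 4) - I * (z + Real.pi / 2)
      = (-(Real.pi * I * τ / 4) - I * z) + - (Real.pi / 2 * I) by ring, Complex.exp_add,
    Complex.exp_neg, h, Complex.inv_I]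
  ring

lemma th1_add_tau (z τ : ℂ) :
    th1 (z + Real.pi * τ) τ = - cexp (-(Real.pi * I * τ) - 2 * I * z) * th1 z τ := by
  rw [show z + (Real.pi : ℂ) * τ = (z + Real.pi * τ / 2) + Real.pi * τ / 2 by ring,
    th1_add_half_tau, th4_add_half_tau,
    show -((Real.pi : ℂ) * I * τ) - 2 * I * z = (-(Real.pi * I * τ / 4) - I * z)
      + (-(Real.pi * I * τ / 4) - I * (z + Real.pi * τ / 2)) by ring, Complex.exp_add]
  linear_combination (cexp (-(Real.pi * I * τ / 4) - I * z)
      * cexp (-(Real.pi * I * τ / 4) - I * (z + Real.pi * τ / 2)) * th1 z τ) * I_sq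

lemma th4_add_tau (z τ : ℂ) :
    th4 (z + Real.pi * τ) τ = - cexp (-(Real.pi * I * τ) - 2 * I * z) * th4 z τ := by
  rw [show z + (Real.pi : ℂ) * τ = (z + Real.pi * τ / 2) + Real.pi * τ / 2 by ring,
    th4_add_half_tau, th1_add_half_tau,
    show -((Real.pi : ℂ) * I * τ) - 2 * I * z = (-(Real.pi * I * τ / 4) - I * z)
      + (-(Real.pi * I * τ / 4) - I * (z + Real.pi * τ / 2)) by ring, Complex.exp_add]
  linear_combination (cexp (-(Real.pi * I * τ / 4) - I * z)
      * cexp (-(Real.pi * I * τ / 4) - I * (z + Real.pi * τ / 2)) * th4 z τ) * I_sq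

lemma differentiable_th3 {τ : ℂ} (hτ : 0 < τ.im) : Differentiable ℂ fun z => th3 z τ := by
  intro z
  have h := (differentiableAt_jacobiTheta₂_fst (z / Real.pi) hτ)
  have h2 : DifferentiableAt ℂ (fun z : ℂ => z / (Real.pi : ℂ)) z := by fun_prop
  have := h.comp z h2
  simpa [Function.comp_def, ← th3_eq_jacobi] using this

lemma differentiable_th4 {τ : ℂ} (hτ : 0 < τ.im) : Differentiable ℂ fun z => th4 z τ := by
  simp only [th4_eq_th3]
  exact (differentiable_th3 hτ).comp (f := fun z : ℂ => z + Real.pi / 2) (by fun_prop)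

lemma differentiable_th2 {τ : ℂ} (hτ : 0 < τ.im) : Differentiable ℂ fun z => th2 z τ := by
  simp only [th2_eq_th3]
  have := (differentiable_th3 hτ).comp (f := fun z : ℂ => z + Real.pi * τ / 2) (by fun_prop)
  simp only [Function.comp_def] at this
  fun_prop

lemma differentiable_th1 {τ : ℂ} (hτ : 0 < τ.im) : Differentiable ℂ fun z => th1 z τ := by
  simp only [th1_eq_th2]
  have := (differentiable_th2 hτ).comp (f := fun z : ℂ => z + Real.pi / 2) (by fun_prop)
  simp only [Function.comp_def] at this
  fun_prop

lemma two_mul_im_pos {τ : ℂ} (hτ : 0 < τ.im) : 0 < (2 * τ).im := by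
  simpa using hτ

/-! ### Product formulas -/

/-- Pairs of integers, split according to the parity of their sum. -/
def pairParityEquiv : (ℤ × ℤ) ⊕ (ℤ × ℤ) ≃ ℤ × ℤ where
  toFun := Sum.elim (fun x => (x.1 + x.2, x.1 - x.2)) (fun x => (x.1 + x.2 + 1, x.1 - x.2))
  invFun y := if (y.1 + y.2) % 2 = 0 then Sum.inl ((y.1 + y.2) / 2, (y.1 - y.2) / 2)
    else Sum.inr ((y.1 + y.2 - 1) / 2, (y.1 - y.2 - 1) / 2)
  left_inv := by
    rintro (⟨a, b⟩ | ⟨a, b⟩)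
    · have h : (a + b + (a - b)) % 2 = 0 := by omega
      simp only [Sum.elim_inl, h, if_true]
      congr 2 <;> omega
    · have h : (a + b + 1 + (a - b)) % 2 ≠ 0 := by omega
      simp only [Sum.elim_inr, h, if_false]
      congr 2 <;> omega
  right_inv := by
    rintro ⟨a, b⟩
    by_cases h : (a + b) % 2 = 0
    · simp only [h, if_true, Sum.elim_inl]
      ext <;> simp only [] <;> omega
    · simp only [h, if_false, Sum.elim_inr]
      ext <;> simp only [] <;> omega

lemma summable_th3_term {τ : ℂ} (hτ : 0 < τ.im) (z : ℂ) : Summable fun n : ℤ =>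
    cexp ((Real.pi : ℂ) * I * τ * (n : ℂ) ^ 2 + 2 * (n : ℂ) * I * z) := by
  have hpi : (Real.pi : ℂ) ≠ 0 := by exact_mod_cast Real.pi_ne_zero
  refine ((summable_jacobiTheta₂_term_iff (z / Real.pi) τ).2 hτ).congr fun n => ?_
  unfold jacobiTheta₂_term
  congr 1
  field_simp
  ring

lemma summable_th2_term {τ : ℂ} (hτ : 0 < τ.im) (z : ℂ) : Summable fun n : ℤ =>
    cexp ((Real.pi : ℂ) * I * τ * ((n : ℂ) + 1/2) ^ 2 + (2 * (n : ℂ) + 1) * I * z) := by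
  refine ((summable_th3_term hτ (z + Real.pi * τ / 2)).mul_left
    (cexp (Real.pi * I * τ / 4 + I * z))).congr fun n => ?_
  rw [← Complex.exp_add]
  congr 1
  ring

lemma th3_mul_th3 {τ : ℂ} (hτ : 0 < τ.im) (u v : ℂ) :
    th3 u τ * th3 v τ = th3 (u + v) (2 * τ) * th3 (u - v) (2 * τ)
      + th2 (u + v) (2 * τ) * th2 (u - v) (2 * τ) := by
  have h2 := two_mul_im_pos hτ
  unfold th3 th2
  have hs := summable_mul_of_summable_norm (summable_th3_term hτ u).norm
    (summable_th3_term hτ v).norm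
  have hs' := (pairParityEquiv.summable_iff).2 hs
  rw [tsum_mul_tsum_of_summable_norm (summable_th3_term hτ u).norm (summable_th3_term hτ v).norm,
    tsum_mul_tsum_of_summable_norm (summable_th3_term h2 _).norm (summable_th3_term h2 _).norm,
    tsum_mul_tsum_of_summable_norm (summable_th2_term h2 _).norm (summable_th2_term h2 _).norm,
    ← pairParityEquiv.tsum_eq, Summable.tsum_sum]
  · congr 1 <;> refine tsum_congr fun x => ?_ <;> rw [← Complex.exp_add, ← Complex.exp_add] <;>
      congr 1 <;> simp only [pairParityEquiv, Equiv.coe_fn_mk, Sum.elim_inl, Sum.elim_inr] <;>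
      push_cast <;> ring
  · exact hs'.comp_injective Sum.inl_injective
  · exact hs'.comp_injective Sum.inr_injective

lemma th2_mul_th2 {τ : ℂ} (hτ : 0 < τ.im) (u v : ℂ) :
    th2 u τ * th2 v τ = th2 (u + v) (2 * τ) * th3 (u - v) (2 * τ)
      + th3 (u + v) (2 * τ) * th2 (u - v) (2 * τ) := by
  have h := th3_mul_th3 hτ (u + Real.pi * τ / 2) (v + Real.pi * τ / 2)
  rw [show u + (Real.pi : ℂ) * τ / 2 + (v + Real.pi * τ / 2) = (u + v) + Real.pi * (2 * τ) / 2 by ring,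
    show u + (Real.pi : ℂ) * τ / 2 - (v + Real.pi * τ / 2) = u - v by ring,
    th3_add_half_tau, th3_add_half_tau, th3_add_half_tau, th2_add_half_tau,
    show -((Real.pi : ℂ) * I * (2 * τ) / 4) - I * (u + v) = (-(Real.pi * I * τ / 4) - I * u)
      + (-(Real.pi * I * τ / 4) - I * v) by ring, Complex.exp_add] at h
  have h1 := Complex.exp_ne_zero (-(Real.pi * I * τ / 4) - I * u)
  have h2 := Complex.exp_ne_zero (-(Real.pi * I * τ / 4) - I * v)
  refine mul_left_cancel₀ (mul_ne_zero h1 h2) ?_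
  linear_combination h

/-- The Landen-type identity. -/
lemma th1_mul_th2 {τ : ℂ} (hτ : 0 < τ.im) (x y : ℂ) :
    th1 x τ * th2 y τ = th1 (x + y) (2 * τ) * th4 (x - y) (2 * τ)
      + th4 (x + y) (2 * τ) * th1 (x - y) (2 * τ) := by
  have h := th2_mul_th2 hτ (x + Real.pi / 2) y
  rw [show x + (Real.pi : ℂ) / 2 + y = (x + y) + Real.pi / 2 by ring,
    show x + (Real.pi : ℂ) / 2 - y = (x - y) + Real.pi / 2 by ring] at h
  simp only [th2_add_half_pi, th3_add_half_pi] at h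
  linear_combination -h

lemma th1_mul_th1 {τ : ℂ} (hτ : 0 < τ.im) (u v : ℂ) :
    th1 u τ * th1 v τ = th3 (u + v) (2 * τ) * th2 (u - v) (2 * τ)
      - th2 (u + v) (2 * τ) * th3 (u - v) (2 * τ) := by
  have h := th2_mul_th2 hτ (u + Real.pi / 2) (v + Real.pi / 2)
  rw [show u + (Real.pi : ℂ) / 2 + (v + Real.pi / 2) = (u + v) + Real.pi by ring,
    show u + (Real.pi : ℂ) / 2 - (v + Real.pi / 2) = (u - v) by ring] at h
  simp only [th2_add_half_pi, th2_add_pi, th3_add_pi] at h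
  linear_combination h

lemma th4_mul_th4 {τ : ℂ} (hτ : 0 < τ.im) (u v : ℂ) :
    th4 u τ * th4 v τ = th3 (u + v) (2 * τ) * th3 (u - v) (2 * τ)
      - th2 (u + v) (2 * τ) * th2 (u - v) (2 * τ) := by
  have h := th3_mul_th3 hτ (u + Real.pi / 2) (v + Real.pi / 2)
  rw [show u + (Real.pi : ℂ) / 2 + (v + Real.pi / 2) = (u + v) + Real.pi by ring,
    show u + (Real.pi : ℂ) / 2 - (v + Real.pi / 2) = (u - v) by ring] at h
  simp only [th3_add_half_pi, th2_add_pi, th3_add_pi] at h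
  linear_combination h

lemma th1_add_mul_th1_sub {τ : ℂ} (hτ : 0 < τ.im) (x y : ℂ) :
    th1 (x + y) τ * th1 (x - y) τ * th4 0 τ ^ 2
      = th1 x τ ^ 2 * th4 y τ ^ 2 - th4 x τ ^ 2 * th1 y τ ^ 2 := by
  have h1 := th1_mul_th1 hτ (x + y) (x - y)
  have h2 := th4_mul_th4 hτ 0 0
  have h3 := th1_mul_th1 hτ x x
  have h4 := th1_mul_th1 hτ y y
  have h5 := th4_mul_th4 hτ x x
  have h6 := th4_mul_th4 hτ y y
  rw [show x + y + (x - y) = x + x by ring, show x + y - (x - y) = y + y by ring] at h1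
  simp only [sub_self, add_zero] at h2 h3 h4 h5 h6
  simp only [sq]
  rw [h1, h2, h3, h4, h5, h6]
  ring

lemma th4_add_mul_th4_sub {τ : ℂ} (hτ : 0 < τ.im) (x y : ℂ) :
    th4 (x + y) τ * th4 (x - y) τ * th4 0 τ ^ 2
      = th4 x τ ^ 2 * th4 y τ ^ 2 - th1 x τ ^ 2 * th1 y τ ^ 2 := by
  have h1 := th4_mul_th4 hτ (x + y) (x - y)
  have h2 := th4_mul_th4 hτ 0 0
  have h3 := th1_mul_th1 hτ x x
  have h4 := th1_mul_th1 hτ y y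
  have h5 := th4_mul_th4 hτ x x
  have h6 := th4_mul_th4 hτ y y
  rw [show x + y + (x - y) = x + x by ring, show x + y - (x - y) = y + y by ring] at h1
  simp only [sub_self, add_zero] at h2 h3 h4 h5 h6
  simp only [sq]
  rw [h1, h2, h3, h4, h5, h6]
  ring

/-! ### Fourier coefficients of quasi-periodic entire functions -/

/-- Entire functions with `f(z+1) = f(z)` and `f(z+σ) = A e^{-2πimz} f(z)`. -/
def quasiPeriodic (σ A : ℂ) (m : ℕ) : Submodule ℂ (ℂ → ℂ) where
  carrier := {f | Differentiable ℂ f ∧ (∀ z, f (z + 1) = f z) ∧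
    ∀ z, f (z + σ) = A * cexp (-2 * Real.pi * I * m * z) * f z}
  add_mem' := by
    rintro f g ⟨hf, hf1, hfs⟩ ⟨hg, hg1, hgs⟩
    refine ⟨hf.add hg, fun z => ?_, fun z => ?_⟩
    · simp only [Pi.add_apply, hf1, hg1]
    · simp only [Pi.add_apply, hfs, hgs]
      ring
  zero_mem' := ⟨differentiable_const 0, fun _ => rfl, fun z => by simp⟩
  smul_mem' := by
    rintro c f ⟨hf, hf1, hfs⟩
    refine ⟨hf.const_smul c, fun z => ?_, fun z => ?_⟩
    · simp only [Pi.smul_apply, hf1]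
    · simp only [Pi.smul_apply, hfs, smul_eq_mul]
      ring

/-- Fourier coefficients of a function of period one. -/
def fourierC (f : ℂ → ℂ) (n : ℤ) : ℂ :=
  ∫ x in (0 : ℝ)..1, f x * cexp (-2 * Real.pi * I * n * x)

lemma integral_shift_of_periodic {g : ℂ → ℂ} (hg : Differentiable ℂ g)
    (h1 : ∀ z, g (z + 1) = g z) (s : ℂ) :
    ∫ x in (0 : ℝ)..1, g (x + s) = ∫ x in (0 : ℝ)..1, g x := by
  have hper : Function.Periodic (fun x : ℝ => g (x + s.im * I)) 1 := by
    intro x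
    have := h1 (x + s.im * I)
    simp only [ofReal_add, ofReal_one]
    rw [← this]
    ring_nf
  have h2 := hper.intervalIntegral_add_eq s.re 0
  rw [zero_add] at h2
  have h3 : ∫ x in (0 : ℝ)..1, g (x + s) = ∫ x in s.re..s.re + 1, g (x + s.im * I) := by
    have := intervalIntegral.integral_comp_add_right (a := 0) (b := 1)
      (fun x : ℝ => g (x + s.im * I)) s.re
    rw [zero_add, add_comm 1] at this
    rw [← this]
    refine intervalIntegral.integral_congr fun x _ => ?_
    simp only [ofReal_add]
    conv_lhs => rw [← Complex.re_add_im s]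
    ring_nf
  rw [h3, h2]
  have h4 := Complex.integral_boundary_rect_eq_zero_of_differentiableOn g 0 (1 + s.im * I)
    hg.differentiableOn
  simp only [zero_re, zero_im, add_re, one_re, mul_re, ofReal_re, I_re, mul_zero, ofReal_im, I_im,
    sub_self, add_zero, add_im, one_im, mul_im, mul_one, zero_add, ofReal_zero, zero_mul,
    ofReal_one, smul_eq_mul] at h4
  have h5 : ∫ y in (0 : ℝ)..s.im, g (1 + y * I) = ∫ y in (0 : ℝ)..s.im, g (y * I) := by
    refine intervalIntegral.integral_congr fun y _ => ?_
    rw [add_comm, h1]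
  rw [h5] at h4
  linear_combination -h4

lemma fourierC_rec {σ A : ℂ} {m : ℕ} {f : ℂ → ℂ} (hf : f ∈ quasiPeriodic σ A m) (n : ℤ) :
    fourierC f n = A * cexp (-2 * Real.pi * I * n * σ) * fourierC f (n + m) := by
  obtain ⟨hd, h1, hs⟩ := hf
  have hg : Differentiable ℂ fun z => f z * cexp (-2 * Real.pi * I * n * z) := by fun_prop
  have := integral_shift_of_periodic hg (fun z => ?_) σ
  · unfold fourierC
    rw [← this, ← intervalIntegral.integral_const_mul]
    refine intervalIntegral.integral_congr fun x _ => ?_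
    rw [hs, show (-2 * Real.pi * I * n * (x + σ) : ℂ)
      = -2 * Real.pi * I * n * σ + -2 * Real.pi * I * n * x by ring, Complex.exp_add,
      show (-2 * Real.pi * I * ((n + m : ℤ) : ℂ) * x : ℂ)
      = -2 * Real.pi * I * m * x + -2 * Real.pi * I * n * x by push_cast; ring, Complex.exp_add]
    ring
  · rw [h1, show (-2 * Real.pi * I * n * (z + 1) : ℂ)
      = -2 * Real.pi * I * n * z + ((-n : ℤ) : ℂ) * (2 * Real.pi * I) by push_cast; ring,
      Complex.exp_add, Complex.exp_int_mul_two_pi_mul_I, mul_one]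

lemma fourierC_add {f g : ℂ → ℂ} (hf : Differentiable ℂ f) (hg : Differentiable ℂ g) (n : ℤ) :
    fourierC (f + g) n = fourierC f n + fourierC g n := by
  unfold fourierC
  rw [← intervalIntegral.integral_add]
  · refine intervalIntegral.integral_congr fun x _ => ?_
    simp only [Pi.add_apply]
    ring
  · have := hf.continuous
    exact Continuous.intervalIntegrable (by fun_prop) _ _
  · have := hg.continuous
    exact Continuous.intervalIntegrable (by fun_prop) _ _

lemma fourierC_smul (c : ℂ) (f : ℂ → ℂ) (n : ℤ) :
    fourierC (c • f) n = c * fourierC f n := by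
  unfold fourierC
  rw [← intervalIntegral.integral_const_mul]
  refine intervalIntegral.integral_congr fun x _ => ?_
  simp only [Pi.smul_apply, smul_eq_mul]
  ring

lemma eq_zero_of_fourierC_eq_zero {f : ℂ → ℂ} (hf : Differentiable ℂ f)
    (h1 : ∀ z, f (z + 1) = f z) (h0 : ∀ n, fourierC f n = 0) : f = 0 := by
  have hper : Function.Periodic (fun x : ℝ => f x) 1 := by
    intro x
    simp only [ofReal_add, ofReal_one, h1]
  have : Fact (0 < (1 : ℝ)) := ⟨one_pos⟩
  let F : C(AddCircle (1 : ℝ), ℂ) := ⟨hper.lift, by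
    have := hf.continuous
    exact continuous_coinduced_dom.mpr (by
      change Continuous fun x : ℝ => f x
      fun_prop)⟩
  have hF : ∀ x : ℝ, F (x : AddCircle (1 : ℝ)) = f x := fun x => rfl
  have hc : ∀ n, fourierCoeff F n = 0 := by
    intro n
    rw [fourierCoeff_eq_intervalIntegral F n 0, ← h0 n, fourierC]
    simp only [div_one, one_smul, zero_add]
    refine intervalIntegral.integral_congr fun x _ => ?_
    simp only [hF, smul_eq_mul, fourier_coe_apply]
    rw [mul_comm]
    congr 2
    push_cast
    ring
  have hsum : Summable (fourierCoeff F) := by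
    rw [show fourierCoeff F = fun _ => 0 from funext hc]
    exact summable_zero
  have hreal : ∀ x : ℝ, f x = 0 := by
    intro x
    have := has_pointwise_sum_fourier_series_of_summable hsum (x : AddCircle (1 : ℝ))
    simp only [hc, zero_smul] at this
    rw [← hF]
    exact this.unique hasSum_zero
  have hA : AnalyticOnNhd ℂ f Set.univ := fun z _ => hf.analyticAt z
  have hfreq : ∃ᶠ z in nhdsWithin (0 : ℂ) {0}ᶜ, f z = 0 := by
    have ht : Filter.Tendsto (fun n : ℕ => (((1 : ℝ) / (n + 1) : ℝ) : ℂ)) Filter.atTop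
        (nhdsWithin (0 : ℂ) {0}ᶜ) := by
      refine tendsto_nhdsWithin_iff.2 ⟨?_, Filter.Eventually.of_forall fun n => ?_⟩
      · have := tendsto_one_div_add_atTop_nhds_zero_nat (𝕜 := ℝ)
        simpa [Function.comp_def] using (continuous_ofReal.tendsto 0).comp this
      · have : (0 : ℝ) < 1 / (n + 1) := by positivity
        simpa using (by exact_mod_cast this.ne' : ((((1 : ℝ) / (n + 1) : ℝ) : ℂ)) ≠ 0)
    exact ht.frequently (Filter.Frequently.of_forall fun n => hreal _)
  funext z
  exact hA.eqOn_zero_of_preconnected_of_frequently_eq_zero isPreconnected_univ (Set.mem_univ 0)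
    hfreq (Set.mem_univ z)

lemma quasiPeriodic_eq_zero {σ A : ℂ} {m : ℕ} (hm : 0 < m) {f : ℂ → ℂ}
    (hf : f ∈ quasiPeriodic σ A m) (n₀ : ℤ)
    (h : ∀ n, n₀ ≤ n → n < n₀ + m → fourierC f n = 0) : f = 0 := by
  by_cases hA : A = 0
  · funext z
    have := hf.2.2 (z - σ)
    simpa [hA] using this
  refine eq_zero_of_fourierC_eq_zero hf.1 hf.2.1 fun n => ?_
  have hm' : (m : ℤ) ≠ 0 := by exact_mod_cast hm.ne'
  have key : ∀ (r : ℤ), fourierC f r = 0 → ∀ j : ℤ, fourierC f (r + m * j) = 0 := by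
    intro r hr j
    induction j using Int.induction_on with
    | zero => simpa using hr
    | succ i ih =>
      have := fourierC_rec hf (r + m * i)
      rw [ih] at this
      have hne : A * cexp (-2 * Real.pi * I * ((r + m * i : ℤ) : ℂ) * σ) ≠ 0 :=
        mul_ne_zero hA (Complex.exp_ne_zero _)
      have h2 := (mul_eq_zero.1 this.symm).resolve_left hne
      rw [← h2]
      congr 1
      ring
    | pred i ih =>
      rw [fourierC_rec hf, show r + (m : ℤ) * (-(i : ℤ) - 1) + m = r + m * -(i : ℤ) by ring, ih,
        mul_zero]
  have hr := key (n₀ + (n - n₀) % m) (h _ (by have := Int.emod_nonneg (n - n₀) hm'; omega)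
    (by have := Int.emod_lt_of_pos (n - n₀) (by exact_mod_cast hm : (0 : ℤ) < m); omega))
    ((n - n₀) / m)
  rw [← hr]
  congr 1
  have := Int.emod_add_mul_ediv (n - n₀) m
  linarith

/-- The map to a window of Fourier coefficients. -/
def fourierWindow (σ A : ℂ) (m : ℕ) (n₀ : ℤ) (N : ℕ) :
    quasiPeriodic σ A m →ₗ[ℂ] (Fin N → ℂ) where
  toFun f j := fourierC f.1 (n₀ + j)
  map_add' f g := by
    funext j
    exact fourierC_add f.2.1 g.2.1 _
  map_smul' c f := by
    funext j
    exact fourierC_smul c _ _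

lemma fourierWindow_injective (σ A : ℂ) {m : ℕ} (hm : 0 < m) (n₀ : ℤ) :
    Function.Injective (fourierWindow σ A m n₀ m) := by
  rw [← LinearMap.ker_eq_bot, LinearMap.ker_eq_bot']
  rintro ⟨f, hf⟩ h0
  refine Subtype.ext (quasiPeriodic_eq_zero hm hf n₀ fun n h1 h2 => ?_)
  have := congrFun h0 ⟨(n - n₀).toNat, by omega⟩
  simp only [fourierWindow, LinearMap.coe_mk, AddHom.coe_mk, Pi.zero_apply] at this
  rw [← this]
  congr 1
  omega

lemma finite_quasiPeriodic (σ A : ℂ) {m : ℕ} (hm : 0 < m) :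
    FiniteDimensional ℂ (quasiPeriodic σ A m) :=
  FiniteDimensional.of_injective _ (fourierWindow_injective σ A hm 0)

/-- In degree one all quasi-periodic functions are proportional. -/
lemma quasiPeriodic_one_proportional {σ A : ℂ} {f g : ℂ → ℂ} (hf : f ∈ quasiPeriodic σ A 1)
    (hg : g ∈ quasiPeriodic σ A 1) (z w : ℂ) : f z * g w = f w * g z := by
  have h1 : fourierC g 0 • f - fourierC f 0 • g = 0 := by
    refine quasiPeriodic_eq_zero one_pos
      (Submodule.sub_mem _ (Submodule.smul_mem _ _ hf) (Submodule.smul_mem _ _ hg)) 0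
      fun n h1 h2 => ?_
    obtain rfl : n = 0 := by simp at h2; omega
    rw [sub_eq_add_neg, ← neg_smul, fourierC_add (hf.1.const_smul _) (hg.1.const_smul _),
      fourierC_smul, fourierC_smul]
    ring
  have h2 : ∀ x, fourierC g 0 * f x = fourierC f 0 * g x := fun x => by
    have := congrFun h1 x
    simp only [Pi.sub_apply, Pi.smul_apply, smul_eq_mul, Pi.zero_apply] at this
    linear_combination this
  have key : ∀ k ∈ quasiPeriodic σ A 1, fourierC k 0 = 0 → k = 0 := fun k hk h0 =>
    quasiPeriodic_eq_zero one_pos hk 0 fun n h1 h2 => by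
      obtain rfl : n = 0 := by simp at h2; omega
      exact h0
  by_cases hg0 : fourierC g 0 = 0
  · simp [key g hg hg0]
  · refine mul_left_cancel₀ hg0 ?_
    linear_combination g w * h2 z - g z * h2 w

/-- Interpolation nodes for a finite-dimensional space of functions. -/
lemma exists_interpolation_nodes {X : Type*} (V : Submodule ℂ (X → ℂ)) [FiniteDimensional ℂ V] :
    ∃ (N : ℕ) (a : Fin N → X) (L : Fin N → X → ℂ), (∀ j, L j ∈ V) ∧
      ∀ f ∈ V, ∀ x, f x = ∑ j, f (a j) * L j x := by
  obtain ⟨d, hd⟩ : ∃ d, Module.finrank ℂ V = d := ⟨_, rfl⟩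
  induction d using Nat.strong_induction_on generalizing V with
  | _ d ih =>
    by_cases hV : V = ⊥
    · refine ⟨0, Fin.elim0, Fin.elim0, fun j => j.elim0, fun f hf x => ?_⟩
      rw [hV, Submodule.mem_bot] at hf
      simp [hf]
    · obtain ⟨g, hg, hg0⟩ := Submodule.exists_mem_ne_zero_of_ne_bot hV
      obtain ⟨a, ha⟩ := Function.ne_iff.1 hg0
      simp only [Pi.zero_apply] at ha
      let W : Submodule ℂ (X → ℂ) := V ⊓ LinearMap.ker (LinearMap.proj a : (X → ℂ) →ₗ[ℂ] ℂ)
      have hWV : W < V := by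
        refine lt_of_le_of_ne inf_le_left fun h => ha ?_
        have : g ∈ W := h ▸ hg
        simpa using this.2
      have : FiniteDimensional ℂ W := Submodule.finiteDimensional_of_le hWV.le
      obtain ⟨N, b, L, hL, hI⟩ := ih _ (hd ▸ Submodule.finrank_lt_finrank_of_lt hWV) W rfl
      have hr : ∀ f ∈ V, (f - (f a / g a) • g) ∈ W := fun f hf =>
        ⟨Submodule.sub_mem _ hf (Submodule.smul_mem _ _ hg), by
          simp [div_mul_cancel₀ _ ha]⟩
      refine ⟨N + 1, Fin.cons a b,
        Fin.cons ((g a)⁻¹ • (g - ∑ j, g (b j) • L j)) L, ?_, ?_⟩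
      · intro j
        refine Fin.cases ?_ (fun j => ?_) j
        · exact Submodule.smul_mem _ _ (Submodule.sub_mem _ hg
            (Submodule.sum_mem _ fun j _ => Submodule.smul_mem _ _ (hL j).1))
        · exact (hL j).1
      · intro f hf x
        have h := hI _ (hr f hf) x
        simp only [Pi.sub_apply, Pi.smul_apply, smul_eq_mul] at h
        rw [Fin.sum_univ_succ]
        simp only [Fin.cons_zero, Fin.cons_succ, Pi.smul_apply, Pi.sub_apply, Finset.sum_apply,
          smul_eq_mul]
        have h2 : ∑ j, (f (b j) - f a / g a * g (b j)) * L j x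
            = ∑ j, f (b j) * L j x - f a / g a * ∑ j, g (b j) * L j x := by
          rw [Finset.mul_sum, ← Finset.sum_sub_distrib]
          exact Finset.sum_congr rfl fun j _ => by ring
        rw [h2] at h
        linear_combination h

/-! ### Zeros of the theta functions -/

/-- The infinite product `∏ (1 - a qⁿ)`. -/
def qPoch (q a : ℂ) : ℂ := ∏' n : ℕ, (1 + -(a * q ^ n))

lemma summable_qPoch {q : ℂ} (hq : ‖q‖ < 1) (a : ℂ) : Summable fun n : ℕ => ‖-(a * q ^ n)‖ := by
  simp only [norm_neg, norm_mul, norm_pow]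
  exact (summable_geometric_of_lt_one (norm_nonneg _) hq).mul_left _

lemma qPoch_rec {q : ℂ} (hq : ‖q‖ < 1) (a : ℂ) : qPoch q a = (1 - a) * qPoch q (a * q) := by
  unfold qPoch
  have h : ∀ n : ℕ, (1 + -(a * q ^ (n + 1))) = 1 + -(a * q * q ^ n) := fun n => by ring
  rw [tprod_eq_zero_mul']
  · simp only [h, pow_zero, mul_one, sub_eq_add_neg]
  · simp only [h]
    exact multipliable_one_add_of_summable (summable_qPoch hq (a * q))

lemma qPoch_ne_zero {q : ℂ} (hq : ‖q‖ < 1) {a : ℂ} (h : ∀ n : ℕ, a * q ^ n ≠ 1) :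
    qPoch q a ≠ 0 :=
  tprod_one_add_ne_zero_of_summable (fun n h0 => h n (by linear_combination -h0))
    (summable_qPoch hq a)

lemma differentiable_qPoch {q : ℂ} (hq : ‖q‖ < 1) : Differentiable ℂ (qPoch q) := by
  intro a
  have h : DifferentiableOn ℂ (qPoch q) (Metric.ball 0 (‖a‖ + 1)) := by
    have hm : MultipliableLocallyUniformlyOn (fun (n : ℕ) (b : ℂ) => 1 + -(b * q ^ n))
        (Metric.ball 0 (‖a‖ + 1)) := by
      refine Summable.multipliableLocallyUniformlyOn_nat_one_add Metric.isOpen_ball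
        ((summable_geometric_of_lt_one (norm_nonneg _) hq).mul_left (‖a‖ + 1))
        (.of_forall fun n x hx => ?_) (fun _ => by fun_prop)
      simp only [norm_neg, norm_mul, norm_pow]
      have : ‖x‖ < ‖a‖ + 1 := by simpa using hx
      gcongr
    exact hm.hasProdLocallyUniformlyOn.differentiableOn
      (.of_forall fun _ => by simpa [Finset.prod_fn] using
        DifferentiableOn.finsetProd (fun _ _ => by fun_prop)) Metric.isOpen_ball
  exact h.differentiableAt (Metric.isOpen_ball.mem_nhds (by simp))

lemma norm_exp_tau_lt_one {τ : ℂ} (hτ : 0 < τ.im) : ‖cexp (2 * Real.pi * I * τ)‖ < 1 := by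
  rw [Complex.norm_exp]
  simp only [Real.exp_lt_one_iff]
  have := Real.pi_pos
  simp
  positivity

lemma exists_th3_ne_zero {τ : ℂ} (hτ : 0 < τ.im) : ∃ z, th3 z τ ≠ 0 := by
  by_contra! h
  have hpi : (Real.pi : ℂ) ≠ 0 := by exact_mod_cast Real.pi_ne_zero
  let F : ℤ → C(ℝ, ℂ) := fun n =>
    ⟨fun x => cexp ((Real.pi : ℂ) * I * τ * (n : ℂ) ^ 2 + 2 * (n : ℂ) * I * (Real.pi * x)),
      by fun_prop⟩
  have hnorm : ∀ (n : ℤ) (x : ℝ), ‖F n x‖ = ‖cexp ((Real.pi : ℂ) * I * τ * (n : ℂ) ^ 2)‖ := by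
    intro n x
    simp only [F, ContinuousMap.coe_mk, Complex.norm_exp]
    congr 1
    simp [mul_re, mul_im, pow_two]
  have hs : Summable fun n : ℤ =>
      ‖(F n).restrict (⟨Set.uIcc (0 : ℝ) 1, isCompact_uIcc⟩ : TopologicalSpace.Compacts ℝ)‖ := by
    have h0 := (summable_th3_term hτ 0).norm
    refine Summable.of_nonneg_of_le (fun n => norm_nonneg _) (fun n => ?_) h0
    rw [ContinuousMap.norm_le _ (norm_nonneg _)]
    intro x
    rw [ContinuousMap.restrict_apply, hnorm]
    simp
  have hI := intervalIntegral.hasSum_intervalIntegral_of_summable_norm (a := 0) (b := 1) (f := F) hs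
  have hz : ∫ x in (0 : ℝ)..1, ∑' n, F n x = 0 := by
    rw [← intervalIntegral.integral_zero (a := 0) (b := 1) (E := ℂ) (μ := MeasureTheory.volume)]
    refine intervalIntegral.integral_congr fun x _ => ?_
    exact h (Real.pi * x)
  have hterm : ∀ n : ℤ, ∫ x in (0 : ℝ)..1, F n x = if n = 0 then 1 else 0 := by
    intro n
    split_ifs with hn
    · subst hn
      simp [F]
    · have hn' : (n : ℂ) ≠ 0 := by exact_mod_cast hn
      have : ∀ x : ℝ, F n x = cexp ((Real.pi : ℂ) * I * τ * (n : ℂ) ^ 2)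
          * cexp ((2 * (n : ℂ) * I * Real.pi) * x) := by
        intro x
        simp only [F, ContinuousMap.coe_mk]
        rw [← Complex.exp_add]
        ring_nf
      simp only [this]
      rw [intervalIntegral.integral_const_mul, integral_exp_mul_complex
        (by simp [hn', hpi, I_ne_zero])]
      rw [show (2 * (n : ℂ) * I * Real.pi) * ((1 : ℝ) : ℂ) = n * (2 * Real.pi * I) by push_cast; ring,
        Complex.exp_int_mul_two_pi_mul_I]
      simp
  rw [hz] at hI
  simp only [hterm] at hI
  have := hI.unique (hasSum_ite_eq (0 : ℤ) (1 : ℂ))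
  exact zero_ne_one this

lemma th4_mem_quasiPeriodic {τ : ℂ} (hτ : 0 < τ.im) :
    (fun z => th4 (Real.pi * z) τ) ∈ quasiPeriodic τ (-cexp (-(Real.pi * I * τ))) 1 := by
  refine ⟨?_, fun z => ?_, fun z => ?_⟩
  · have := (differentiable_th4 hτ).comp (f := fun z : ℂ => Real.pi * z) (by fun_prop)
    simpa [Function.comp_def] using this
  · simp only [mul_add, mul_one, th4_add_pi]
  · simp only [mul_add, th4_add_tau]
    rw [sub_eq_add_neg, Complex.exp_add]
    push_cast
    ring_nf

/-- The theta function `ϑ₄` as an infinite product, up to a constant factor. -/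
lemma th4_product_mem {τ : ℂ} (hτ : 0 < τ.im) :
    (fun z => qPoch (cexp (2 * Real.pi * I * τ)) (cexp (Real.pi * I * τ + 2 * Real.pi * I * z))
      * qPoch (cexp (2 * Real.pi * I * τ)) (cexp (Real.pi * I * τ - 2 * Real.pi * I * z)))
      ∈ quasiPeriodic τ (-cexp (-(Real.pi * I * τ))) 1 := by
  have hq := norm_exp_tau_lt_one hτ
  refine ⟨?_, fun z => ?_, fun z => ?_⟩
  · have h1 := (differentiable_qPoch hq).comp
      (f := fun z : ℂ => cexp (Real.pi * I * τ + 2 * Real.pi * I * z)) (by fun_prop)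
    have h2 := (differentiable_qPoch hq).comp
      (f := fun z : ℂ => cexp (Real.pi * I * τ - 2 * Real.pi * I * z)) (by fun_prop)
    exact h1.mul h2
  · have e1 : cexp (Real.pi * I * τ + 2 * Real.pi * I * (z + 1))
        = cexp (Real.pi * I * τ + 2 * Real.pi * I * z) := by
      rw [mul_add, mul_one, ← add_assoc, Complex.exp_periodic]
    have e2 : cexp (Real.pi * I * τ - 2 * Real.pi * I * (z + 1))
        = cexp (Real.pi * I * τ - 2 * Real.pi * I * z) := by
      rw [mul_add, mul_one, ← sub_sub, Complex.exp_periodic.sub_eq]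
    simp only [e1, e2]
  · simp only [mul_add]
    have h1 := qPoch_rec hq (cexp (Real.pi * I * τ + 2 * Real.pi * I * z))
    have h2 := qPoch_rec hq (cexp (Real.pi * I * τ - (2 * Real.pi * I * z + 2 * Real.pi * I * τ)))
    rw [← Complex.exp_add] at h1 h2
    rw [← add_assoc, h1, h2,
      show (Real.pi * I * τ - (2 * Real.pi * I * z + 2 * Real.pi * I * τ) + 2 * Real.pi * I * τ : ℂ)
        = Real.pi * I * τ - 2 * Real.pi * I * z by ring,
      show (Real.pi * I * τ - (2 * Real.pi * I * z + 2 * Real.pi * I * τ) : ℂ)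
        = -(Real.pi * I * τ) + -(2 * Real.pi * I * z) by ring,
      show (-2 * Real.pi * I * ((1 : ℕ) : ℂ) * z : ℂ) = -(2 * Real.pi * I * z) by push_cast; ring]
    have e : cexp (-(Real.pi * I * τ) + -(2 * Real.pi * I * z))
        * cexp (Real.pi * I * τ + 2 * Real.pi * I * z) = 1 := by
      rw [← Complex.exp_add, ← Complex.exp_zero]
      ring_nf
    have e3 := Complex.exp_add (-(Real.pi * I * τ)) (-(2 * Real.pi * I * z))
    linear_combination (qPoch (cexp (2 * Real.pi * I * τ)) (cexp (Real.pi * I * τ + 2 * Real.pi * I * z + 2 * Real.pi * I * τ))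
      * qPoch (cexp (2 * Real.pi * I * τ)) (cexp (Real.pi * I * τ - 2 * Real.pi * I * z))) *
      (-e - (1 - cexp (Real.pi * I * τ + 2 * Real.pi * I * z)) * e3)

lemma th4_ne_zero_of_factors {τ : ℂ} (hτ : 0 < τ.im) (z : ℂ)
    (h1 : ∀ n : ℕ, cexp ((2 * n + 1) * (Real.pi * I * τ) + 2 * I * z) ≠ 1)
    (h2 : ∀ n : ℕ, cexp ((2 * n + 1) * (Real.pi * I * τ) - 2 * I * z) ≠ 1) : th4 z τ ≠ 0 := by
  have hpi : (Real.pi : ℂ) ≠ 0 := by exact_mod_cast Real.pi_ne_zero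
  have hq := norm_exp_tau_lt_one hτ
  obtain ⟨w, hw⟩ := exists_th3_ne_zero hτ
  have hw' : th4 (Real.pi * ((w + Real.pi / 2) / Real.pi)) τ ≠ 0 := by
    rwa [mul_div_cancel₀ _ hpi, th4_add_half_pi]
  have key := quasiPeriodic_one_proportional (th4_mem_quasiPeriodic hτ) (th4_product_mem hτ)
    (z / Real.pi) ((w + Real.pi / 2) / Real.pi)
  intro h0
  rw [show (Real.pi : ℂ) * (z / Real.pi) = z from mul_div_cancel₀ _ hpi, h0, zero_mul] at key
  refine (mul_ne_zero hw' (mul_ne_zero (qPoch_ne_zero hq fun n => ?_)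
    (qPoch_ne_zero hq fun n => ?_))) key.symm
  · rw [← Complex.exp_nat_mul, ← Complex.exp_add]
    convert h1 n using 2
    field_simp
    ring
  · rw [← Complex.exp_nat_mul, ← Complex.exp_add]
    convert h2 n using 2
    field_simp
    ring

lemma exp_ne_one_of_re_ne_zero {z : ℂ} (h : z.re ≠ 0) : cexp z ≠ 1 := by
  intro h1
  have := congrArg norm h1
  rw [Complex.norm_exp, norm_one, Real.exp_eq_one_iff] at this
  exact h this

lemma th4_ne_zero {τ : ℂ} (hτ : 0 < τ.im) {z : ℂ} (hz : |2 * z.im| < Real.pi * τ.im) :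
    th4 z τ ≠ 0 := by
  have hpos : 0 < Real.pi * τ.im := mul_pos Real.pi_pos hτ
  rw [abs_lt] at hz
  refine th4_ne_zero_of_factors hτ z (fun n => ?_) (fun n => ?_) <;>
  · refine exp_ne_one_of_re_ne_zero (ne_of_lt ?_)
    have : 0 ≤ (n : ℝ) * (Real.pi * τ.im) := by positivity
    simp
    nlinarith

lemma th1_ne_zero {τ : ℂ} (hτ : 0 < τ.im) {z : ℂ} (hz : |z.im| < Real.pi * τ.im)
    (h1 : cexp (2 * I * z) ≠ 1) : th1 z τ ≠ 0 := by
  have hpos : 0 < Real.pi * τ.im := mul_pos Real.pi_pos hτ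
  rw [abs_lt] at hz
  intro h0
  refine th4_ne_zero_of_factors hτ (z + Real.pi * τ / 2) (fun n => ?_) (fun n => ?_)
    (by rw [th4_add_half_tau, h0, mul_zero])
  · refine exp_ne_one_of_re_ne_zero (ne_of_lt ?_)
    have : 0 ≤ (n : ℝ) * (Real.pi * τ.im) := by positivity
    simp
    nlinarith
  · rcases n with _ | n
    · intro h2
      apply h1
      have h3 : cexp (-(2 * I * z)) = 1 := by
        rw [← h2]
        congr 1
        push_cast
        ring
      rw [Complex.exp_neg, inv_eq_one] at h3
      exact h3
    · refine exp_ne_one_of_re_ne_zero (ne_of_lt ?_)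
      have : 0 ≤ (n : ℝ) * (Real.pi * τ.im) := by positivity
      simp
      nlinarith

/-! ### The function `w` -/

/-- `D(x) = ϑ₁(x-η)ϑ₁(x+η)`. -/
def Dth (τ x : ℂ) : ℂ := th1 (x - ηc) τ * th1 (x + ηc) τ

/-- `K = ϑ₄(η,p²)/ϑ₄(0,p²)`. -/
def Kth (τ : ℂ) : ℂ := th4 ηc (2 * τ) / th4 0 (2 * τ)

lemma three_ηc : 3 * ηc = Real.pi := by
  unfold ηc
  ring

lemma ηc_im : ηc.im = 0 := by
  unfold ηc
  rw [show (Real.pi : ℂ) / 3 = ((Real.pi / 3 : ℝ) : ℂ) by push_cast; ring, ofReal_im]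

lemma wfun_eq (τ x : ℂ) : wfun τ x = Kth τ * th1 x τ ^ 2 / Dth τ x := rfl

lemma th1_sub_pi (z τ : ℂ) : th1 (z - Real.pi) τ = - th1 z τ := by
  rw [← neg_neg (th1 (z - _) τ), ← th1_add_pi, sub_add_cancel]

lemma th4_sub_pi (z τ : ℂ) : th4 (z - Real.pi) τ = th4 z τ := by
  rw [← th4_add_pi, sub_add_cancel]

lemma th1_two_η (τ : ℂ) : th1 (2 * ηc) τ = th1 ηc τ := by
  rw [show 2 * ηc = -(ηc) + Real.pi by rw [← three_ηc]; ring, th1_add_pi, th1_neg, neg_neg]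

lemma th2_two_η (τ : ℂ) : th2 (2 * ηc) τ = - th2 ηc τ := by
  rw [show 2 * ηc = -(ηc) + Real.pi by rw [← three_ηc]; ring, th2_add_pi, th2_neg]

lemma th4_two_η (τ : ℂ) : th4 (2 * ηc) τ = th4 ηc τ := by
  rw [show 2 * ηc = -(ηc) + Real.pi by rw [← three_ηc]; ring, th4_add_pi, th4_neg]

lemma Dth_β2c (τ : ℂ) : Dth τ β2c = - th2 0 τ * th2 ηc τ := by
  unfold Dth β2c
  rw [show ηc + (Real.pi : ℂ) / 2 - ηc = 0 + Real.pi / 2 by ring,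
    show ηc + (Real.pi : ℂ) / 2 + ηc = 2 * ηc + Real.pi / 2 by ring, th1_add_half_pi,
    th1_add_half_pi, th2_two_η]
  ring

section
variable {τ : ℂ}

lemma th4_real_ne_zero (hτ : 0 < τ.im) {z : ℂ} (hz : z.im = 0) : th4 z τ ≠ 0 :=
  th4_ne_zero hτ (by rw [hz, mul_zero, abs_zero]; exact mul_pos Real.pi_pos hτ)

lemma th4_zero_ne (hτ : 0 < τ.im) : th4 0 τ ≠ 0 := th4_real_ne_zero hτ rfl
lemma th4_η_ne (hτ : 0 < τ.im) : th4 ηc τ ≠ 0 := th4_real_ne_zero hτ ηc_im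

lemma th1_real_ne_zero (hτ : 0 < τ.im) {x : ℝ} (h : ∀ n : ℤ, x ≠ n * Real.pi) : th1 x τ ≠ 0 := by
  refine th1_ne_zero hτ (by simpa using mul_pos Real.pi_pos hτ) fun h1 => ?_
  obtain ⟨n, hn⟩ := Complex.exp_eq_one_iff.1 h1
  refine h n ?_
  have h2 : ((x : ℝ) : ℂ) = ((n * Real.pi : ℝ) : ℂ) := by
    refine mul_left_cancel₀ (mul_ne_zero two_ne_zero I_ne_zero) ?_
    push_cast
    linear_combination hn
  exact_mod_cast h2

lemma th1_rat_ne_zero (hτ : 0 < τ.im) (a : ℚ) (h : ∀ n : ℤ, a ≠ n) : th1 (a * Real.pi) τ ≠ 0 := by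
  have := th1_real_ne_zero hτ (x := a * Real.pi) fun n hn => h n (by
    have := mul_right_cancel₀ Real.pi_ne_zero hn
    exact_mod_cast this)
  simpa using this

lemma th1_η_ne (hτ : 0 < τ.im) : th1 ηc τ ≠ 0 := by
  have := th1_rat_ne_zero hτ (1 / 3) (fun n hn => by
    have : (3 * n : ℚ) = 1 := by rw [← hn]; norm_num
    have : 3 * n = 1 := by exact_mod_cast this
    omega)
  convert this using 2
  unfold ηc
  push_cast
  ring

lemma th2_zero_ne (hτ : 0 < τ.im) : th2 0 τ ≠ 0 := by
  have := th1_rat_ne_zero hτ (1 / 2) (fun n hn => by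
    have : (2 * n : ℚ) = 1 := by rw [← hn]; norm_num
    have : 2 * n = 1 := by exact_mod_cast this
    omega)
  rw [← th1_add_half_pi]
  convert this using 2
  push_cast
  ring

lemma th2_η_ne (hτ : 0 < τ.im) : th2 ηc τ ≠ 0 := by
  have := th1_rat_ne_zero hτ (5 / 6) (fun n hn => by
    have : (6 * n : ℚ) = 5 := by rw [← hn]; norm_num
    have : 6 * n = 5 := by exact_mod_cast this
    omega)
  rw [← th1_add_half_pi]
  convert this using 2
  unfold ηc
  push_cast
  ring

lemma Kth_ne_zero (hτ : 0 < τ.im) : Kth τ ≠ 0 :=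
  div_ne_zero (th4_η_ne (two_mul_im_pos hτ)) (th4_zero_ne (two_mul_im_pos hτ))

lemma differentiable_Dth (hτ : 0 < τ.im) : Differentiable ℂ (Dth τ) := by
  have h := differentiable_th1 hτ
  have h1 := h.comp (f := fun z : ℂ => z - ηc) (by fun_prop)
  have h2 := h.comp (f := fun z : ℂ => z + ηc) (by fun_prop)
  exact h1.mul h2

lemma th1_sq_mul_Dth (hτ : 0 < τ.im) (x z : ℂ) :
    th1 x τ ^ 2 * Dth τ z - th1 z τ ^ 2 * Dth τ x
      = - th1 ηc τ ^ 2 * (th1 (x - z) τ * th1 (x + z) τ) := by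
  have h1 := th1_add_mul_th1_sub hτ x ηc
  have h2 := th1_add_mul_th1_sub hτ z ηc
  have h3 := th1_add_mul_th1_sub hτ x z
  refine mul_right_cancel₀ (pow_ne_zero 2 (th4_zero_ne hτ)) ?_
  unfold Dth
  linear_combination th1 x τ ^ 2 * h2 - th1 z τ ^ 2 * h1 + th1 ηc τ ^ 2 * h3

lemma wfun_sub_wfun (hτ : 0 < τ.im) {x z : ℂ} (hx : Dth τ x ≠ 0) (hz : Dth τ z ≠ 0) :
    wfun τ x - wfun τ z
      = - Kth τ * th1 ηc τ ^ 2 * (th1 (x - z) τ * th1 (x + z) τ) / (Dth τ x * Dth τ z) := by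
  have h := th1_sq_mul_Dth hτ x z
  rw [wfun_eq, wfun_eq]
  field_simp
  linear_combination Kth τ * h

lemma one_sub_zet_sq (hτ : 0 < τ.im) : 1 - zet τ ^ 2 = (Kth τ ^ 3)⁻¹ := by
  have h2 := two_mul_im_pos hτ
  have h := th4_add_mul_th4_sub h2 ηc ηc
  rw [← two_mul, th4_two_η, sub_self] at h
  have h4 := th4_η_ne h2
  have h0 := th4_zero_ne h2
  unfold zet Kth
  field_simp
  linear_combination -h

lemma one_sub_zet_sq_ne (hτ : 0 < τ.im) : 1 - zet τ ^ 2 ≠ 0 := by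
  rw [one_sub_zet_sq hτ]
  exact inv_ne_zero (pow_ne_zero 3 (Kth_ne_zero hτ))

lemma two_th1_mul_th4 (hτ : 0 < τ.im) (y : ℂ) : 2 * (th1 y (2 * τ) * th4 y (2 * τ)) = th2 0 τ * th1 y τ := by
  have := th1_mul_th2 hτ y 0
  rw [add_zero, sub_zero] at this
  linear_combination -this

lemma th1_mul_th2_self (hτ : 0 < τ.im) (x : ℂ) : th1 x τ * th2 x τ = th4 0 (2 * τ) * th1 (2 * x) (2 * τ) := by
  have := th1_mul_th2 hτ x x
  rw [sub_self, th1_zero, ← two_mul] at this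
  linear_combination this

lemma two_Kth_mul (hτ : 0 < τ.im) : 2 * Kth τ * th2 ηc τ = th2 0 τ := by
  have h1 := two_th1_mul_th4 hτ ηc
  have h2 := th1_mul_th2_self hτ ηc
  rw [th1_two_η] at h2
  have h0 := th4_zero_ne (two_mul_im_pos hτ)
  have h3 := th1_η_ne hτ
  unfold Kth
  field_simp
  refine mul_left_cancel₀ h3 ?_
  linear_combination 2 * th4 ηc (2 * τ) * h2 + th4 0 (2 * τ) * h1

lemma wfun_β2c (hτ : 0 < τ.im) : wfun τ β2c = J2c := by
  rw [wfun_eq, Dth_β2c]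
  unfold β2c J2c
  rw [th1_add_half_pi]
  have h1 := two_Kth_mul hτ
  have h2 := th2_zero_ne hτ
  have h3 := th2_η_ne hτ
  field_simp
  linear_combination -h1

lemma th1_cube_mem (hτ : 0 < τ.im) : (fun z : ℂ => (th1 (ηc * z) τ ^ 3 - th1 (ηc * z + ηc) τ ^ 3
      + th1 (ηc * z + 2 * ηc) τ ^ 3) * cexp (Real.pi * I * z)) ∈ quasiPeriodic (3 * τ) (-1) 1 := by
  have hd := differentiable_th1 hτ
  have e6 : cexp (-(6 * I * ηc)) = 1 := by
    rw [show -(6 * I * ηc) = -(2 * Real.pi * I) by rw [← three_ηc]; ring, Complex.exp_neg,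
      Complex.exp_two_pi_mul_I, inv_one]
  have e6' (x : ℂ) : cexp (x + -(6 * I * ηc)) = cexp x := by rw [Complex.exp_add, e6, mul_one]
  refine ⟨?_, fun z => ?_, fun z => ?_⟩
  · have h1 := hd.comp (f := fun z : ℂ => ηc * z) (by fun_prop)
    have h2 := hd.comp (f := fun z : ℂ => ηc * z + ηc) (by fun_prop)
    have h3 := hd.comp (f := fun z : ℂ => ηc * z + 2 * ηc) (by fun_prop)
    simp only [Function.comp_def] at h1 h2 h3
    fun_prop
  · beta_reduce
    rw [show ηc * (z + 1) = ηc * z + ηc by ring,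
      show ηc * z + ηc + ηc = ηc * z + 2 * ηc by ring,
      show ηc * z + ηc + 2 * ηc = ηc * z + Real.pi by rw [← three_ηc]; ring, th1_add_pi, mul_add,
      mul_one, Complex.exp_add, Complex.exp_pi_mul_I]
    ring
  · beta_reduce
    rw [show ηc * (z + 3 * τ) = ηc * z + Real.pi * τ by rw [← three_ηc]; ring,
      add_right_comm, add_right_comm _ _ (2 * ηc), th1_add_tau, th1_add_tau, th1_add_tau]
    simp only [mul_pow, neg_pow (cexp _), ← Complex.exp_nat_mul]
    rw [show ((3 : ℕ) : ℂ) * (-((Real.pi : ℂ) * I * τ) - 2 * I * (ηc * z + ηc))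
        = (-(3 * (Real.pi * I * τ)) - 2 * I * Real.pi * z) + -(6 * I * ηc) by
          rw [← three_ηc]; push_cast; ring,
      show ((3 : ℕ) : ℂ) * (-((Real.pi : ℂ) * I * τ) - 2 * I * (ηc * z + 2 * ηc))
        = (-(3 * (Real.pi * I * τ)) - 2 * I * Real.pi * z) + -(6 * I * ηc) + -(6 * I * ηc) by
          rw [← three_ηc]; push_cast; ring,
      show ((3 : ℕ) : ℂ) * (-((Real.pi : ℂ) * I * τ) - 2 * I * (ηc * z))
        = (-(3 * (Real.pi * I * τ)) - 2 * I * Real.pi * z) by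
          rw [← three_ηc]; push_cast; ring, e6', e6', e6', mul_add, Complex.exp_add (Real.pi * I * z),
      show -2 * (Real.pi : ℂ) * I * ((1 : ℕ) : ℂ) * z
        = (-(3 * (Real.pi * I * τ)) - 2 * I * Real.pi * z) + (Real.pi * I * (3 * τ)) by
          push_cast; ring, Complex.exp_add _ (Real.pi * I * (3 * τ))]
    ring

lemma th1_triple_mem (hτ : 0 < τ.im) : (fun z : ℂ => (th1 (ηc * z) τ * th1 (ηc * z + ηc) τ
      * th1 (ηc * z + 2 * ηc) τ) * cexp (Real.pi * I * z)) ∈ quasiPeriodic (3 * τ) (-1) 1 := by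
  have hd := differentiable_th1 hτ
  refine ⟨?_, fun z => ?_, fun z => ?_⟩
  · have h1 := hd.comp (f := fun z : ℂ => ηc * z) (by fun_prop)
    have h2 := hd.comp (f := fun z : ℂ => ηc * z + ηc) (by fun_prop)
    have h3 := hd.comp (f := fun z : ℂ => ηc * z + 2 * ηc) (by fun_prop)
    simp only [Function.comp_def] at h1 h2 h3
    fun_prop
  · beta_reduce
    rw [show ηc * (z + 1) = ηc * z + ηc by ring,
      show ηc * z + ηc + ηc = ηc * z + 2 * ηc by ring,
      show ηc * z + ηc + 2 * ηc = ηc * z + Real.pi by rw [← three_ηc]; ring, th1_add_pi, mul_add,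
      mul_one, Complex.exp_add, Complex.exp_pi_mul_I]
    ring
  · beta_reduce
    rw [show ηc * (z + 3 * τ) = ηc * z + Real.pi * τ by rw [← three_ηc]; ring,
      add_right_comm, add_right_comm _ _ (2 * ηc), th1_add_tau, th1_add_tau, th1_add_tau]
    have e : cexp (-((Real.pi : ℂ) * I * τ) - 2 * I * (ηc * z))
        * cexp (-((Real.pi : ℂ) * I * τ) - 2 * I * (ηc * z + ηc))
        * cexp (-((Real.pi : ℂ) * I * τ) - 2 * I * (ηc * z + 2 * ηc))
        * cexp (Real.pi * I * (z + 3 * τ))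
        = cexp (-2 * Real.pi * I * ((1 : ℕ) : ℂ) * z) * cexp (Real.pi * I * z) := by
      rw [← Complex.exp_add, ← Complex.exp_add, ← Complex.exp_add, ← Complex.exp_add,
        ← mul_one (cexp (-2 * _ * _ * _ * _ + _)), ← Complex.exp_two_pi_mul_I, ← mul_one (cexp (_ + _)),
        ← Complex.exp_two_pi_mul_I,  ← Complex.exp_add, ← Complex.exp_add]
      rw [Complex.exp_eq_exp_iff_exists_int]
      refine ⟨-1, ?_⟩
      rw [← three_ηc]
      push_cast
      ring
    linear_combination -(th1 (ηc * z) τ * th1 (ηc * z + ηc) τ * th1 (ηc * z + 2 * ηc) τ) * e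

lemma th1_cube_identity (hτ : 0 < τ.im) (y : ℂ) :
    (th1 y τ ^ 3 - th1 (y + ηc) τ ^ 3 + th1 (y + 2 * ηc) τ ^ 3) * Kth τ
      = (1 - 4 * Kth τ ^ 3) * (th1 y τ * th1 (y + ηc) τ * th1 (y + 2 * ηc) τ) := by
  have hpi : (Real.pi : ℂ) ≠ 0 := by exact_mod_cast Real.pi_ne_zero
  have hη : ηc ≠ 0 := by
    unfold ηc
    exact div_ne_zero hpi (by norm_num)
  have key := quasiPeriodic_one_proportional (th1_cube_mem hτ) (th1_triple_mem hτ)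
    (y / ηc) ((Real.pi / 2) / ηc)
  simp only [mul_div_cancel₀ _ hη] at key
  have h0 : th1 (Real.pi / 2) τ = th2 0 τ := by
    rw [← th1_add_half_pi, zero_add]
  rw [h0, add_comm ((Real.pi : ℂ) / 2) ηc, add_comm ((Real.pi : ℂ) / 2) (2 * ηc), th1_add_half_pi, th1_add_half_pi, th2_two_η] at key
  have e1 := Complex.exp_ne_zero (Real.pi * I * (y / ηc))
  have e2 := Complex.exp_ne_zero (Real.pi * I * (Real.pi / 2 / ηc))
  have h2 := th2_η_ne hτ
  have hK := Kth_ne_zero hτ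
  rw [← two_Kth_mul hτ] at key
  refine mul_left_cancel₀ (mul_ne_zero (mul_ne_zero e1 e2) (pow_ne_zero 3 h2)) ?_
  linear_combination -key / 2

lemma wfun_triple (hτ : 0 < τ.im) {y : ℂ} (h0 : th1 y τ ≠ 0) (h1 : th1 (y + ηc) τ ≠ 0)
    (h2 : th1 (y - ηc) τ ≠ 0) :
    wfun τ (y - ηc) + wfun τ y + wfun τ (y + ηc) = (3 + zet τ ^ 2) / (1 - zet τ ^ 2) ∧
    wfun τ (y - ηc) * wfun τ y * wfun τ (y + ηc) = 1 / (1 - zet τ ^ 2) := by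
  have hK := Kth_ne_zero hτ
  have hz := one_sub_zet_sq hτ
  have hz' : zet τ ^ 2 = 1 - (Kth τ ^ 3)⁻¹ := by linear_combination -hz
  have key := th1_cube_identity hτ (y - ηc)
  rw [show y - ηc + ηc = y by ring, show y - ηc + 2 * ηc = y + ηc by ring] at key
  have e1 : th1 (y - ηc - ηc) τ = - th1 (y + ηc) τ := by
    rw [← th1_sub_pi]
    congr 1
    rw [← three_ηc]
    ring
  have e2 : th1 (y + ηc + ηc) τ = - th1 (y - ηc) τ := by
    rw [← th1_add_pi]
    congr 1
    rw [← three_ηc]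
    ring
  rw [hz, hz']
  simp only [wfun_eq, Dth]
  rw [show y - ηc + ηc = y by ring, show y + ηc - ηc = y by ring, e1, e2]
  constructor
  · field_simp
    linear_combination -key
  · field_simp

lemma chi_diff (hτ : 0 < τ.im) (x l : ℂ) :
    th1 (x + l) (2 * τ) * th4 (x - l - 2 * ηc) (2 * τ)
      - th1 (x - l - 2 * ηc) (2 * τ) * th4 (x + l) (2 * τ) = th1 (l + ηc) τ * th2 (x - ηc) τ := by
  have := th1_mul_th2 hτ (l + ηc) (x - ηc)
  rw [show l + ηc + (x - ηc) = x + l by ring,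
    show l + ηc - (x - ηc) = -(x - l - 2 * ηc) by ring, th1_neg, th4_neg] at this
  linear_combination -this

lemma chi_sum (hτ : 0 < τ.im) (x l : ℂ) :
    th1 (x + l) (2 * τ) * th4 (x - l - 2 * ηc) (2 * τ)
      + th1 (x - l - 2 * ηc) (2 * τ) * th4 (x + l) (2 * τ) = th1 (x - ηc) τ * th2 (l + ηc) τ := by
  have := th1_mul_th2 hτ (x - ηc) (l + ηc)
  rw [show x - ηc + (l + ηc) = x + l by ring,
    show x - ηc - (l + ηc) = (x - l - 2 * ηc) by ring] at this
  linear_combination -this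

lemma mubar_eq_wfun (hτ : 0 < τ.im) {l : ℂ} (hf : th1 l (2 * τ) * th4 (l + 2 * ηc) (2 * τ) ≠ 0)
    (hg : th1 (l + 2 * ηc) (2 * τ) * th4 l (2 * τ) ≠ 0) :
    mubar (zet τ) (-(th1 (l + 2 * ηc) (2 * τ) * th4 l (2 * τ))
      / (th1 l (2 * τ) * th4 (l + 2 * ηc) (2 * τ))) = wfun τ (l + ηc) := by
  have h1 := chi_diff hτ 0 l
  rw [zero_add, zero_sub, show -l - 2 * ηc = -(l + 2 * ηc) by ring, zero_sub, th1_neg, th4_neg,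
    th2_neg] at h1
  have h2 := two_th1_mul_th4 hτ l
  have h3 := two_th1_mul_th4 hτ (l + 2 * ηc)
  have hK := Kth_ne_zero hτ
  have hz := one_sub_zet_sq hτ
  have h5 := two_Kth_mul hτ
  have hD : Dth τ (l + ηc) = th1 l τ * th1 (l + 2 * ηc) τ := by
    unfold Dth
    ring_nf
  have h20 := th2_zero_ne hτ
  rw [wfun_eq, hD]
  unfold mubar
  rw [show zet τ ^ 2 - 1 = -(Kth τ ^ 3)⁻¹ by linear_combination -hz]
  set f := th1 l (2 * τ) * th4 (l + 2 * ηc) (2 * τ) with hfdef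
  set g := th1 (l + 2 * ηc) (2 * τ) * th4 l (2 * τ) with hgdef
  have hfg : 4 * (f * g) = th2 0 τ ^ 2 * (th1 l τ * th1 (l + 2 * ηc) τ) := by
    rw [hfdef, hgdef]
    linear_combination (2 * th1 (l + 2 * ηc) (2 * τ) * th4 (l + 2 * ηc) (2 * τ)) * h2 + th2 0 τ * th1 l τ * h3
  have hne : th1 l τ * th1 (l + 2 * ηc) τ ≠ 0 := by
    intro h0
    rw [h0, mul_zero] at hfg
    exact mul_ne_zero (by norm_num) (mul_ne_zero hf hg) hfg
  have hs : f + g = th1 (l + ηc) τ * th2 ηc τ := by linear_combination h1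
  rw [show (-g / f - 1) ^ 2 / (-(Kth τ ^ 3)⁻¹ * (-g / f)) = Kth τ ^ 3 * (f + g) ^ 2 / (f * g) by
    field_simp
    ring, div_eq_div_iff (mul_ne_zero hf hg) hne, hs]
  rw [← h5] at hfg
  have h2η := th2_η_ne hτ
  linear_combination -(Kth τ * th1 (l + ηc) τ ^ 2 / 4) * hfg

end

/-! ### Even theta functions -/

/-- Even theta functions of degree `2M`. -/
def evenTheta (τ : ℂ) (M : ℕ) : Submodule ℂ (ℂ → ℂ) where
  carrier := {f | Differentiable ℂ f ∧ (∀ z, f (-z) = f z) ∧ (∀ z, f (z + Real.pi) = f z) ∧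
    ∀ z, f (z + Real.pi * τ) = cexp (-2 * M * (Real.pi * I * τ) - 4 * M * I * z) * f z}
  add_mem' := by
    rintro f g ⟨hf, hf0, hf1, hfs⟩ ⟨hg, hg0, hg1, hgs⟩
    refine ⟨hf.add hg, fun z => ?_, fun z => ?_, fun z => ?_⟩
    · simp only [Pi.add_apply, hf0, hg0]
    · simp only [Pi.add_apply, hf1, hg1]
    · simp only [Pi.add_apply, hfs, hgs]
      ring
  zero_mem' := ⟨differentiable_const 0, fun _ => rfl, fun _ => rfl, fun z => by simp⟩
  smul_mem' := by
    rintro c f ⟨hf, hf0, hf1, hfs⟩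
    refine ⟨hf.const_smul c, fun z => ?_, fun z => ?_, fun z => ?_⟩
    · simp only [Pi.smul_apply, hf0]
    · simp only [Pi.smul_apply, hf1]
    · simp only [Pi.smul_apply, hfs, smul_eq_mul]
      ring

lemma fourierC_neg {f : ℂ → ℂ} (h1 : ∀ z, f (z + 1) = f z)
    (h0 : ∀ z, f (-z) = f z) (n : ℤ) : fourierC f (-n) = fourierC f n := by
  have key := intervalIntegral.integral_comp_sub_left (a := 0) (b := 1)
    (fun x : ℝ => f x * cexp (-2 * Real.pi * I * n * x)) 1
  rw [sub_self, sub_zero] at key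
  unfold fourierC
  rw [← key]
  congr 1
  funext x
  have e : cexp (-2 * Real.pi * I * n * ((1 - x : ℝ) : ℂ))
      = cexp (-2 * Real.pi * I * ((-n : ℤ) : ℂ) * x) := by
    rw [Complex.exp_eq_exp_iff_exists_int]
    exact ⟨-n, by push_cast; ring⟩
  have e2 : f ((1 - x : ℝ) : ℂ) = f x := by
    rw [← h0 x, ← h1 (-x)]
    congr 1
    push_cast
    ring
  rw [e, e2]

lemma evenTheta_comp_mem {τ : ℂ} {M : ℕ} {f : ℂ → ℂ} (hf : f ∈ evenTheta τ M) :
    (fun z => f (Real.pi * z)) ∈ quasiPeriodic τ (cexp (-2 * M * (Real.pi * I * τ))) (2 * M) := by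
  obtain ⟨hd, -, h1, hs⟩ := hf
  refine ⟨hd.comp (by fun_prop), fun z => ?_, fun z => ?_⟩
  · beta_reduce
    rw [mul_add, mul_one, h1]
  · beta_reduce
    rw [mul_add, hs, ← Complex.exp_add]
    congr 2
    push_cast
    ring

/-- The Fourier coefficients `0, …, M` of an even theta function. -/
def evenWindow (τ : ℂ) (M : ℕ) : evenTheta τ M →ₗ[ℂ] (Fin (M + 1) → ℂ) where
  toFun f := fun j => fourierC (fun z => f.1 (Real.pi * z)) j
  map_add' f g := by
    funext j
    exact fourierC_add (evenTheta_comp_mem f.2).1 (evenTheta_comp_mem g.2).1 _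
  map_smul' c f := by
    funext j
    exact fourierC_smul c _ _

lemma evenWindow_injective (τ : ℂ) {M : ℕ} (hM : 0 < M) :
    Function.Injective (evenWindow τ M) := by
  refine (injective_iff_map_eq_zero _).2 fun f hf => ?_
  have hmem := evenTheta_comp_mem f.2
  have h0 (n : ℤ) (h1 : -M ≤ n) (h2 : n ≤ M) : fourierC (fun z => f.1 (Real.pi * z)) n = 0 := by
    have hnat (m : ℕ) (hm : m ≤ M) : fourierC (fun z => f.1 (Real.pi * z)) m = 0 :=
      congrFun hf ⟨m, by omega⟩
    rcases Int.eq_nat_or_neg n with ⟨m, rfl | rfl⟩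
    · exact hnat m (by omega)
    · rw [fourierC_neg hmem.2.1 (fun z => by rw [mul_neg, f.2.2.1])]
      exact hnat m (by omega)
  have := quasiPeriodic_eq_zero (by omega) hmem (-M + 1)
    fun n h1 h2 => h0 n (by omega) (by push_cast at h2; omega)
  ext z
  have hpi : (Real.pi : ℂ) ≠ 0 := by exact_mod_cast Real.pi_ne_zero
  have h3 := congrFun this (z / Real.pi)
  simp only [mul_div_cancel₀ _ hpi] at h3
  exact h3

lemma th1_Dth_mem {τ : ℂ} (hτ : 0 < τ.im) {M j : ℕ} (hj : j ≤ M) :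
    (fun z => (th1 z τ ^ 2) ^ j * Dth τ z ^ (M - j)) ∈ evenTheta τ M := by
  have h1 := differentiable_th1 hτ
  have h2 := differentiable_Dth hτ
  obtain ⟨k, rfl⟩ := Nat.exists_eq_add_of_le hj
  rw [Nat.add_sub_cancel_left]
  refine ⟨by fun_prop, fun z => ?_, fun z => ?_, fun z => ?_⟩
  · have : Dth τ (-z) = Dth τ z := by
      unfold Dth
      rw [show -z - ηc = -(z + ηc) by ring, show -z + ηc = -(z - ηc) by ring, th1_neg, th1_neg]
      ring
    beta_reduce
    rw [this, th1_neg, neg_sq]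
  · have : Dth τ (z + Real.pi) = Dth τ z := by
      unfold Dth
      rw [add_sub_right_comm, add_right_comm, th1_add_pi, th1_add_pi]
      ring
    beta_reduce
    rw [this, th1_add_pi, neg_sq]
  · have : Dth τ (z + Real.pi * τ) = cexp (-2 * (Real.pi * I * τ) - 4 * I * z) * Dth τ z := by
      unfold Dth
      rw [add_sub_right_comm, add_right_comm, th1_add_tau, th1_add_tau]
      rw [show -2 * ((Real.pi : ℂ) * I * τ) - 4 * I * z
        = (-(Real.pi * I * τ) - 2 * I * (z - ηc)) + (-(Real.pi * I * τ) - 2 * I * (z + ηc)) by ring,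
        Complex.exp_add]
      ring
    have h3 : th1 (z + Real.pi * τ) τ ^ 2
        = cexp (-2 * (Real.pi * I * τ) - 4 * I * z) * th1 z τ ^ 2 := by
      rw [th1_add_tau, show -2 * ((Real.pi : ℂ) * I * τ) - 4 * I * z
        = (-(Real.pi * I * τ) - 2 * I * z) + (-(Real.pi * I * τ) - 2 * I * z) by ring,
        Complex.exp_add]
      ring
    beta_reduce
    rw [this, h3, mul_pow, mul_pow, show -2 * ((j + k : ℕ) : ℂ) * ((Real.pi : ℂ) * I * τ)
        - 4 * ((j + k : ℕ) : ℂ) * I * z = ((j + k : ℕ) : ℂ) * (-2 * (Real.pi * I * τ) - 4 * I * z) by ring,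
      Complex.exp_nat_mul]
    ring

lemma Dth_η (τ : ℂ) : Dth τ ηc = 0 := by
  unfold Dth
  rw [sub_self, th1_zero, zero_mul]

/-- An even theta function of degree `2M` vanishing at `η` and at `M` further points with
distinct values of `w` vanishes. -/
lemma evenTheta_eq_zero {τ : ℂ} (hτ : 0 < τ.im) {M : ℕ} (hM : 0 < M) {G : ℂ → ℂ}
    (hG : G ∈ evenTheta τ M) (hη : G ηc = 0) (s : Finset ℂ) (hs : M ≤ s.card)
    (hD : ∀ x ∈ s, Dth τ x ≠ 0) (hinj : Set.InjOn (wfun τ) s) (h0 : ∀ x ∈ s, G x = 0) :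
    G = 0 := by
  have hK := Kth_ne_zero hτ
  let φ : ℂ × (Fin (M + 1) → ℂ) →ₗ[ℂ] evenTheta τ M :=
    (LinearMap.toSpanSingleton ℂ _ (⟨G, hG⟩ : evenTheta τ M)).coprod
      (Fintype.linearCombination ℂ fun j : Fin (M + 1) =>
        (⟨_, th1_Dth_mem hτ (Nat.le_of_lt_succ j.2)⟩ : evenTheta τ M))
  let φ' := (evenWindow τ M).comp φ
  have hker : LinearMap.ker φ' ≠ ⊥ := by
    apply LinearMap.ker_ne_bot_of_finrank_lt
    rw [Module.finrank_prod, Module.finrank_self, Module.finrank_fin_fun]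
    omega
  obtain ⟨⟨c0, c⟩, hc, hne⟩ := Submodule.exists_mem_ne_zero_of_ne_bot hker
  have h1 : φ (c0, c) = 0 := by
    refine evenWindow_injective τ hM ?_
    rw [map_zero]
    exact hc
  have h2 (z : ℂ) : c0 * G z + ∑ j : Fin (M + 1), c j * ((th1 z τ ^ 2) ^ (j : ℕ)
      * Dth τ z ^ (M - j)) = 0 := by
    have := congrArg (fun f : evenTheta τ M => f.1 z) h1
    simpa [φ, Fintype.linearCombination_apply, Finset.sum_apply] using this
  have hcM : c (Fin.last M) = 0 := by
    have := h2 ηc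
    rw [hη, mul_zero, zero_add, Dth_η, Fin.sum_univ_castSucc] at this
    rw [Finset.sum_eq_zero, zero_add] at this
    · have h3 := th1_η_ne hτ
      simpa [h3] using this
    · intro j _
      have : M - (j.castSucc : ℕ) ≠ 0 := by
        have := j.2
        simp only [Fin.val_castSucc]
        omega
      rw [zero_pow this, mul_zero, mul_zero]
  have hc0 : ∀ j : Fin M, c j.castSucc = 0 := by
    let P : Polynomial ℂ := ∑ j : Fin M, Polynomial.monomial (j : ℕ) (c j.castSucc)
    have hP : P = 0 := by
      refine Polynomial.eq_zero_of_natDegree_lt_card_of_eval_eq_zero' P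
        (s.image fun x => th1 x τ ^ 2 / Dth τ x) ?_ ?_
      · intro y hy
        obtain ⟨x, hx, rfl⟩ := Finset.mem_image.1 hy
        have := h2 x
        rw [h0 x hx, mul_zero, zero_add, Fin.sum_univ_castSucc, hcM, zero_mul, add_zero] at this
        simp only [P, Polynomial.eval_finsetSum, Polynomial.eval_monomial]
        refine mul_left_cancel₀ (pow_ne_zero M (hD x hx)) ?_
        rw [mul_zero, ← this, Finset.mul_sum]
        refine Finset.sum_congr rfl fun j _ => ?_
        have hj : Dth τ x ^ M = Dth τ x ^ (M - (j : ℕ)) * Dth τ x ^ (j : ℕ) := by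
          rw [← pow_add, Nat.sub_add_cancel j.2.le]
        have hDx := hD x hx
        simp only [Fin.val_castSucc]
        rw [hj, div_pow]
        have hDj := pow_ne_zero (j : ℕ) hDx
        field_simp
      · rw [Finset.card_image_of_injOn]
        · refine lt_of_lt_of_le ?_ hs
          rw [Nat.lt_iff_le_pred hM]
          refine Polynomial.natDegree_sum_le_of_forall_le _ _ fun j _ => ?_
          refine (Polynomial.natDegree_monomial_le _).trans ?_
          have := j.2
          omega
        · intro x hx y hy hxy
          refine hinj hx hy ?_
          rw [wfun_eq, wfun_eq, mul_div_assoc, mul_div_assoc]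
          exact congrArg _ hxy
    intro j
    have := congrArg (fun Q => Polynomial.coeff Q (j : ℕ)) hP
    simp only [P, Polynomial.finsetSum_coeff, Polynomial.coeff_monomial, Polynomial.coeff_zero] at this
    rw [Finset.sum_eq_single j] at this
    · simpa using this
    · intro b _ hb
      rw [if_neg]
      exact fun h => hb (Fin.ext h)
    · simp
  have hc' : c = 0 := by
    funext j
    refine Fin.lastCases ?_ (fun j => ?_) j
    · exact hcM
    · exact hc0 j
  have hc00 : c0 ≠ 0 := by
    rintro rfl
    exact hne (by rw [hc']; rfl)
  funext z
  have := h2 z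
  rw [hc'] at this
  simpa [hc00] using this

/-! ### The vectors `Ψ_n` with arguments given by lists -/

/-- `Ψ` with spectral parameters and spins given by lists. -/
def PsiL (Ψ : PsiFam) (u : List ℂ) (α : List (Fin 2)) : ℂ :=
  Ψ ((u.length - 1) / 2) (fun j => u.getD j 0) (fun j => α.getD j 0)

lemma PsiL_eq (Ψ : PsiFam) {n : ℕ} {u : List ℂ} (hu : u.length = 2 * n + 1) (α : List (Fin 2)) :
    PsiL Ψ u α = Ψ n (fun j => u.getD j 0) (fun j => α.getD j 0) := by
  unfold PsiL
  have : (u.length - 1) / 2 = n := by omega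
  rw [this]

lemma getD_append_cons_self {X : Type*} (l r : List X) (a d : X) :
    (l ++ a :: r).getD l.length d = a := by simp

lemma getD_append_cons_cons {X : Type*} (l r : List X) (a b d : X) :
    (l ++ a :: b :: r).getD (l.length + 1) d = b := by simp

lemma update_getD {X : Type*} {L : ℕ} (l r : List X) (a x d : X) (i : Fin L)
    (hi : (i : ℕ) = l.length) :
    Function.update (fun j : Fin L => (l ++ a :: r).getD j d) i x
      = fun j : Fin L => (l ++ x :: r).getD j d := by
  funext j
  rcases eq_or_ne j i with rfl | h
  · simp [hi]
  · rw [Function.update_of_ne h]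
    rcases lt_or_ge (j : ℕ) l.length with h1 | h1
    · rw [List.getD_append _ _ _ _ h1, List.getD_append _ _ _ _ h1]
    · rw [List.getD_append_right _ _ _ _ h1, List.getD_append_right _ _ _ _ h1]
      have : (j : ℕ) ≠ i := fun h' => h (Fin.ext h')
      obtain ⟨m, hm⟩ : ∃ m, (j : ℕ) - l.length = m + 1 := ⟨j - l.length - 1, by omega⟩
      rw [hm, List.getD_cons_succ, List.getD_cons_succ]

lemma update_getD_succ {X : Type*} {L : ℕ} (l r : List X) (a b x d : X) (i : Fin L)
    (hi : (i : ℕ) = l.length + 1) :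
    Function.update (fun j : Fin L => (l ++ a :: b :: r).getD j d) i x
      = fun j : Fin L => (l ++ a :: x :: r).getD j d := by
  have := update_getD (L := L) (l ++ [a]) r b x d i (by simpa using hi)
  simpa using this

lemma delTwo_getD {X : Type*} {n : ℕ} (l r : List X) (a b d : X) :
    delTwo (n := n) l.length (fun j => (l ++ a :: b :: r).getD j d)
      = fun j : Fin (2 * n + 1) => (l ++ r).getD j d := by
  funext j
  unfold delTwo
  split_ifs with h
  · beta_reduce
    rw [List.getD_append _ _ _ _ h, List.getD_append _ _ _ _ h]
  · beta_reduce
    have h' := not_lt.1 h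
    rw [List.getD_append_right _ _ _ _ (show l.length ≤ (j : ℕ) + 2 by omega),
      List.getD_append_right _ _ _ _ h', show (j : ℕ) + 2 - l.length = (j - l.length) + 2 by omega, List.getD_cons_succ,
      List.getD_cons_succ]

lemma sum_getD {n : ℕ} {u : List ℂ} (hu : u.length = n) (f : ℂ → ℂ) :
    ∑ j : Fin n, f (u.getD j 0) = (u.map f).sum := by
  subst hu
  rw [← List.sum_ofFn]
  congr 1
  apply List.ext_getElem <;> simp

lemma prod_getD {n : ℕ} {u : List ℂ} (hu : u.length = n) (f : ℂ → ℂ) :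
    ∏ j : Fin n, f (u.getD j 0) = (u.map f).prod := by
  subst hu
  rw [← List.prod_ofFn]
  congr 1
  apply List.ext_getElem <;> simp

lemma sum_map_sub_const (u : List ℂ) (a : ℂ) :
    (u.map fun x => x - a).sum = u.sum - u.length * a := by
  induction u with
  | nil => simp
  | cons x u ih =>
    simp only [List.map_cons, List.sum_cons, ih, List.length_cons]
    push_cast
    ring

section
variable {τ : ℂ} {Ψ : PsiFam}

lemma differentiable_PsiL (h : PsiEntire Ψ) {n : ℕ} {l r : List ℂ}
    (hl : l.length + r.length = 2 * n) (α : List (Fin 2)) :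
    Differentiable ℂ fun z => PsiL Ψ (l ++ z :: r) α := by
  have hlen (z : ℂ) : (l ++ z :: r).length = 2 * n + 1 := by simp; omega
  have key := h n (fun j => (l ++ 0 :: r).getD j 0) ⟨l.length, by omega⟩ (fun j => α.getD j 0)
  convert key using 2 with z
  rw [PsiL_eq Ψ (hlen z), update_getD _ _ _ _ _ _ rfl]

lemma PsiL_exchange (h : PsiP1 τ Ψ) {n : ℕ} {l r : List ℂ} {l' : List (Fin 2)}
    (hl : l.length + r.length + 1 = 2 * n) (hl' : l'.length = l.length) (a b : ℂ) (s t : Fin 2)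
    (r' : List (Fin 2)) :
    ∑ s', ∑ t', Rcheckent τ (b - a) (s, t) (s', t')
        * PsiL Ψ (l ++ a :: b :: r) (l' ++ s' :: t' :: r')
      = rv τ (b - a) * PsiL Ψ (l ++ b :: a :: r) (l' ++ s :: t :: r') := by
  have hlen (a b : ℂ) : (l ++ a :: b :: r).length = 2 * n + 1 := by simp; omega
  have key := congrFun (h n (fun j => (l ++ a :: b :: r).getD j 0) ⟨l.length, by omega⟩
    ⟨l.length + 1, by omega⟩ rfl) (fun j => (l' ++ s :: t :: r').getD j 0)
  simp only [applyRc, getD_append_cons_self, getD_append_cons_cons, ← hl',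
    update_getD l' _ _ _ _ (⟨l'.length, _⟩ : Fin (2 * n + 1)) rfl,
    update_getD_succ l' _ _ _ _ _ (⟨l'.length + 1, _⟩ : Fin (2 * n + 1)) rfl] at key
  simp only [hl', getD_append_cons_self, getD_append_cons_cons] at key
  simp only [PsiL_eq Ψ (hlen _ _)]
  rw [key]
  congr 2
  have := Equiv.comp_swap_eq_update (⟨l.length, by omega⟩ : Fin (2 * n + 1)) ⟨l.length + 1, by omega⟩
    (fun j : Fin (2 * n + 1) => (l ++ a :: b :: r).getD j 0)
  simp only [getD_append_cons_self, getD_append_cons_cons] at this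
  rw [update_getD_succ l _ _ _ _ _ (⟨l.length + 1, _⟩ : Fin (2 * n + 1)) rfl,
    update_getD l _ _ _ _ (⟨l.length, _⟩ : Fin (2 * n + 1)) rfl] at this
  exact this

lemma PsiL_flip (h : PsiP2 τ Ψ) {n : ℕ} {l r : List ℂ} {l' : List (Fin 2)}
    (hl : l.length + r.length = 2 * n) (hl' : l'.length = l.length) (a : ℂ) (s : Fin 2)
    (r' : List (Fin 2)) :
    PsiL Ψ (l ++ a :: r) (l' ++ flipS s :: r')
      = (-(pnome τ)) ^ n * cexp (-I * ((l ++ a :: r).sum - (2 * n + 1) * a))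
        * PsiL Ψ (l ++ (a + Real.pi * τ) :: r) (l' ++ s :: r') := by
  have hlen (a : ℂ) : (l ++ a :: r).length = 2 * n + 1 := by simp; omega
  have key := h n (fun j => (l ++ a :: r).getD j 0) ⟨l.length, by omega⟩
    (fun j => (l' ++ s :: r').getD j 0)
  simp only [getD_append_cons_self, ← hl',
    update_getD l' _ _ _ _ (⟨l'.length, _⟩ : Fin (2 * n + 1)) rfl] at key
  simp only [hl', getD_append_cons_self,
    update_getD l _ _ _ _ (⟨l.length, _⟩ : Fin (2 * n + 1)) rfl] at key
  simp only [PsiL_eq Ψ (hlen _)]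
  rw [key, sum_getD (hlen a) (fun x => x - a), sum_map_sub_const, hlen]
  push_cast
  rfl

/-- The sign `±1` of a spin. -/
def spinSign (s : Fin 2) : ℂ := if s = 0 then 1 else -1

lemma spinSign_mul_self (s : Fin 2) : spinSign s * spinSign s = 1 := by
  unfold spinSign
  split_ifs <;> norm_num

lemma PsiL_add_pi (h : PsiP3 τ Ψ) {n : ℕ} {l r : List ℂ} {l' : List (Fin 2)}
    (hl : l.length + r.length = 2 * n) (hl' : l'.length = l.length) (a : ℂ) (s : Fin 2)
    (r' : List (Fin 2)) :
    PsiL Ψ (l ++ (a + Real.pi) :: r) (l' ++ s :: r')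
      = spinSign s * (∏ j : Fin (2 * n + 1), spinSign ((l' ++ s :: r').getD j 0))
        * PsiL Ψ (l ++ a :: r) (l' ++ s :: r') := by
  have hlen (a : ℂ) : (l ++ a :: r).length = 2 * n + 1 := by simp; omega
  have key := congrFun (h n (fun j => (l ++ a :: r).getD j 0) ⟨l.length, by omega⟩).1
    (fun j => (l' ++ s :: r').getD j 0)
  simp only [getD_append_cons_self,
    update_getD l _ _ _ _ (⟨l.length, _⟩ : Fin (2 * n + 1)) rfl] at key
  simp only [PsiL_eq Ψ (hlen _)]
  rw [key, ← Finset.mul_prod_erase Finset.univ (fun j : Fin (2 * n + 1) =>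
    spinSign ((l' ++ s :: r').getD j 0)) (Finset.mem_univ (⟨l.length, by omega⟩ : Fin (2 * n + 1)))]
  simp only [← hl', getD_append_cons_self]
  rw [← mul_assoc, spinSign_mul_self, one_mul]
  rfl

lemma prod_spinSign_mul_self {n : ℕ} (α : Fin n → Fin 2) :
    (∏ j, spinSign (α j)) * ∏ j, spinSign (α j) = 1 := by
  rw [← Finset.prod_mul_distrib]
  simp [spinSign_mul_self]

lemma PsiL_add_two_pi (h : PsiP3 τ Ψ) {n : ℕ} {l r : List ℂ} {l' : List (Fin 2)}
    (hl : l.length + r.length = 2 * n) (hl' : l'.length = l.length) (a : ℂ) (s : Fin 2)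
    (r' : List (Fin 2)) :
    PsiL Ψ (l ++ (a + 2 * Real.pi) :: r) (l' ++ s :: r') = PsiL Ψ (l ++ a :: r) (l' ++ s :: r') := by
  rw [two_mul, ← add_assoc, PsiL_add_pi h hl hl', PsiL_add_pi h hl hl']
  have h1 := spinSign_mul_self s
  have h2 := prod_spinSign_mul_self (fun j : Fin (2 * n + 1) => (l' ++ s :: r').getD j 0)
  linear_combination (PsiL Ψ (l ++ a :: r) (l' ++ s :: r')) *
    ((∏ j : Fin (2 * n + 1), spinSign ((l' ++ s :: r').getD j 0)) ^ 2 * h1 + h2)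

lemma PsiL_shift_pi (h : PsiP3 τ Ψ) {n : ℕ} {l r : List ℂ} {l' : List (Fin 2)}
    (hl : l.length + r.length + 1 = 2 * n) (hl' : l'.length = l.length) (a b : ℂ) (s t : Fin 2)
    (r' : List (Fin 2)) :
    PsiL Ψ (l ++ (a + Real.pi) :: (b - Real.pi) :: r) (l' ++ s :: t :: r')
      = spinSign s * spinSign t * PsiL Ψ (l ++ a :: b :: r) (l' ++ s :: t :: r') := by
  have e1 := PsiL_add_pi h (l := l) (r := (b - Real.pi) :: r) (n := n) (by simp; omega) hl' a s
    (t :: r')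
  have e2 := PsiL_add_pi h (l := l ++ [a]) (r := r) (l' := l' ++ [s]) (n := n) (by simp; omega)
    (by simpa using hl') (b - Real.pi) t r'
  simp only [List.append_assoc, List.cons_append, List.nil_append, sub_add_cancel] at e2
  rw [e1, e2]
  have h1 := spinSign_mul_self t
  linear_combination - spinSign s * (∏ j : Fin (2 * n + 1), spinSign ((l' ++ s :: t :: r').getD j 0))
    * PsiL Ψ (l ++ a :: (b - Real.pi) :: r) (l' ++ s :: t :: r') * h1

lemma PsiL_add_two_pi_tau (h : PsiP3 τ Ψ) {n : ℕ} {l r : List ℂ}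
    (hl : l.length + r.length = 2 * n) (a : ℂ) (α : List (Fin 2)) :
    PsiL Ψ (l ++ (a + 2 * Real.pi * τ) :: r) α
      = (pnome τ ^ (4 * n))⁻¹ * cexp (-2 * I * ((2 * n + 1) * a - (l ++ a :: r).sum))
        * PsiL Ψ (l ++ a :: r) α := by
  have hlen (a : ℂ) : (l ++ a :: r).length = 2 * n + 1 := by simp; omega
  have key := congrFun (h n (fun j => (l ++ a :: r).getD j 0) ⟨l.length, by omega⟩).2
    (fun j => α.getD j 0)
  simp only [getD_append_cons_self,
    update_getD l _ _ _ _ (⟨l.length, _⟩ : Fin (2 * n + 1)) rfl] at key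
  simp only [PsiL_eq Ψ (hlen _)]
  rw [key]
  have e : ∑ j : Fin (2 * n + 1), (a - (l ++ a :: r).getD j 0)
      = -∑ j : Fin (2 * n + 1), ((l ++ a :: r).getD j 0 - a) := by
    rw [← Finset.sum_neg_distrib]
    exact Finset.sum_congr rfl fun j _ => by ring
  rw [e, sum_getD (hlen a) (fun x => x - a), sum_map_sub_const, hlen]
  push_cast
  rw [neg_sub]

lemma PsiL_reduce (hτ : 0 < τ.im) (h : PsiP5 τ Ψ) {n : ℕ} {l r : List ℂ} {l' : List (Fin 2)}
    (hl : l.length + r.length = 2 * n + 1) (hl' : l'.length = l.length) (a : ℂ) (s t : Fin 2)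
    (r' : List (Fin 2)) :
    PsiL Ψ (l ++ a :: (a + 2 * ηc) :: r) (l' ++ s :: t :: r')
      = ((l ++ r).map fun x => th1 (a - x - 2 * ηc) τ).prod * singletC s t
        * PsiL Ψ (l ++ r) (l' ++ r') := by
  have hlen : (l ++ a :: (a + 2 * ηc) :: r).length = 2 * (n + 1) + 1 := by simp; omega
  have hlen' : (l ++ r).length = 2 * n + 1 := by simp; omega
  have key := congrFun (h n (fun j => (l ++ a :: (a + 2 * ηc) :: r).getD j 0) l.length (by omega)
    (by simp only [getD_append_cons_self, getD_append_cons_cons]))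
    (fun j => (l' ++ s :: t :: r').getD j 0)
  simp only [getD_append_cons_self, ← hl', getD_append_cons_cons, delTwo_getD l'] at key
  simp only [hl', getD_append_cons_self, delTwo_getD l] at key
  rw [PsiL_eq Ψ hlen, PsiL_eq Ψ hlen', key]
  congr 2
  have hp := prod_getD hlen fun x => th1 (a - x - 2 * ηc) τ
  rw [← Finset.mul_prod_erase _ _ (Finset.mem_univ (⟨l.length, by omega⟩ : Fin (2 * (n + 1) + 1))),
    ← Finset.mul_prod_erase _ _ (Finset.mem_erase.2 ⟨Fin.ne_of_val_ne (by simp),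
      Finset.mem_univ (⟨l.length + 1, by omega⟩ : Fin (2 * (n + 1) + 1))⟩)] at hp
  simp only [getD_append_cons_self, getD_append_cons_cons, List.map_append, List.map_cons,
    List.prod_append, List.prod_cons] at hp
  have hη := th1_η_ne hτ
  have h1 : th1 (a - a - 2 * ηc) τ ≠ 0 := by
    rw [sub_self, zero_sub, th1_neg, th1_two_η]
    exact neg_ne_zero.2 hη
  have h2 : th1 (a - (a + 2 * ηc) - 2 * ηc) τ ≠ 0 := by
    rw [show a - (a + 2 * ηc) - 2 * ηc = -ηc - Real.pi by rw [← three_ηc]; ring, th1_sub_pi,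
      th1_neg, neg_neg]
    exact hη
  rw [List.map_append, List.prod_append]
  refine mul_left_cancel₀ (mul_ne_zero h1 h2) ?_
  rw [mul_assoc, hp]
  ring

lemma PsiL_one (h : PsiP6 Ψ) (x : ℂ) (α : List (Fin 2)) : PsiL Ψ [x] α = 1 := by
  rw [PsiL_eq Ψ (n := 0) rfl]
  exact h _ _

end

/-! ### Contractions and the functions `Z_n` -/

/-- The properties of the family `Ψ_n` used below. -/
structure PsiSol (τ : ℂ) (Ψ : PsiFam) : Prop where
  im_pos : 0 < τ.im
  entire : PsiEntire Ψ
  exchange : PsiP1 τ Ψ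
  flip : PsiP2 τ Ψ
  shift : PsiP3 τ Ψ
  reduce : PsiP5 τ Ψ
  zero : PsiP6 Ψ

/-- Contraction of consecutive pairs of spins with the weights `W x`, the last spin being `↑`. -/
def contr (W : ℂ → Fin 2 → Fin 2 → ℂ) : List ℂ → (List (Fin 2) → ℂ) →ₗ[ℂ] ℂ
  | [] => LinearMap.proj [0]
  | x :: xs => ∑ s, ∑ t, W x s t • (contr W xs).comp (LinearMap.funLeft ℂ ℂ fun β => s :: t :: β)

lemma contr_nil (W : ℂ → Fin 2 → Fin 2 → ℂ) (φ : List (Fin 2) → ℂ) : contr W [] φ = φ [0] := rfl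

lemma contr_cons (W : ℂ → Fin 2 → Fin 2 → ℂ) (x : ℂ) (xs : List ℂ) (φ : List (Fin 2) → ℂ) :
    contr W (x :: xs) φ = ∑ s, ∑ t, W x s t * contr W xs (fun β => φ (s :: t :: β)) := by
  simp only [contr, LinearMap.sum_apply, LinearMap.smul_apply, smul_eq_mul, LinearMap.comp_apply]
  rfl

lemma contr_mul_left (W : ℂ → Fin 2 → Fin 2 → ℂ) (xs : List ℂ) (c : ℂ) (φ : List (Fin 2) → ℂ) :
    contr W xs (fun β => c * φ β) = c * contr W xs φ :=
  (contr W xs).map_smul c φ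

lemma contr_sum (W : ℂ → Fin 2 → Fin 2 → ℂ) (xs : List ℂ) {ι : Type*} (s : Finset ι)
    (φ : ι → List (Fin 2) → ℂ) :
    contr W xs (fun β => ∑ i ∈ s, φ i β) = ∑ i ∈ s, contr W xs (φ i) := by
  rw [← map_sum]
  congr 1
  funext β
  simp

lemma differentiable_contr (W : ℂ → Fin 2 → Fin 2 → ℂ) (xs : List ℂ) {φ : ℂ → List (Fin 2) → ℂ}
    (h : ∀ β, Differentiable ℂ fun z => φ z β) : Differentiable ℂ fun z => contr W xs (φ z) := by
  induction xs generalizing φ with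
  | nil => exact h _
  | cons x xs ih =>
    simp only [contr_cons]
    exact Differentiable.fun_sum fun s _ => Differentiable.fun_sum fun t _ =>
      (ih fun β => h _).const_mul _

/-- The spectral parameters `(x₁,-x₁,…,x_n,-x_n,0)`. -/
def flatU : List ℂ → List ℂ
  | [] => [0]
  | x :: xs => x :: -x :: flatU xs

lemma length_flatU (xs : List ℂ) : (flatU xs).length = 2 * xs.length + 1 := by
  induction xs with
  | nil => rfl
  | cons x xs ih =>
    simp only [flatU, List.length_cons, ih]
    ring

lemma sum_flatU (xs : List ℂ) : (flatU xs).sum = 0 := by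
  induction xs with
  | nil => simp [flatU]
  | cons x xs ih => simp [flatU, ih]

/-- The partial contraction of `Ψ` with given spins at the leading, uncontracted sites. -/
def Zp (τ lam : ℂ) (Ψ : PsiFam) (l : List ℂ) (α : List (Fin 2)) (xs : List ℂ) : ℂ :=
  contr (chiC τ lam) xs fun β => PsiL Ψ (l ++ flatU xs) (α ++ β)

/-- The function `Z_n` with arguments given by a list. -/
def ZL (τ lam : ℂ) (Ψ : PsiFam) (xs : List ℂ) : ℂ := Zp τ lam Ψ [] [] xs

lemma Zp_cons (τ lam : ℂ) (Ψ : PsiFam) (l : List ℂ) (l' : List (Fin 2)) (x : ℂ) (xs : List ℂ) :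
    Zp τ lam Ψ l l' (x :: xs)
      = ∑ s, ∑ t, chiC τ lam x s t * Zp τ lam Ψ (l ++ [x, -x]) (l' ++ [s, t]) xs := by
  simp only [Zp, contr_cons, flatU, List.append_assoc, List.cons_append, List.nil_append]

/-! ### Relation with `S_n` -/

lemma sum_spins_eq_contr (w : Fin 2 → Fin 2 → ℂ) (n : ℕ) (φ : List (Fin 2) → ℂ) :
    ∑ α : Fin (2 * n + 1) → Fin 2, (∏ m : Fin n, w (α ⟨2 * (m : ℕ), by have := m.2; omega⟩)
        (α ⟨2 * (m : ℕ) + 1, by have := m.2; omega⟩))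
      * (if α ⟨2 * n, by omega⟩ = 0 then (1 : ℂ) else 0) * φ (List.ofFn α)
      = contr (fun _ => w) (List.replicate n 0) φ := by
  induction n generalizing φ with
  | zero =>
    simp only [Finset.univ_eq_empty, Finset.prod_empty, one_mul, List.replicate_zero, contr_nil]
    rw [← (Fin.consEquiv fun _ : Fin 1 => Fin 2).sum_comp]
    rw [Fintype.sum_prod_type]
    simp [Fin.consEquiv]
  | succ n ih =>
    rw [List.replicate_succ, contr_cons]
    change ∑ α : Fin (2 * n + 1 + 1 + 1) → Fin 2, _ = _
    rw [← (Fin.consEquiv fun _ : Fin (2 * n + 1 + 1 + 1) => Fin 2).sum_comp, Fintype.sum_prod_type]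
    refine Finset.sum_congr rfl fun s _ => ?_
    rw [← (Fin.consEquiv fun _ : Fin (2 * n + 1 + 1) => Fin 2).sum_comp, Fintype.sum_prod_type]
    refine Finset.sum_congr rfl fun t _ => ?_
    rw [← ih, Finset.mul_sum]
    refine Finset.sum_congr rfl fun α _ => ?_
    rw [Fin.prod_univ_succ, mul_assoc, mul_assoc]
    have e : List.ofFn (Fin.cons s (Fin.cons t α : Fin (2 * n + 1 + 1) → Fin 2) :
        Fin (2 * n + 1 + 1 + 1) → Fin 2) = s :: t :: List.ofFn α := by
      rw [List.ofFn_succ, List.ofFn_succ]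
      rfl
    rw [mul_assoc, ← e]
    rfl

/-- The weight `⟨↑↓| + μ⟨↓↑|`. -/
def omegaW (μ : ℂ) (s t : Fin 2) : ℂ :=
  if s = 0 ∧ t = 1 then 1 else if s = 1 ∧ t = 0 then μ else 0

lemma Sfun_eq_contr (τ : ℂ) (Ψ : PsiFam) (n : ℕ) (μ : ℂ) :
    Sfun τ Ψ n μ = Ncoef τ n * contr (fun _ => omegaW μ) (List.replicate n 0)
      (PsiL Ψ (List.replicate (2 * n + 1) 0)) := by
  rw [← sum_spins_eq_contr, Finset.mul_sum]
  unfold Sfun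
  refine Finset.sum_congr rfl fun α _ => ?_
  rw [PsiL_eq Ψ (n := n) (by simp)]
  have e1 : (fun j : Fin (2 * n + 1) => (List.replicate (2 * n + 1) (0 : ℂ)).getD j 0)
      = fun _ => 0 := by
    funext j
    simp [List.getD]
  have e2 : (fun j : Fin (2 * n + 1) => (List.ofFn α).getD j 0) = α := by
    funext j
    rw [List.getD_eq_getElem _ _ (by rw [List.length_ofFn]; exact j.2), List.getElem_ofFn]
  rw [e1, e2]
  unfold psiH omegaW
  ring

lemma flatU_replicate (n : ℕ) : flatU (List.replicate n 0) = List.replicate (2 * n + 1) 0 := by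
  induction n with
  | zero => rfl
  | succ n ih =>
    rw [List.replicate_succ, flatU, ih, neg_zero]
    rfl

lemma contr_smul_weight {w : Fin 2 → Fin 2 → ℂ} {W : ℂ → Fin 2 → Fin 2 → ℂ} (c : ℂ)
    (h : ∀ s t, W 0 s t = c * w s t) (n : ℕ) (φ : List (Fin 2) → ℂ) :
    contr W (List.replicate n 0) φ = c ^ n * contr (fun _ => w) (List.replicate n 0) φ := by
  induction n generalizing φ with
  | zero => simp [contr_nil]
  | succ n ih =>
    simp only [List.replicate_succ, contr_cons, ih, h, Finset.mul_sum]
    refine Finset.sum_congr rfl fun s _ => Finset.sum_congr rfl fun t _ => ?_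
    ring

lemma ZL_zero_eq_Sfun {τ : ℂ} (Ψ : PsiFam) (n : ℕ) (l : ℂ)
    (hf : th1 l (2 * τ) * th4 (l + 2 * ηc) (2 * τ) ≠ 0) :
    Ncoef τ n * ZL τ l Ψ (List.replicate n 0)
      = (th1 l (2 * τ) * th4 (l + 2 * ηc) (2 * τ)) ^ n * Sfun τ Ψ n
          (-(th1 (l + 2 * ηc) (2 * τ) * th4 l (2 * τ))
            / (th1 l (2 * τ) * th4 (l + 2 * ηc) (2 * τ))) := by
  unfold ZL Zp
  rw [Sfun_eq_contr, contr_smul_weight (th1 l (2 * τ) * th4 (l + 2 * ηc) (2 * τ))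
    (w := omegaW (-(th1 (l + 2 * ηc) (2 * τ) * th4 l (2 * τ))
            / (th1 l (2 * τ) * th4 (l + 2 * ηc) (2 * τ)))), flatU_replicate]
  · simp only [List.nil_append]
    ring
  · intro s t
    unfold chiC omegaW
    rw [zero_add, zero_sub, show -l - 2 * ηc = -(l + 2 * ηc) by ring, th1_neg, th4_neg]
    split_ifs
    · ring
    · rw [mul_div_cancel₀ _ hf]
      ring
    · ring

/-! ### Differentiability -/

section
variable {τ : ℂ} {Ψ : PsiFam}

lemma PsiL_mul_th4_mem (h : PsiSol τ Ψ) {n : ℕ} {l r : List ℂ}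
    (hr : l.length + r.length + 1 = 2 * n) (v : ℂ) {l' : List (Fin 2)}
    (hl' : l'.length = l.length) (s : Fin 2) (r' : List (Fin 2)) :
    (fun z : ℂ => PsiL Ψ (l ++ 2 * Real.pi * z :: v :: r) (l' ++ s :: r')
      * th4 (2 * Real.pi * z + v) (2 * τ))
      ∈ quasiPeriodic τ (-((pnome τ ^ (4 * n))⁻¹
        * cexp (-(2 * Real.pi * I * τ) + 2 * I * (l.sum + r.sum)))) (2 * (2 * n + 1)) := by
  have hd : Differentiable ℂ fun z : ℂ => PsiL Ψ (l ++ 2 * Real.pi * z :: v :: r) (l' ++ s :: r') :=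
    (differentiable_PsiL h.entire (l := l) (n := n) (r := v :: r) (by simp; omega)
      (l' ++ s :: r')).comp (f := fun z : ℂ => 2 * Real.pi * z) (by fun_prop)
  have hd4 : Differentiable ℂ fun z : ℂ => th4 (2 * Real.pi * z + v) (2 * τ) :=
    (differentiable_th4 (two_mul_im_pos h.im_pos)).comp (f := fun z : ℂ => 2 * Real.pi * z + v)
      (by fun_prop)
  refine ⟨hd.mul hd4, fun z => ?_, fun z => ?_⟩
  · have := PsiL_add_two_pi h.shift (l := l) (l' := l') (n := n) (r := v :: r) (by simp; omega)
      hl' (2 * Real.pi * z) s r'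
    beta_reduce
    rw [mul_add, mul_one, this, add_right_comm, two_mul (Real.pi : ℂ), ← add_assoc, th4_add_pi,
      th4_add_pi, ← two_mul]
  · have := PsiL_add_two_pi_tau h.shift (l := l) (n := n) (r := v :: r) (by simp; omega)
      (2 * Real.pi * z) (l' ++ s :: r')
    simp only [List.sum_append, List.sum_cons] at this
    beta_reduce
    rw [mul_add, this, add_right_comm, show 2 * (Real.pi : ℂ) * τ = Real.pi * (2 * τ) by ring,
      th4_add_tau]
    have e : cexp (-2 * I * ((2 * n + 1) * (2 * Real.pi * z)
          - (l.sum + (2 * Real.pi * z + (v + r.sum)))))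
        * cexp (-(Real.pi * I * (2 * τ)) - 2 * I * (2 * Real.pi * z + v))
        = cexp (-(2 * Real.pi * I * τ) + 2 * I * (l.sum + r.sum))
          * cexp (-2 * Real.pi * I * ((2 * (2 * n + 1) : ℕ) : ℂ) * z) := by
      rw [← Complex.exp_add, ← Complex.exp_add]
      congr 1
      push_cast
      ring
    linear_combination -(pnome τ ^ (4 * n))⁻¹
      * PsiL Ψ (l ++ 2 * Real.pi * z :: v :: r) (l' ++ s :: r')
      * th4 (2 * Real.pi * z + v) (2 * τ) * e

lemma differentiable_PsiL_pair (h : PsiSol τ Ψ) {n : ℕ} {l r : List ℂ}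
    (hr : l.length + r.length + 1 = 2 * n) {l' : List (Fin 2)} (hl' : l'.length = l.length)
    (s : Fin 2) (r' : List (Fin 2)) :
    Differentiable ℂ fun x => PsiL Ψ (l ++ x :: -x :: r) (l' ++ s :: r') := by
  have := finite_quasiPeriodic τ (-((pnome τ ^ (4 * n))⁻¹
    * cexp (-(2 * Real.pi * I * τ) + 2 * I * (l.sum + r.sum)))) (m := 2 * (2 * n + 1)) (by omega)
  obtain ⟨N, a, L, hL, hrec⟩ := exists_interpolation_nodes (quasiPeriodic τ
    (-((pnome τ ^ (4 * n))⁻¹ * cexp (-(2 * Real.pi * I * τ) + 2 * I * (l.sum + r.sum))))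
    (2 * (2 * n + 1)))
  have h40 := th4_zero_ne (two_mul_im_pos h.im_pos)
  have hpi : (2 * Real.pi : ℂ) ≠ 0 := by exact_mod_cast Real.two_pi_pos.ne'
  have key : (fun x => PsiL Ψ (l ++ x :: -x :: r) (l' ++ s :: r'))
      = fun x => (∑ j, PsiL Ψ (l ++ 2 * Real.pi * a j :: -x :: r) (l' ++ s :: r')
          * th4 (2 * Real.pi * a j + -x) (2 * τ) * L j (x / (2 * Real.pi))) / th4 0 (2 * τ) := by
    funext x
    have := hrec _ (PsiL_mul_th4_mem h hr (-x) hl' s r') (x / (2 * Real.pi))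
    simp only [mul_div_cancel₀ _ hpi, add_neg_cancel] at this
    rw [← this]
    field_simp
  rw [key]
  refine Differentiable.div_const (Differentiable.fun_sum fun j _ => ?_) _
  have h1 : Differentiable ℂ fun x =>
      PsiL Ψ (l ++ 2 * Real.pi * a j :: -x :: r) (l' ++ s :: r') := by
    have := (differentiable_PsiL h.entire (l := l ++ [2 * Real.pi * a j]) (n := n) (r := r)
      (by simp; omega) (l' ++ s :: r')).comp (f := fun x : ℂ => -x) (by fun_prop)
    simpa only [List.append_assoc, List.cons_append, List.nil_append, Function.comp_def] using this
  have h2 : Differentiable ℂ fun x => th4 (2 * Real.pi * a j + -x) (2 * τ) :=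
    (differentiable_th4 (two_mul_im_pos h.im_pos)).comp (f := fun x : ℂ => 2 * Real.pi * a j + -x)
      (by fun_prop)
  have h3 : Differentiable ℂ fun x => L j (x / (2 * Real.pi)) :=
    (hL j).1.comp (f := fun x : ℂ => x / (2 * Real.pi)) (by fun_prop)
  exact (h1.mul h2).mul h3

lemma differentiable_chiC (hτ : 0 < τ.im) (lam : ℂ) (s t : Fin 2) :
    Differentiable ℂ fun x => chiC τ lam x s t := by
  have h1 := differentiable_th1 (two_mul_im_pos hτ)
  have h4 := differentiable_th4 (two_mul_im_pos hτ)
  have e1 := h1.comp (f := fun x : ℂ => x + lam) (by fun_prop)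
  have e2 := h1.comp (f := fun x : ℂ => x - lam - 2 * ηc) (by fun_prop)
  have e3 := h4.comp (f := fun x : ℂ => x + lam) (by fun_prop)
  have e4 := h4.comp (f := fun x : ℂ => x - lam - 2 * ηc) (by fun_prop)
  unfold chiC
  split_ifs
  · exact e1.mul e4
  · exact e2.mul e3
  · fun_prop

lemma differentiable_Zp (h : PsiSol τ Ψ) (lam : ℂ) {m : ℕ} {p : List ℂ} (hp : p.length = 2 * m)
    {p' : List (Fin 2)} (hp' : p'.length = p.length) (l r : List ℂ) :
    Differentiable ℂ fun x => Zp τ lam Ψ p p' (l ++ x :: r) := by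
  induction l generalizing p p' m with
  | nil =>
    simp only [Zp, contr_cons, flatU, List.nil_append]
    refine Differentiable.fun_sum fun s _ => Differentiable.fun_sum fun t _ =>
      (differentiable_chiC h.im_pos lam s t).mul (differentiable_contr _ _ fun β => ?_)
    exact differentiable_PsiL_pair h (n := m + r.length + 1) (by rw [length_flatU]; omega) hp' s _
  | cons y l ih =>
    simp only [List.cons_append, Zp_cons]
    exact Differentiable.fun_sum fun s _ => Differentiable.fun_sum fun t _ =>
      (ih (m := m + 1) (by simp; omega) (by simp; omega)).const_mul _

lemma differentiable_ZL (h : PsiSol τ Ψ) (lam : ℂ) (l r : List ℂ) :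
    Differentiable ℂ fun x => ZL τ lam Ψ (l ++ x :: r) :=
  differentiable_Zp h lam (m := 0) rfl rfl l r

end

/-! ### Symmetries of `Z_n` -/

lemma eq_zero_of_entire_mul {f g : ℂ → ℂ} (hf : Differentiable ℂ f) (hg : Differentiable ℂ g)
    (h : ∀ z, f z * g z = 0) {z₀ : ℂ} (h₀ : f z₀ ≠ 0) (z : ℂ) : g z = 0 := by
  rcases AnalyticOnNhd.eq_zero_or_eq_zero_of_mul_eq_zero (U := Set.univ)
    (fun z _ => hf.analyticAt z) (fun z _ => hg.analyticAt z) (fun z _ => h z)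
    isPreconnected_univ with h' | h'
  · exact absurd (h' z₀ trivial) h₀
  · exact h' z trivial

/-- The component `χ(x)_{↑↓}`. -/
def chiF (τ lam x : ℂ) : ℂ := th1 (x + lam) (2 * τ) * th4 (x - lam - 2 * ηc) (2 * τ)

/-- The component `χ(x)_{↓↑}`. -/
def chiG (τ lam x : ℂ) : ℂ := th1 (x - lam - 2 * ηc) (2 * τ) * th4 (x + lam) (2 * τ)

section
variable {τ lam : ℂ} {Ψ : PsiFam}

lemma Zp_cons' (l : List ℂ) (l' : List (Fin 2)) (x : ℂ) (xs : List ℂ) :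
    Zp τ lam Ψ l l' (x :: xs) = chiF τ lam x * Zp τ lam Ψ (l ++ [x, -x]) (l' ++ [0, 1]) xs
      + chiG τ lam x * Zp τ lam Ψ (l ++ [x, -x]) (l' ++ [1, 0]) xs := by
  rw [Zp_cons]
  simp [Fin.sum_univ_two, chiC, chiF, chiG]

lemma ZL_cons (x : ℂ) (xs : List ℂ) :
    ZL τ lam Ψ (x :: xs) = chiF τ lam x * Zp τ lam Ψ [x, -x] [0, 1] xs
      + chiG τ lam x * Zp τ lam Ψ [x, -x] [1, 0] xs := by
  rw [ZL, Zp_cons']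
  rfl

lemma Zp_exchange (h : PsiSol τ Ψ) {m : ℕ} {l r : List ℂ} {l' : List (Fin 2)}
    (hl : l.length + r.length = 2 * m) (hl' : l'.length = l.length) (a b : ℂ) (s t : Fin 2)
    (r' : List (Fin 2)) (xs : List ℂ) :
    ∑ s', ∑ t', Rcheckent τ (b - a) (s, t) (s', t')
        * Zp τ lam Ψ (l ++ a :: b :: r) (l' ++ s' :: t' :: r') xs
      = rv τ (b - a) * Zp τ lam Ψ (l ++ b :: a :: r) (l' ++ s :: t :: r') xs := by
  have key (β : List (Fin 2)) := PsiL_exchange h.exchange (n := m + xs.length + 1) (l := l)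
    (r := r ++ flatU xs) (by rw [List.length_append, length_flatU]; omega) hl' a b s t (r' ++ β)
  simp only [Zp, List.append_assoc, List.cons_append]
  rw [← contr_mul_left, ← funext key]
  simp only [contr_sum, contr_mul_left]

lemma Zp_exchange_01 (h : PsiSol τ Ψ) {m : ℕ} {l r : List ℂ} {l' : List (Fin 2)}
    (hl : l.length + r.length = 2 * m) (hl' : l'.length = l.length) (a b : ℂ)
    (r' : List (Fin 2)) (xs : List ℂ) :
    cv τ (b - a) * Zp τ lam Ψ (l ++ a :: b :: r) (l' ++ 0 :: 1 :: r') xs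
      + bv τ (b - a) * Zp τ lam Ψ (l ++ a :: b :: r) (l' ++ 1 :: 0 :: r') xs
      = rv τ (b - a) * Zp τ lam Ψ (l ++ b :: a :: r) (l' ++ 0 :: 1 :: r') xs := by
  rw [← Zp_exchange h hl hl']
  simp [Fin.sum_univ_two, Rcheckent, Rent]

lemma Zp_exchange_10 (h : PsiSol τ Ψ) {m : ℕ} {l r : List ℂ} {l' : List (Fin 2)}
    (hl : l.length + r.length = 2 * m) (hl' : l'.length = l.length) (a b : ℂ)
    (r' : List (Fin 2)) (xs : List ℂ) :
    bv τ (b - a) * Zp τ lam Ψ (l ++ a :: b :: r) (l' ++ 0 :: 1 :: r') xs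
      + cv τ (b - a) * Zp τ lam Ψ (l ++ a :: b :: r) (l' ++ 1 :: 0 :: r') xs
      = rv τ (b - a) * Zp τ lam Ψ (l ++ b :: a :: r) (l' ++ 1 :: 0 :: r') xs := by
  rw [← Zp_exchange h hl hl']
  simp [Fin.sum_univ_two, Rcheckent, Rent]

lemma Zp_exchange_00 (h : PsiSol τ Ψ) {m : ℕ} {l r : List ℂ} {l' : List (Fin 2)}
    (hl : l.length + r.length = 2 * m) (hl' : l'.length = l.length) (a b : ℂ)
    (r' : List (Fin 2)) (xs : List ℂ) :
    av τ (b - a) * Zp τ lam Ψ (l ++ a :: b :: r) (l' ++ 0 :: 0 :: r') xs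
      + dv τ (b - a) * Zp τ lam Ψ (l ++ a :: b :: r) (l' ++ 1 :: 1 :: r') xs
      = rv τ (b - a) * Zp τ lam Ψ (l ++ b :: a :: r) (l' ++ 0 :: 0 :: r') xs := by
  rw [← Zp_exchange h hl hl']
  simp [Fin.sum_univ_two, Rcheckent, Rent]

lemma Zp_exchange_11 (h : PsiSol τ Ψ) {m : ℕ} {l r : List ℂ} {l' : List (Fin 2)}
    (hl : l.length + r.length = 2 * m) (hl' : l'.length = l.length) (a b : ℂ)
    (r' : List (Fin 2)) (xs : List ℂ) :
    dv τ (b - a) * Zp τ lam Ψ (l ++ a :: b :: r) (l' ++ 0 :: 0 :: r') xs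
      + av τ (b - a) * Zp τ lam Ψ (l ++ a :: b :: r) (l' ++ 1 :: 1 :: r') xs
      = rv τ (b - a) * Zp τ lam Ψ (l ++ b :: a :: r) (l' ++ 1 :: 1 :: r') xs := by
  rw [← Zp_exchange h hl hl']
  simp [Fin.sum_univ_two, Rcheckent, Rent]

/-! #### Identities for the weights -/

lemma rv_eq (hτ : 0 < τ.im) (u : ℂ) :
    rv τ u = th4 ηc (2 * τ) * th1 (u + ηc) τ * th2 ηc τ := by
  have := th1_mul_th2 hτ (u + ηc) ηc
  rw [show u + ηc + ηc = u + 2 * ηc by ring, add_sub_cancel_right] at this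
  rw [mul_assoc, this, rv, av, bv, th4_two_η]
  ring

lemma differentiable_rv (hτ : 0 < τ.im) : Differentiable ℂ (rv τ) := by
  rw [funext (rv_eq hτ)]
  have := (differentiable_th1 hτ).comp (f := fun u : ℂ => u + ηc) (by fun_prop)
  exact (this.const_mul _).mul_const _

lemma rv_zero_ne (hτ : 0 < τ.im) : rv τ 0 ≠ 0 := by
  rw [rv_eq hτ, zero_add]
  exact mul_ne_zero (mul_ne_zero (th4_η_ne (two_mul_im_pos hτ)) (th1_η_ne hτ)) (th2_η_ne hτ)

lemma chiF_add_chiG (hτ : 0 < τ.im) (x : ℂ) :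
    chiF τ lam x + chiG τ lam x = th1 (x - ηc) τ * th2 (lam + ηc) τ := chi_sum hτ x lam

lemma chiF_sub_chiG (hτ : 0 < τ.im) (x : ℂ) :
    chiF τ lam x - chiG τ lam x = th1 (lam + ηc) τ * th2 (x - ηc) τ := chi_diff hτ x lam

lemma chi_neg_exchange (hτ : 0 < τ.im) (x : ℂ) :
    chiF τ lam (-x) * cv τ (-x - x) + chiG τ lam (-x) * bv τ (-x - x)
      = th4 (2 * ηc - 2 * x) (2 * τ) * th4 0 (2 * τ) * th1 (2 * x + 2 * ηc) (2 * τ)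
        * chiF τ lam x ∧
    chiF τ lam (-x) * bv τ (-x - x) + chiG τ lam (-x) * cv τ (-x - x)
      = th4 (2 * ηc - 2 * x) (2 * τ) * th4 0 (2 * τ) * th1 (2 * x + 2 * ηc) (2 * τ)
        * chiG τ lam x := by
  have hp := chiF_add_chiG (lam := lam) hτ x
  have hm := chiF_sub_chiG (lam := lam) hτ x
  have hp' := chiF_add_chiG (lam := lam) hτ (-x)
  have hm' := chiF_sub_chiG (lam := lam) hτ (-x)
  have es := th1_mul_th2_self hτ (x + ηc)
  have e1 := th1_mul_th2 hτ (ηc - x) (ηc + x)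
  have e2 := th1_mul_th2 hτ (ηc + x) (ηc - x)
  rw [show 2 * (x + ηc) = 2 * x + 2 * ηc by ring] at es
  rw [show ηc - x + (ηc + x) = 2 * ηc by ring, show ηc - x - (ηc + x) = -(2 * x) by ring,
    th4_neg, th1_neg] at e1
  rw [show ηc + x + (ηc - x) = 2 * ηc by ring, show ηc + x - (ηc - x) = 2 * x by ring] at e2
  rw [show -x - ηc = -(x + ηc) by ring] at hp' hm'
  rw [th1_neg] at hp'
  rw [th2_neg] at hm'
  rw [show ηc - x = -(x - ηc) by ring, th1_neg, add_comm ηc x] at e1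
  rw [show ηc - x = -(x - ηc) by ring, th2_neg, add_comm ηc x] at e2
  unfold bv cv
  rw [show -x - x + 2 * ηc = 2 * ηc - 2 * x by ring, show -x - x = -(2 * x) by ring, th1_neg,
    th4_neg]
  set T := th4 (2 * ηc - 2 * x) (2 * τ)
  have k1 : (chiF τ lam (-x) + chiG τ lam (-x)) * (T * (th1 (2 * ηc) (2 * τ) * th4 (2 * x) (2 * τ)
      + th4 (2 * ηc) (2 * τ) * -th1 (2 * x) (2 * τ)))
      = T * (th4 0 (2 * τ) * th1 (2 * x + 2 * ηc) (2 * τ)) * (chiF τ lam x + chiG τ lam x) := by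
    rw [← e1, ← es, hp, hp']
    ring
  have k2 : (chiF τ lam (-x) - chiG τ lam (-x)) * (T * (th1 (2 * ηc) (2 * τ) * th4 (2 * x) (2 * τ)
      + th4 (2 * ηc) (2 * τ) * th1 (2 * x) (2 * τ)))
      = T * (th4 0 (2 * τ) * th1 (2 * x + 2 * ηc) (2 * τ)) * (chiF τ lam x - chiG τ lam x) := by
    rw [← e2, ← es, hm, hm']
    ring
  constructor
  · linear_combination (k1 + k2) / 2
  · linear_combination (k1 - k2) / 2

lemma two_mul_th4_zero_mul (hτ : 0 < τ.im) (y : ℂ) :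
    th4 0 (2 * τ) * (th1 y (2 * τ) * th4 y (2 * τ)) = th4 ηc (2 * τ) * th2 ηc τ * th1 y τ := by
  have h40 := th4_zero_ne (two_mul_im_pos hτ)
  have e1 := two_th1_mul_th4 hτ y
  have e2 := two_Kth_mul hτ
  unfold Kth at e2
  rw [mul_div_assoc', div_mul_eq_mul_div, div_eq_iff h40] at e2
  linear_combination th4 0 (2 * τ) / 2 * e1 - th1 y τ / 2 * e2

lemma ZL_neg (h : PsiSol τ Ψ) (x : ℂ) (xs : List ℂ) :
    ZL τ lam Ψ (-x :: xs) * th4 (2 * x - ηc) (2 * τ)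
      = ZL τ lam Ψ (x :: xs) * th4 (2 * x + ηc) (2 * τ) := by
  have hτ := h.im_pos
  have dZ := differentiable_ZL h lam [] xs
  have d4 := differentiable_th4 (two_mul_im_pos hτ)
  have d1 : Differentiable ℂ fun x : ℂ => rv τ (-x - x) :=
    (differentiable_rv hτ).comp (f := fun x : ℂ => -x - x) (by fun_prop)
  have d2 : Differentiable ℂ fun x : ℂ => ZL τ lam Ψ (-x :: xs) * th4 (2 * x - ηc) (2 * τ)
      - ZL τ lam Ψ (x :: xs) * th4 (2 * x + ηc) (2 * τ) :=
    ((dZ.comp (f := fun x : ℂ => -x) (by fun_prop)).mul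
      (d4.comp (f := fun x : ℂ => 2 * x - ηc) (by fun_prop))).sub
      (dZ.mul (d4.comp (f := fun x : ℂ => 2 * x + ηc) (by fun_prop)))
  refine sub_eq_zero.1 (eq_zero_of_entire_mul d1 d2 (fun x => ?_) (z₀ := 0)
    (by simpa using rv_zero_ne hτ) x)
  have e01 := Zp_exchange_01 (lam := lam) h (l := []) (r := []) (l' := []) (m := 0) rfl rfl x (-x)
    [] xs
  have e10 := Zp_exchange_10 (lam := lam) h (l := []) (r := []) (l' := []) (m := 0) rfl rfl x (-x)
    [] xs
  simp only [List.nil_append] at e01 e10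
  obtain ⟨k1, k2⟩ := chi_neg_exchange (lam := lam) hτ x
  have key := two_mul_th4_zero_mul hτ (2 * x - ηc)
  have er : rv τ (-x - x) = - (th4 ηc (2 * τ) * th2 ηc τ * th1 (2 * x - ηc) τ) := by
    rw [rv_eq hτ, show -x - x + ηc = -(2 * x - ηc) by ring, th1_neg]
    ring
  rw [show 2 * ηc - 2 * x = -(2 * x + ηc - Real.pi) by rw [← three_ηc]; ring, th4_neg, th4_sub_pi,
    show 2 * x + 2 * ηc = 2 * x - ηc + Real.pi by rw [← three_ηc]; ring, th1_add_pi] at k1 k2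
  rw [ZL_cons, ZL_cons, neg_neg]
  rw [er] at e01 e10 ⊢
  linear_combination (-(th4 (2 * x - ηc) (2 * τ)) * chiF τ lam (-x)) * e01
    + (-(th4 (2 * x - ηc) (2 * τ)) * chiG τ lam (-x)) * e10
    + th4 (2 * x - ηc) (2 * τ) * Zp τ lam Ψ [x, -x] [0, 1] xs * k1
    + th4 (2 * x - ηc) (2 * τ) * Zp τ lam Ψ [x, -x] [1, 0] xs * k2
    - th4 (2 * x + ηc) (2 * τ) * (chiF τ lam x * Zp τ lam Ψ [x, -x] [0, 1] xs
      + chiG τ lam x * Zp τ lam Ψ [x, -x] [1, 0] xs) * key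

/-! #### Exchange of two variables -/

lemma chi_quadratic (hτ : 0 < τ.im) (x y : ℂ) :
    chiF τ lam x * chiF τ lam y - chiG τ lam x * chiG τ lam y
      = - (th1 (lam + ηc) τ * th2 (lam + ηc) τ * th1 (-y - x + 2 * ηc) (2 * τ)
        * th4 (y - x) (2 * τ)) ∧
    chiG τ lam x * chiF τ lam y - chiG τ lam y * chiF τ lam x
      = - (th1 (lam + ηc) τ * th2 (lam + ηc) τ * th4 (-y - x + 2 * ηc) (2 * τ)
        * th1 (y - x) (2 * τ)) := by
  have hp := chiF_add_chiG (lam := lam) hτ x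
  have hm := chiF_sub_chiG (lam := lam) hτ x
  have hp' := chiF_add_chiG (lam := lam) hτ y
  have hm' := chiF_sub_chiG (lam := lam) hτ y
  have e1 := th1_mul_th2 hτ (x - ηc) (y - ηc)
  have e2 := th1_mul_th2 hτ (y - ηc) (x - ηc)
  rw [show x - ηc + (y - ηc) = -(-y - x + 2 * ηc) by ring,
    show x - ηc - (y - ηc) = -(y - x) by ring, th1_neg, th4_neg, th4_neg, th1_neg] at e1
  rw [show y - ηc + (x - ηc) = -(-y - x + 2 * ηc) by ring,
    show y - ηc - (x - ηc) = y - x by ring, th1_neg, th4_neg] at e2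
  have k1 : (chiF τ lam x + chiG τ lam x) * (chiF τ lam y - chiG τ lam y)
      = (th1 (x - ηc) τ * th2 (y - ηc) τ) * (th1 (lam + ηc) τ * th2 (lam + ηc) τ) := by
    rw [hp, hm']; ring
  have k2 : (chiF τ lam x - chiG τ lam x) * (chiF τ lam y + chiG τ lam y)
      = (th1 (y - ηc) τ * th2 (x - ηc) τ) * (th1 (lam + ηc) τ * th2 (lam + ηc) τ) := by
    rw [hm, hp']; ring
  rw [e1] at k1
  rw [e2] at k2
  constructor
  · linear_combination (k1 + k2) / 2
  · linear_combination (k1 - k2) / 2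

lemma Zp_swap_mul (h : PsiSol τ Ψ) {m : ℕ} {p : List ℂ} (hp : p.length = 2 * m)
    {p' : List (Fin 2)} (hp' : p'.length = p.length) (x y : ℂ) (xs : List ℂ) :
    rv τ (-y - x) * rv τ (y - x)
      * (Zp τ lam Ψ p p' (y :: x :: xs) - Zp τ lam Ψ p p' (x :: y :: xs)) = 0 := by
  have hτ := h.im_pos
  have l1 : (p ++ ([] : List ℂ)).length + [-y, -x].length = 2 * (m + 1) := by simp; omega
  have l2 (z w : ℂ) : (p ++ [z]).length + [w].length = 2 * (m + 1) := by simp; omega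
  have l3 (z w : ℂ) : (p ++ [z, w]).length + ([] : List ℂ).length = 2 * (m + 1) := by simp; omega
  have m1 : (p' ++ ([] : List (Fin 2))).length = (p ++ ([] : List ℂ)).length := by simpa using hp'
  have m2 (z : ℂ) (s : Fin 2) : (p' ++ [s]).length = (p ++ [z]).length := by simp; omega
  have m3 (z w : ℂ) (s t : Fin 2) : (p' ++ [s, t]).length = (p ++ [z, w]).length := by
    simp; omega
  have hP00 (u v : Fin 2) := Zp_exchange_00 (lam := lam) h l1 m1 x y [u, v] xs
  have hP01 (u v : Fin 2) := Zp_exchange_01 (lam := lam) h l1 m1 x y [u, v] xs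
  have hP10 (u v : Fin 2) := Zp_exchange_10 (lam := lam) h l1 m1 x y [u, v] xs
  have hP11 (u v : Fin 2) := Zp_exchange_11 (lam := lam) h l1 m1 x y [u, v] xs
  have hQ00 (u v : Fin 2) := Zp_exchange_00 (lam := lam) h (l3 x y) (m3 x y u v) (-y) (-x) [] xs
  have hQ01 (u v : Fin 2) := Zp_exchange_01 (lam := lam) h (l3 x y) (m3 x y u v) (-y) (-x) [] xs
  have hQ10 (u v : Fin 2) := Zp_exchange_10 (lam := lam) h (l3 x y) (m3 x y u v) (-y) (-x) [] xs
  have hQ11 (u v : Fin 2) := Zp_exchange_11 (lam := lam) h (l3 x y) (m3 x y u v) (-y) (-x) [] xs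
  have hA00 (u v : Fin 2) := Zp_exchange_00 (lam := lam) h (l2 y (-x)) (m2 y u) x (-y) [v] xs
  have hA01 (u v : Fin 2) := Zp_exchange_01 (lam := lam) h (l2 y (-x)) (m2 y u) x (-y) [v] xs
  have hA10 (u v : Fin 2) := Zp_exchange_10 (lam := lam) h (l2 y (-x)) (m2 y u) x (-y) [v] xs
  have hA11 (u v : Fin 2) := Zp_exchange_11 (lam := lam) h (l2 y (-x)) (m2 y u) x (-y) [v] xs
  have hB00 (u v : Fin 2) := Zp_exchange_00 (lam := lam) h (l2 x (-y)) (m2 x u) y (-x) [v] xs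
  have hB01 (u v : Fin 2) := Zp_exchange_01 (lam := lam) h (l2 x (-y)) (m2 x u) y (-x) [v] xs
  have hB10 (u v : Fin 2) := Zp_exchange_10 (lam := lam) h (l2 x (-y)) (m2 x u) y (-x) [v] xs
  have hB11 (u v : Fin 2) := Zp_exchange_11 (lam := lam) h (l2 x (-y)) (m2 x u) y (-x) [v] xs
  simp only [List.append_assoc, List.nil_append] at hP00 hP01 hP10 hP11
  simp only [List.append_assoc, List.cons_append, List.nil_append,
    show -x - -y = y - x by ring] at hQ00 hQ01 hQ10 hQ11
  simp only [List.append_assoc, List.cons_append, List.nil_append] at hA00 hA01 hA10 hA11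
  simp only [List.append_assoc, List.cons_append, List.nil_append,
    show -x - y = -y - x by ring] at hB00 hB01 hB10 hB11
  simp only [Zp_cons', List.append_assoc, List.cons_append, List.nil_append]
  obtain ⟨q1, q2⟩ := chi_quadratic (lam := lam) hτ x y
  have id1 : cv τ (-y - x) * bv τ (y - x)
        * (chiF τ lam x * chiF τ lam y - chiG τ lam x * chiG τ lam y)
      = av τ (-y - x) * cv τ (y - x)
        * (chiG τ lam x * chiF τ lam y - chiG τ lam y * chiF τ lam x) := by
    rw [q1, q2, av, bv, cv, cv]
    ring
  have id2 : bv τ (-y - x) * dv τ (y - x)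
        * (chiF τ lam x * chiF τ lam y - chiG τ lam x * chiG τ lam y)
      = dv τ (-y - x) * av τ (y - x)
        * (chiG τ lam x * chiF τ lam y - chiG τ lam y * chiF τ lam x) := by
    rw [q1, q2, av, bv, dv, dv]
    ring
  generalize chiF τ lam x = f1 at *
  generalize chiG τ lam x = g1 at *
  generalize chiF τ lam y = f2 at *
  generalize chiG τ lam y = g2 at *
  generalize av τ (-y - x) = a at *
  generalize bv τ (-y - x) = b at *
  generalize cv τ (-y - x) = c at *
  generalize dv τ (-y - x) = d at *
  generalize rv τ (-y - x) = r at *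
  generalize av τ (y - x) = a' at *
  generalize bv τ (y - x) = b' at *
  generalize cv τ (y - x) = c' at *
  generalize dv τ (y - x) = d' at *
  generalize rv τ (y - x) = r' at *
  linear_combination
    -r' * (f2 * f1 * hA10 0 1 + f2 * g1 * hA11 0 0 + g2 * f1 * hA00 1 1 + g2 * g1 * hA01 1 0)
    + r' * (f1 * f2 * hB10 0 1 + f1 * g2 * hB11 0 0 + g1 * f2 * hB00 1 1 + g1 * g2 * hB01 1 0)
    - f2 * f1 * (b * hP00 1 1 + c * hP01 0 1) - f2 * g1 * (d * hP00 0 0 + a * hP01 1 0)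
    - g2 * f1 * (a * hP10 0 1 + d * hP11 1 1) - g2 * g1 * (c * hP10 1 0 + b * hP11 0 0)
    + f1 * f2 * (b * hQ11 0 0 + c * hQ01 0 1) + f1 * g2 * (d * hQ00 0 0 + a * hQ10 0 1)
    + g1 * f2 * (a * hQ01 1 0 + d * hQ11 1 1) + g1 * g2 * (c * hQ10 1 0 + b * hQ00 1 1)
    + (Zp τ lam Ψ (p ++ [x, y, -y, -x]) (p' ++ [1, 1, 1, 1]) xs
      - Zp τ lam Ψ (p ++ [x, y, -y, -x]) (p' ++ [0, 0, 0, 0]) xs) * id2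
    + (Zp τ lam Ψ (p ++ [x, y, -y, -x]) (p' ++ [1, 0, 0, 1]) xs
      - Zp τ lam Ψ (p ++ [x, y, -y, -x]) (p' ++ [0, 1, 1, 0]) xs) * id1

lemma Zp_swap_of_ne (h : PsiSol τ Ψ) {m : ℕ} {p : List ℂ} (hp : p.length = 2 * m)
    {p' : List (Fin 2)} (hp' : p'.length = p.length) (l r : List ℂ) {x y : ℂ}
    (hr : rv τ (-y - x) * rv τ (y - x) ≠ 0) :
    Zp τ lam Ψ p p' (l ++ x :: y :: r) = Zp τ lam Ψ p p' (l ++ y :: x :: r) := by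
  induction l generalizing p p' m with
  | nil =>
    have := (mul_eq_zero.1 (Zp_swap_mul (lam := lam) h hp hp' x y r)).resolve_left hr
    exact (sub_eq_zero.1 this).symm
  | cons z l ih =>
    simp only [List.cons_append, Zp_cons]
    refine Finset.sum_congr rfl fun s _ => Finset.sum_congr rfl fun t _ => ?_
    rw [ih (m := m + 1) (by simp; omega) (by simp; omega)]

lemma ZL_swap (h : PsiSol τ Ψ) (l r : List ℂ) (x y : ℂ) :
    ZL τ lam Ψ (l ++ x :: y :: r) = ZL τ lam Ψ (l ++ y :: x :: r) := by
  have hτ := h.im_pos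
  have d1 := differentiable_ZL h lam l (y :: r)
  have d2 : Differentiable ℂ fun x => ZL τ lam Ψ (l ++ y :: x :: r) := by
    simpa using differentiable_ZL h lam (l ++ [y]) r
  have dr := (differentiable_rv hτ)
  have d3 : Differentiable ℂ fun x => rv τ (-y - x) :=
    dr.comp (f := fun x : ℂ => -y - x) (by fun_prop)
  have d4 : Differentiable ℂ fun x => rv τ (y - x) :=
    dr.comp (f := fun x : ℂ => y - x) (by fun_prop)
  have key (x : ℂ) : rv τ (-y - x) * (rv τ (y - x)
      * (ZL τ lam Ψ (l ++ x :: y :: r) - ZL τ lam Ψ (l ++ y :: x :: r))) = 0 := by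
    by_cases hr : rv τ (-y - x) * rv τ (y - x) = 0
    · rw [← mul_assoc, hr, zero_mul]
    · rw [ZL, ZL, Zp_swap_of_ne h (m := 0) rfl rfl l r hr, sub_self, mul_zero, mul_zero]
  have k2 := eq_zero_of_entire_mul d3 (d4.mul (d1.sub d2)) key (z₀ := -y)
    (by simpa using rv_zero_ne hτ)
  exact sub_eq_zero.1 (eq_zero_of_entire_mul d4 (d1.sub d2) k2 (z₀ := y)
    (by simpa using rv_zero_ne hτ) x)

lemma ZL_perm (h : PsiSol τ Ψ) {l₁ l₂ : List ℂ} (hp : l₁.Perm l₂) :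
    ZL τ lam Ψ l₁ = ZL τ lam Ψ l₂ := by
  suffices H : ∀ l, ZL τ lam Ψ (l ++ l₁) = ZL τ lam Ψ (l ++ l₂) from H []
  induction hp with
  | nil => exact fun _ => rfl
  | cons x _ ih =>
    intro l
    simpa using ih (l ++ [x])
  | swap x y r => exact fun l => ZL_swap h l r y x
  | trans _ _ ih1 ih2 => exact fun l => (ih1 l).trans (ih2 l)

end

/-! ### Quasi-periodicity and reduction of `Z_n` -/

section
variable {τ lam : ℂ} {Ψ : PsiFam}

lemma chiF_add_pi (x : ℂ) : chiF τ lam (x + Real.pi) = - chiF τ lam x := by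
  rw [chiF, chiF, show x + (Real.pi : ℂ) + lam = x + lam + Real.pi by ring,
    show x + (Real.pi : ℂ) - lam - 2 * ηc = x - lam - 2 * ηc + Real.pi by ring, th1_add_pi,
    th4_add_pi]
  ring

lemma chiG_add_pi (x : ℂ) : chiG τ lam (x + Real.pi) = - chiG τ lam x := by
  rw [chiG, chiG, show x + (Real.pi : ℂ) + lam = x + lam + Real.pi by ring,
    show x + (Real.pi : ℂ) - lam - 2 * ηc = x - lam - 2 * ηc + Real.pi by ring, th1_add_pi,
    th4_add_pi]
  ring

lemma th1_th4_add_half_tau (a b : ℂ) :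
    th1 (a + Real.pi * τ) (2 * τ) * th4 (b + Real.pi * τ) (2 * τ)
      = - cexp (-(Real.pi * I * τ) - I * (a + b)) * (th1 b (2 * τ) * th4 a (2 * τ)) := by
  rw [show (Real.pi : ℂ) * τ = Real.pi * (2 * τ) / 2 by ring, th1_add_half_tau, th4_add_half_tau]
  have : cexp (-(Real.pi * I * (2 * τ) / 4) - I * a) * cexp (-(Real.pi * I * (2 * τ) / 4) - I * b)
      = cexp (-(Real.pi * I * τ) - I * (a + b)) := by
    rw [← Complex.exp_add]
    congr 1
    ring
  linear_combination (-(th1 b (2 * τ) * th4 a (2 * τ))) * this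
    + th1 b (2 * τ) * th4 a (2 * τ) * cexp (-(Real.pi * I * (2 * τ) / 4) - I * a)
      * cexp (-(Real.pi * I * (2 * τ) / 4) - I * b) * Complex.I_sq

lemma chiF_add_tau (x : ℂ) :
    chiF τ lam (x + Real.pi * τ)
      = - cexp (-(Real.pi * I * τ) - I * (2 * x - 2 * ηc)) * chiG τ lam x := by
  rw [chiF, chiG, show x + Real.pi * τ + lam = x + lam + Real.pi * τ by ring,
    show x + Real.pi * τ - lam - 2 * ηc = x - lam - 2 * ηc + Real.pi * τ by ring,
    th1_th4_add_half_tau, show x + lam + (x - lam - 2 * ηc) = 2 * x - 2 * ηc by ring]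

lemma chiG_add_tau (x : ℂ) :
    chiG τ lam (x + Real.pi * τ)
      = - cexp (-(Real.pi * I * τ) - I * (2 * x - 2 * ηc)) * chiF τ lam x := by
  rw [chiF, chiG, show x + Real.pi * τ + lam = x + lam + Real.pi * τ by ring,
    show x + Real.pi * τ - lam - 2 * ηc = x - lam - 2 * ηc + Real.pi * τ by ring,
    th1_th4_add_half_tau, show x - lam - 2 * ηc + (x + lam) = 2 * x - 2 * ηc by ring]

lemma Zp_shift_pi (h : PsiSol τ Ψ) (x : ℂ) (s t : Fin 2) (xs : List ℂ) :
    Zp τ lam Ψ [x + Real.pi, -(x + Real.pi)] [s, t] xs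
      = spinSign s * spinSign t * Zp τ lam Ψ [x, -x] [s, t] xs := by
  have key (β : List (Fin 2)) := PsiL_shift_pi h.shift (n := xs.length + 1) (l := []) (l' := [])
    (r := flatU xs) (by rw [length_flatU, List.length_nil]; omega) rfl x (-x) s t β
  simp only [Zp, List.cons_append, List.nil_append] at key ⊢
  rw [← contr_mul_left, ← funext key, neg_add']

lemma ZL_add_pi (h : PsiSol τ Ψ) (x : ℂ) (xs : List ℂ) :
    ZL τ lam Ψ ((x + Real.pi) :: xs) = ZL τ lam Ψ (x :: xs) := by
  rw [ZL_cons, ZL_cons, Zp_shift_pi h, Zp_shift_pi h, chiF_add_pi, chiG_add_pi]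
  simp [spinSign]

lemma flipS_flipS (s : Fin 2) : flipS (flipS s) = s := by
  fin_cases s <;> rfl

lemma PsiL_shift_tau (h : PsiSol τ Ψ) (x : ℂ) (s t : Fin 2) (β : List (Fin 2)) (xs : List ℂ) :
    PsiL Ψ ((x + Real.pi * τ) :: -(x + Real.pi * τ) :: flatU xs) (s :: t :: β)
      = cexp (-I * (2 * (xs.length + 1 : ℕ) + 1) * (2 * x + Real.pi * τ))
        * PsiL Ψ (x :: -x :: flatU xs) (flipS s :: flipS t :: β) := by
  have hlen : (flatU xs).length + 1 = 2 * (xs.length + 1) := by rw [length_flatU]; ring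
  have k1 := PsiL_flip h.flip (n := xs.length + 1) (l := []) (l' := [])
    (r := -(x + Real.pi * τ) :: flatU xs) (by simp [length_flatU]; ring) rfl x s (t :: β)
  have k2 := PsiL_flip h.flip (n := xs.length + 1) (l := [x]) (l' := [flipS s])
    (r := flatU xs) (by simp [length_flatU]; ring) rfl (-(x + Real.pi * τ)) (flipS t) β
  rw [flipS_flipS] at k2
  simp only [List.nil_append, List.cons_append, List.sum_cons, sum_flatU] at k1 k2
  rw [k1, show -(x + Real.pi * τ) + Real.pi * τ = -x by ring] at k2
  have hp : (-(pnome τ)) ^ (xs.length + 1) ≠ 0 := pow_ne_zero _ (neg_ne_zero.2 (exp_ne_zero _))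
  rw [mul_assoc, mul_assoc, mul_right_inj' hp] at k2
  have e : cexp (-I * (x + (-(x + Real.pi * τ) + 0)
        - (2 * ((xs.length + 1 : ℕ) : ℂ) + 1) * -(x + Real.pi * τ)))
      = cexp (-I * (x + (-(x + Real.pi * τ) + 0) - (2 * ((xs.length + 1 : ℕ) : ℂ) + 1) * x))
        * cexp (-I * (2 * (xs.length + 1 : ℕ) + 1) * (2 * x + Real.pi * τ)) := by
    rw [← Complex.exp_add]
    congr 1
    ring
  rw [e, mul_assoc] at k2
  exact mul_left_cancel₀ (exp_ne_zero _) k2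

lemma ZL_add_tau (h : PsiSol τ Ψ) (x : ℂ) (xs : List ℂ) :
    ZL τ lam Ψ ((x + Real.pi * τ) :: xs)
      = - cexp (2 * I * ηc - (2 * (xs.length + 1 : ℕ) + 2) * (Real.pi * I * τ + 2 * I * x))
        * ZL τ lam Ψ (x :: xs) := by
  have key (s t : Fin 2) : Zp τ lam Ψ [x + Real.pi * τ, -(x + Real.pi * τ)] [s, t] xs
      = cexp (-I * (2 * (xs.length + 1 : ℕ) + 1) * (2 * x + Real.pi * τ))
        * Zp τ lam Ψ [x, -x] [flipS s, flipS t] xs := by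
    simp only [Zp, List.cons_append, List.nil_append, PsiL_shift_tau h]
    rw [contr_mul_left]
  have e : cexp (2 * I * ηc - (2 * (xs.length + 1 : ℕ) + 2) * (Real.pi * I * τ + 2 * I * x))
      = cexp (-(Real.pi * I * τ) - I * (2 * x - 2 * ηc))
        * cexp (-I * (2 * (xs.length + 1 : ℕ) + 1) * (2 * x + Real.pi * τ)) := by
    rw [← Complex.exp_add]
    congr 1
    ring
  rw [ZL_cons, ZL_cons, key, key, chiF_add_tau, chiG_add_tau, e]
  simp only [flipS, if_true, one_ne_zero, if_false]
  ring

lemma prod_map_eq_zero_of_mem {f : ℂ → ℂ} {l : List ℂ} {x : ℂ} (hx : x ∈ l) (h : f x = 0) :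
    (l.map f).prod = 0 :=
  List.prod_eq_zero (List.mem_map.2 ⟨x, hx, h⟩)

lemma zero_mem_flatU (xs : List ℂ) : (0 : ℂ) ∈ flatU xs := by
  induction xs with
  | nil => simp [flatU]
  | cons x xs ih => simp [flatU, ih]

lemma ZL_neg_η (h : PsiSol τ Ψ) (xs : List ℂ) : ZL τ lam Ψ (-ηc :: xs) = 0 := by
  have key (s t : Fin 2) : Zp τ lam Ψ [-ηc, - -ηc] [s, t] xs = 0 := by
    have (β : List (Fin 2)) : PsiL Ψ (-ηc :: - -ηc :: flatU xs) (s :: t :: β) = 0 := by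
      have := PsiL_reduce h.im_pos h.reduce (n := xs.length) (l := []) (l' := []) (r := flatU xs)
        (by rw [length_flatU, List.length_nil]; omega) rfl (-ηc) s t β
      simp only [List.nil_append] at this
      rw [show - -ηc = -ηc + 2 * ηc by ring, this, prod_map_eq_zero_of_mem (zero_mem_flatU xs)]
      · simp
      · rw [show -ηc - 0 - 2 * ηc = 0 - Real.pi by rw [← three_ηc]; ring, th1_sub_pi, th1_zero,
          neg_zero]
    simp only [Zp, List.cons_append, List.nil_append, this]
    exact (contr _ _).map_zero
  rw [ZL_cons, key, key]
  ring

lemma prod_map_flatU (f : ℂ → ℂ) (hf : ∀ x, f (-x) = f x) (s : List ℂ) :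
    ((flatU s).map f).prod = f 0 * (s.map fun x => f x ^ 2).prod := by
  induction s with
  | nil => simp [flatU]
  | cons x s ih =>
    simp only [flatU, List.map_cons, List.prod_cons, ih, hf]
    ring

lemma bv_neg_two_η (τ : ℂ) : bv τ (-(2 * ηc)) = - cv τ (-(2 * ηc)) := by
  rw [bv, cv, th1_neg, th4_neg]
  ring

lemma rv_neg_two_η (τ : ℂ) : rv τ (-(2 * ηc)) = - cv τ (-(2 * ηc)) := by
  rw [rv, bv_neg_two_η, av, neg_add_cancel, th1_zero]
  ring

lemma cv_neg_two_η_ne (hτ : 0 < τ.im) : cv τ (-(2 * ηc)) ≠ 0 := by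
  have hτ2 := two_mul_im_pos hτ
  rw [cv, th4_neg, neg_add_cancel, th1_two_η, th4_two_η]
  exact mul_ne_zero (mul_ne_zero (th1_η_ne hτ2) (th4_zero_ne hτ2)) (th4_η_ne hτ2)

lemma Zp_pair_reduce (h : PsiSol τ Ψ) (y : ℂ) (s : List ℂ) :
    Zp τ lam Ψ [y, y - 2 * ηc] [0, 1] s - Zp τ lam Ψ [y, y - 2 * ηc] [1, 0] s
      = - (((flatU s).map fun x => th1 (y - 4 * ηc - x) τ).prod * ZL τ lam Ψ s) := by
  have e := Zp_exchange_01 (lam := lam) h (l := []) (r := []) (l' := []) (m := 0) rfl rfl y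
    (y - 2 * ηc) [] s
  simp only [List.nil_append, sub_sub_cancel_left] at e
  rw [bv_neg_two_η, rv_neg_two_η] at e
  have e2 : Zp τ lam Ψ [y - 2 * ηc, y] [0, 1] s
      = ((flatU s).map fun x => th1 (y - 4 * ηc - x) τ).prod * ZL τ lam Ψ s := by
    have key (β : List (Fin 2)) := PsiL_reduce h.im_pos h.reduce (n := s.length) (l := [])
      (l' := []) (r := flatU s) (by rw [length_flatU, List.length_nil]; omega) rfl (y - 2 * ηc)
      0 1 β
    simp only [sub_add_cancel, List.nil_append] at key
    simp only [ZL, Zp, List.cons_append, List.nil_append, key]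
    rw [contr_mul_left]
    simp only [singletC, true_and, if_true, mul_one]
    congr 3
    funext x
    congr 1
    ring
  rw [e2] at e
  refine mul_left_cancel₀ (cv_neg_two_η_ne h.im_pos) ?_
  linear_combination e

lemma chiF_two_η_sub (y : ℂ) : chiF τ lam (2 * ηc - y) = - chiG τ lam y := by
  rw [chiF, chiG, show 2 * ηc - y + lam = -(y - lam - 2 * ηc) by ring,
    show 2 * ηc - y - lam - 2 * ηc = -(y + lam) by ring, th1_neg, th4_neg]
  ring

lemma chiG_two_η_sub (y : ℂ) : chiG τ lam (2 * ηc - y) = - chiF τ lam y := by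
  rw [chiF, chiG, show 2 * ηc - y + lam = -(y - lam - 2 * ηc) by ring,
    show 2 * ηc - y - lam - 2 * ηc = -(y + lam) by ring, th1_neg, th4_neg]
  ring

lemma ZL_pair (h : PsiSol τ Ψ) (y : ℂ) (s : List ℂ) :
    ZL τ lam Ψ (y :: (2 * ηc - y) :: s)
      = - (chiF τ lam y * chiG τ lam y * (th1 (-y - y - 2 * ηc) τ * th1 (-y - y) τ)
        * (((flatU s).map fun x => th1 (-y - x - 2 * ηc) τ).prod
          * ((flatU s).map fun x => th1 (y - 4 * ηc - x) τ).prod) * ZL τ lam Ψ s) := by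
  have key (a b c d : Fin 2) : Zp τ lam Ψ [y, -y, 2 * ηc - y, -(2 * ηc - y)] [a, b, c, d] s
      = th1 (-y - y - 2 * ηc) τ * th1 (-y - y) τ
        * ((flatU s).map fun x => th1 (-y - x - 2 * ηc) τ).prod * singletC b c
        * Zp τ lam Ψ [y, y - 2 * ηc] [a, d] s := by
    have k (β : List (Fin 2)) := PsiL_reduce h.im_pos h.reduce (n := s.length + 1) (l := [y])
      (l' := [a]) (r := (y - 2 * ηc) :: flatU s)
      (by simp [length_flatU]; ring) rfl (-y) b c (d :: β)
    simp only [List.cons_append, List.nil_append, List.map_cons, List.prod_cons,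
      show -y + 2 * ηc = 2 * ηc - y by ring,
      show -y - (y - 2 * ηc) - 2 * ηc = -y - y by ring] at k
    simp only [Zp, List.cons_append, List.nil_append, neg_sub, k]
    rw [contr_mul_left]
    ring
  rw [ZL, Zp_cons', Zp_cons', Zp_cons', chiF_two_η_sub, chiG_two_η_sub]
  simp only [List.cons_append, List.nil_append, key]
  have := Zp_pair_reduce (lam := lam) h y s
  simp only [singletC, one_ne_zero, zero_ne_one, and_true, and_self, if_true, if_false, and_false]
  linear_combination (chiF τ lam y * chiG τ lam y * (th1 (-y - y - 2 * ηc) τ * th1 (-y - y) τ)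
        * ((flatU s).map fun x => th1 (-y - x - 2 * ηc) τ).prod) * this

lemma chiF_mul_chiG (hτ : 0 < τ.im) (z : ℂ) :
    4 * (chiF τ lam (z + ηc) * chiG τ lam (z + ηc))
      = th2 0 τ ^ 2 * (th1 (z + (lam + ηc)) τ * th1 (z - (lam + ηc)) τ) := by
  have e1 := two_th1_mul_th4 hτ (z + (lam + ηc))
  have e2 := two_th1_mul_th4 hτ (z - (lam + ηc))
  rw [chiF, chiG, show z + ηc + lam = z + (lam + ηc) by ring,
    show z + ηc - lam - 2 * ηc = z - (lam + ηc) by ring]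
  linear_combination (2 * (th1 (z - (lam + ηc)) (2 * τ) * th4 (z - (lam + ηc)) (2 * τ))) * e1
    + th2 0 τ * th1 (z + (lam + ηc)) τ * e2

lemma prod_neg_flatU (f : ℂ → ℂ) (s : List ℂ) :
    ((flatU s).map fun x => -f x).prod = - ((flatU s).map f).prod := by
  induction s with
  | nil => simp [flatU]
  | cons x s ih =>
    simp only [flatU, List.map_cons, List.prod_cons, ih]
    ring

/-- The reduction relation for `Z_n`. -/
lemma ZL_reduce (h : PsiSol τ Ψ) (z : ℂ) (s : List ℂ) :
    ZL τ lam Ψ ((z + ηc) :: (ηc - z) :: s)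
      = th1 (z + (lam + ηc)) τ * th1 (z - (lam + ηc)) τ
        * (th1 (2 * z + ηc) (2 * τ) * th4 (2 * z + ηc) (2 * τ)
          * (th1 (2 * z - ηc) (2 * τ) * th4 (2 * z - ηc) (2 * τ)))
        * (th1 z τ ^ 2 * (s.map fun x => (th1 (z + x) τ * th1 (z - x) τ) ^ 2).prod)
        * ZL τ lam Ψ s := by
  have key := ZL_pair (lam := lam) h (z + ηc) s
  have ef (x : ℂ) : th1 (-(z + ηc) - x - 2 * ηc) τ = th1 (z + x) τ := by
    rw [show -(z + ηc) - x - 2 * ηc = -(z + x) - Real.pi by rw [← three_ηc]; ring, th1_sub_pi,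
      th1_neg, neg_neg]
  have eg (x : ℂ) : th1 (z + ηc - 4 * ηc - x) τ = - th1 (z - x) τ := by
    rw [show z + ηc - 4 * ηc - x = z - x - Real.pi by rw [← three_ηc]; ring, th1_sub_pi]
  have e1 : th1 (-(z + ηc) - (z + ηc) - 2 * ηc) τ = th1 (2 * z + ηc) τ := by
    rw [show -(z + ηc) - (z + ηc) - 2 * ηc = -(2 * z + ηc) - Real.pi by rw [← three_ηc]; ring,
      th1_sub_pi, th1_neg, neg_neg]
  have e2 : th1 (-(z + ηc) - (z + ηc)) τ = th1 (2 * z - ηc) τ := by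
    rw [show -(z + ηc) - (z + ηc) = -(2 * z - ηc) - Real.pi by rw [← three_ηc]; ring,
      th1_sub_pi, th1_neg, neg_neg]
  rw [show 2 * ηc - (z + ηc) = ηc - z by ring, e1, e2] at key
  simp only [ef, eg, prod_neg_flatU] at key
  have ep : ((flatU s).map fun x => th1 (z + x) τ).prod * ((flatU s).map fun x => th1 (z - x) τ).prod
      = th1 z τ ^ 2 * (s.map fun x => (th1 (z + x) τ * th1 (z - x) τ) ^ 2).prod := by
    rw [← List.prod_map_mul, prod_map_flatU (fun x => th1 (z + x) τ * th1 (z - x) τ)]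
    · rw [add_zero, sub_zero, sq]
    · intro x
      rw [← sub_eq_add_neg, sub_neg_eq_add, mul_comm]
  have hfg := chiF_mul_chiG (lam := lam) h.im_pos z
  have t1 := two_th1_mul_th4 h.im_pos (2 * z + ηc)
  have t2 := two_th1_mul_th4 h.im_pos (2 * z - ηc)
  rw [key, ← ep]
  have hc : chiF τ lam (z + ηc) * chiG τ lam (z + ηc)
      * (th1 (2 * z + ηc) τ * th1 (2 * z - ηc) τ)
      = th1 (z + (lam + ηc)) τ * th1 (z - (lam + ηc)) τ
        * (th1 (2 * z + ηc) (2 * τ) * th4 (2 * z + ηc) (2 * τ)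
          * (th1 (2 * z - ηc) (2 * τ) * th4 (2 * z - ηc) (2 * τ))) := by
    linear_combination th1 (2 * z + ηc) τ * th1 (2 * z - ηc) τ / 4 * hfg
      - th1 (z + (lam + ηc)) τ * th1 (z - (lam + ηc)) τ / 4
        * (2 * (th1 (2 * z + ηc) (2 * τ) * th4 (2 * z + ηc) (2 * τ)) * t2
          + th2 0 τ * th1 (2 * z - ηc) τ * t1)
  linear_combination (((flatU s).map fun x => th1 (z + x) τ).prod
    * ((flatU s).map fun x => th1 (z - x) τ).prod * ZL τ lam Ψ s) * hc

end

/-! ### The symmetrised partition function -/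

section
variable {τ lam : ℂ} {Ψ : PsiFam}

/-- The partition function `Z_n`, normalised so as to be even in each variable. -/
def Zs (τ lam : ℂ) (Ψ : PsiFam) (xs : List ℂ) : ℂ :=
  ZL τ lam Ψ xs * (xs.map fun x => th4 (2 * x + ηc) (2 * τ)).prod

lemma Zs_cons (x : ℂ) (xs : List ℂ) :
    Zs τ lam Ψ (x :: xs) = ZL τ lam Ψ (x :: xs) * th4 (2 * x + ηc) (2 * τ)
      * (xs.map fun x => th4 (2 * x + ηc) (2 * τ)).prod := by
  rw [Zs, List.map_cons, List.prod_cons, mul_assoc]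

lemma Zs_perm (h : PsiSol τ Ψ) {l₁ l₂ : List ℂ} (hp : l₁.Perm l₂) :
    Zs τ lam Ψ l₁ = Zs τ lam Ψ l₂ := by
  rw [Zs, Zs, ZL_perm h hp, (hp.map _).prod_eq]

lemma Zs_neg (h : PsiSol τ Ψ) (x : ℂ) (xs : List ℂ) :
    Zs τ lam Ψ (-x :: xs) = Zs τ lam Ψ (x :: xs) := by
  rw [Zs_cons, Zs_cons, ← ZL_neg h x xs, show 2 * -x + ηc = -(2 * x - ηc) by ring, th4_neg]

lemma Zs_add_pi (h : PsiSol τ Ψ) (x : ℂ) (xs : List ℂ) :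
    Zs τ lam Ψ ((x + Real.pi) :: xs) = Zs τ lam Ψ (x :: xs) := by
  rw [Zs_cons, Zs_cons, ZL_add_pi h,
    show 2 * (x + (Real.pi : ℂ)) + ηc = 2 * x + ηc + Real.pi + Real.pi by ring, th4_add_pi,
    th4_add_pi]

lemma Zs_mem (h : PsiSol τ Ψ) (xs : List ℂ) :
    (fun z => Zs τ lam Ψ (z :: xs)) ∈ evenTheta τ (xs.length + 3) := by
  refine ⟨?_, fun z => Zs_neg h z xs, fun z => Zs_add_pi h z xs, fun z => ?_⟩
  · simp only [Zs_cons]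
    have h1 := differentiable_ZL (lam := lam) h [] xs
    have h2 := differentiable_th4 (two_mul_im_pos h.im_pos)
    simp only [List.nil_append] at h1
    fun_prop
  · beta_reduce
    rw [Zs_cons, Zs_cons, ZL_add_tau h,
      show 2 * (z + (Real.pi : ℂ) * τ) + ηc = 2 * z + ηc + Real.pi * (2 * τ) by ring, th4_add_tau]
    have e : cexp (-2 * ((xs.length + 3 : ℕ) : ℂ) * (Real.pi * I * τ)
        - 4 * ((xs.length + 3 : ℕ) : ℂ) * I * z)
        = cexp (2 * I * ηc - (2 * (xs.length + 1 : ℕ) + 2) * (Real.pi * I * τ + 2 * I * z))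
          * cexp (-(Real.pi * I * (2 * τ)) - 2 * I * (2 * z + ηc)) := by
      rw [← Complex.exp_add]
      congr 1
      push_cast
      ring
    rw [e]
    ring

lemma Zs_η (h : PsiSol τ Ψ) (xs : List ℂ) : Zs τ lam Ψ (ηc :: xs) = 0 := by
  rw [← Zs_neg h, Zs_cons, ZL_neg_η h, zero_mul, zero_mul]

lemma Zs_reduce (h : PsiSol τ Ψ) (z : ℂ) (s : List ℂ) :
    Zs τ lam Ψ ((z + ηc) :: (ηc - z) :: s)
      = th1 (z + (lam + ηc)) τ * th1 (z - (lam + ηc)) τ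
        * (th1 (2 * z + ηc) (2 * τ) * th4 (2 * z + ηc) (2 * τ)
          * (th1 (2 * z - ηc) (2 * τ) * th4 (2 * z - ηc) (2 * τ)))
        * (th1 z τ ^ 2 * (s.map fun x => (th1 (z + x) τ * th1 (z - x) τ) ^ 2).prod)
        * th4 (2 * z) (2 * τ) ^ 2 * Zs τ lam Ψ s := by
  have e1 : th4 (2 * (z + ηc) + ηc) (2 * τ) = th4 (2 * z) (2 * τ) := by
    rw [show 2 * (z + ηc) + ηc = 2 * z + 3 * ηc by ring, three_ηc, th4_add_pi]
  have e2 : th4 (2 * (ηc - z) + ηc) (2 * τ) = th4 (2 * z) (2 * τ) := by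
    rw [show 2 * (ηc - z) + ηc = -(2 * z) + 3 * ηc by ring, three_ηc, th4_add_pi, th4_neg]
  rw [Zs, ZL_reduce h, Zs]
  simp only [List.map_cons, List.prod_cons]
  rw [e1, e2]
  ring

/-- Two of the points at which `Z_n` trivially vanishes. -/
def a3c (τ : ℂ) : ℂ := (Real.pi * τ - ηc) / 2

/-- The function collecting the trivial zeros of `Z_n`. -/
def Tth (τ x : ℂ) : ℂ := th4 (2 * x - ηc) (2 * τ) * th4 (2 * x + ηc) (2 * τ)

lemma th4_pi_tau (τ : ℂ) : th4 (Real.pi * τ) (2 * τ) = 0 := by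
  have := th4_add_half_tau (0 : ℂ) (2 * τ)
  rw [th1_zero, mul_zero, zero_add] at this
  rw [← this]
  congr 1
  ring

lemma th4_a3c (τ : ℂ) : th4 (2 * a3c τ + ηc) (2 * τ) = 0 := by
  rw [a3c, show 2 * (((Real.pi : ℂ) * τ - ηc) / 2) + ηc = Real.pi * τ by ring, th4_pi_tau]

lemma th4_a4c (τ : ℂ) : th4 (2 * (a3c τ + Real.pi / 2) + ηc) (2 * τ) = 0 := by
  rw [show 2 * (a3c τ + (Real.pi : ℂ) / 2) + ηc = 2 * a3c τ + ηc + Real.pi by ring, th4_add_pi,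
    th4_a3c]

lemma Zs_eq_zero {x : ℂ} (hx : th4 (2 * x + ηc) (2 * τ) = 0) (xs : List ℂ) :
    Zs τ lam Ψ (x :: xs) = 0 := by
  rw [Zs_cons, hx, mul_zero, zero_mul]

lemma Tth_mem (hτ : 0 < τ.im) : Tth τ ∈ evenTheta τ 2 := by
  refine ⟨?_, fun z => ?_, fun z => ?_, fun z => ?_⟩
  · have h2 := differentiable_th4 (two_mul_im_pos hτ)
    unfold Tth
    fun_prop
  · rw [Tth, Tth, show 2 * -z - ηc = -(2 * z + ηc) by ring, show 2 * -z + ηc = -(2 * z - ηc) by ring,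
      th4_neg, th4_neg, mul_comm]
  · rw [Tth, Tth, show 2 * (z + (Real.pi : ℂ)) - ηc = 2 * z - ηc + Real.pi + Real.pi by ring,
      show 2 * (z + (Real.pi : ℂ)) + ηc = 2 * z + ηc + Real.pi + Real.pi by ring]
    simp only [th4_add_pi]
  · rw [Tth, Tth,
      show 2 * (z + (Real.pi : ℂ) * τ) + ηc = 2 * z + ηc + Real.pi * (2 * τ) by ring, th4_add_tau,
      show 2 * (z + (Real.pi : ℂ) * τ) - ηc = 2 * z - ηc + Real.pi * (2 * τ) by ring, th4_add_tau]
    have e : cexp (-2 * ((2 : ℕ) : ℂ) * (Real.pi * I * τ) - 4 * ((2 : ℕ) : ℂ) * I * z)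
        = cexp (-(Real.pi * I * (2 * τ)) - 2 * I * (2 * z + ηc))
          * cexp (-(Real.pi * I * (2 * τ)) - 2 * I * (2 * z - ηc)) := by
      rw [← Complex.exp_add]
      congr 1
      push_cast
      ring
    rw [e]
    ring

lemma evenTheta_mul {M N : ℕ} {f g : ℂ → ℂ} (hf : f ∈ evenTheta τ M) (hg : g ∈ evenTheta τ N) :
    (fun z => f z * g z) ∈ evenTheta τ (M + N) := by
  refine ⟨hf.1.mul hg.1, fun z => ?_, fun z => ?_, fun z => ?_⟩
  · beta_reduce
    rw [hf.2.1, hg.2.1]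
  · beta_reduce
    rw [hf.2.2.1, hg.2.2.1]
  · beta_reduce
    rw [hf.2.2.2, hg.2.2.2]
    have e : cexp (-2 * ((M + N : ℕ) : ℂ) * (Real.pi * I * τ) - 4 * ((M + N : ℕ) : ℂ) * I * z)
        = cexp (-2 * (M : ℂ) * (Real.pi * I * τ) - 4 * (M : ℂ) * I * z)
          * cexp (-2 * (N : ℂ) * (Real.pi * I * τ) - 4 * (N : ℂ) * I * z) := by
      rw [← Complex.exp_add]
      congr 1
      push_cast
      ring
    rw [e]
    ring

end

/-! ### Interpolation and the partition function for one variable -/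

section
variable {τ lam : ℂ} {Ψ : PsiFam}

/-- The points `x` and `y` are separated by the function `w`. -/
def WSep (τ x y : ℂ) : Prop := th1 (x - y) τ ≠ 0 ∧ th1 (x + y) τ ≠ 0

lemma WSep.symm {x y : ℂ} (h : WSep τ x y) : WSep τ y x := by
  refine ⟨?_, ?_⟩
  · rw [← neg_sub, th1_neg]
    exact neg_ne_zero.2 h.1
  · rw [add_comm]
    exact h.2

lemma WSep.wfun_ne (hτ : 0 < τ.im) {x y : ℂ} (h : WSep τ x y) (hx : Dth τ x ≠ 0)
    (hy : Dth τ y ≠ 0) : wfun τ x ≠ wfun τ y := by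
  rw [← sub_ne_zero, wfun_sub_wfun hτ hx hy]
  exact div_ne_zero (mul_ne_zero (mul_ne_zero (neg_ne_zero.2 (Kth_ne_zero hτ))
    (pow_ne_zero _ (th1_η_ne hτ))) (mul_ne_zero h.1 h.2)) (mul_ne_zero hx hy)

lemma nodup_map_wfun (hτ : 0 < τ.im) {l : List ℂ} (hD : ∀ x ∈ l, Dth τ x ≠ 0)
    (hS : l.Pairwise (WSep τ)) : (l.map (wfun τ)).Nodup := by
  rw [List.Nodup, List.pairwise_map]
  exact hS.imp_of_mem fun hx hy h => h.wfun_ne hτ (hD _ hx) (hD _ hy)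

lemma evenTheta_eq_zero_of_list (hτ : 0 < τ.im) {M : ℕ} (hM : 0 < M) {G : ℂ → ℂ}
    (hG : G ∈ evenTheta τ M) (hη : G ηc = 0) {l : List ℂ} (hl : M ≤ l.length)
    (hD : ∀ x ∈ l, Dth τ x ≠ 0) (hS : l.Pairwise (WSep τ)) (h0 : ∀ x ∈ l, G x = 0) :
    G = 0 := by
  classical
  have hn := nodup_map_wfun hτ hD hS
  refine evenTheta_eq_zero hτ hM hG hη l.toFinset ?_ (fun x hx => hD x (List.mem_toFinset.1 hx))
    ?_ (fun x hx => h0 x (List.mem_toFinset.1 hx))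
  · rwa [List.toFinset_card_of_nodup (List.Nodup.of_map _ hn)]
  · intro x hx y hy hxy
    exact List.inj_on_of_nodup_map hn (List.mem_toFinset.1 hx) (List.mem_toFinset.1 hy) hxy

lemma th1_ne_zero_of_im (hτ : 0 < τ.im) {z : ℂ} (hz : |z.im| < Real.pi * τ.im) (h0 : z.im ≠ 0) :
    th1 z τ ≠ 0 := by
  refine th1_ne_zero hτ hz (exp_ne_one_of_re_ne_zero ?_)
  simpa using h0

lemma a3c_im : (a3c τ).im = Real.pi * τ.im / 2 := by
  have := ηc_im
  simp [a3c, this]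

lemma th1_ne_zero_of_half (hτ : 0 < τ.im) {z : ℂ} (hz : z.im = Real.pi * τ.im / 2) :
    th1 z τ ≠ 0 := by
  have h : 0 < Real.pi * τ.im := mul_pos Real.pi_pos hτ
  refine th1_ne_zero_of_im hτ ?_ ?_
  · rw [hz, abs_of_pos (by linarith)]
    linarith
  · rw [hz]
    exact (by linarith : 0 < Real.pi * τ.im / 2).ne'

lemma half_pi_im : ((Real.pi : ℂ) / 2).im = 0 := by
  rw [show (Real.pi : ℂ) / 2 = ((Real.pi / 2 : ℝ) : ℂ) by push_cast; ring, Complex.ofReal_im]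

lemma Dth_a3c_ne (hτ : 0 < τ.im) : Dth τ (a3c τ) ≠ 0 :=
  mul_ne_zero (th1_ne_zero_of_half hτ (by simp [a3c_im, ηc_im]))
    (th1_ne_zero_of_half hτ (by simp [a3c_im, ηc_im]))

lemma Dth_a4c_ne (hτ : 0 < τ.im) : Dth τ (a3c τ + Real.pi / 2) ≠ 0 :=
  mul_ne_zero (th1_ne_zero_of_half hτ (by simp [a3c_im, ηc_im]))
    (th1_ne_zero_of_half hτ (by simp [a3c_im, ηc_im]))

lemma Dth_β2c_ne (hτ : 0 < τ.im) : Dth τ β2c ≠ 0 := by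
  rw [Dth_β2c]
  exact mul_ne_zero (neg_ne_zero.2 (th2_zero_ne hτ)) (th2_η_ne hτ)

lemma sep_a3c_a4c (hτ : 0 < τ.im) : WSep τ (a3c τ) (a3c τ + Real.pi / 2) := by
  refine ⟨?_, ?_⟩
  · rw [show a3c τ - (a3c τ + (Real.pi : ℂ) / 2) = -(0 + Real.pi / 2) by ring, th1_neg,
      th1_add_half_pi]
    exact neg_ne_zero.2 (th2_zero_ne hτ)
  · rw [show a3c τ + (a3c τ + (Real.pi : ℂ) / 2) = ((1 / 6 : ℚ) : ℂ) * Real.pi + Real.pi * τ by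
      rw [a3c, ηc]; push_cast; ring, th1_add_tau]
    refine mul_ne_zero (neg_ne_zero.2 (Complex.exp_ne_zero _)) (th1_rat_ne_zero hτ _ fun n hn => ?_)
    have : (6 * n : ℚ) = 1 := by linarith
    have : 6 * n = 1 := by exact_mod_cast this
    omega

lemma sep_of_im_eq_zero (hτ : 0 < τ.im) {x y : ℂ} (hx : x.im = Real.pi * τ.im / 2) (hy : y.im = 0) :
    WSep τ x y :=
  ⟨th1_ne_zero_of_half hτ (by simp [hx, hy]), th1_ne_zero_of_half hτ (by simp [hx, hy])⟩

lemma β2c_im : β2c.im = 0 := by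
  rw [β2c, Complex.add_im, ηc_im, half_pi_im, add_zero]

lemma Tth_mul_Dth_pow_mem (hτ : 0 < τ.im) {n j : ℕ} (hj : j ≤ n) :
    (fun z => Tth τ z * ((th1 z τ ^ 2) ^ j * Dth τ z ^ (n - j))) ∈ evenTheta τ (n + 2) := by
  rw [add_comm n]
  exact evenTheta_mul (Tth_mem hτ) (th1_Dth_mem hτ hj)

lemma Zs_singleton_β2c (h : PsiSol τ Ψ) :
    Zs τ lam Ψ [β2c] = th2 ηc τ * th2 (lam + ηc) τ * th2 0 τ * th4 ηc (2 * τ) := by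
  have key (s t : Fin 2) : Zp τ lam Ψ [-β2c, - -β2c] [s, t] []
      = spinSign s * (th2 0 τ * singletC s t) := by
    have h1 := PsiL_add_pi h.shift (n := 1) (l := [-β2c]) (l' := [s]) (r := [0]) rfl rfl
      (-β2c + 2 * ηc) t [0]
    have h2 := PsiL_reduce h.im_pos h.reduce (n := 0) (l := []) (l' := []) (r := [0]) rfl rfl
      (-β2c) s t [0]
    simp only [List.nil_append, List.cons_append, PsiL_one h.zero, List.map_cons, List.map_nil,
      List.prod_cons, List.prod_nil, mul_one] at h1 h2
    rw [h2] at h1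
    have e1 : th1 (-β2c - 0 - 2 * ηc) τ = th2 0 τ := by
      rw [show -β2c - 0 - 2 * ηc = -(0 + Real.pi / 2 + 3 * ηc) by rw [β2c]; ring, three_ηc, th1_neg,
        th1_add_pi, th1_add_half_pi, neg_neg]
    have e2 : - -β2c = -β2c + 2 * ηc + Real.pi := by
      rw [β2c]
      ring
    rw [e1] at h1
    simp only [Zp, contr_nil, flatU, List.cons_append, List.nil_append]
    rw [e2, h1]
    simp only [Nat.reduceMul, Nat.reduceAdd, Fin.prod_univ_three]
    fin_cases s <;> fin_cases t <;> simp [spinSign, singletC]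
  rw [← Zs_neg h, Zs_cons, ZL_cons, key, key]
  have e3 := chiF_add_chiG (lam := lam) h.im_pos (-β2c)
  have e4 : th1 (-β2c - ηc) τ = th2 ηc τ := by
    rw [show -β2c - ηc = -(2 * ηc + Real.pi / 2) by rw [β2c]; ring, th1_neg, th1_add_half_pi,
      th2_two_η, neg_neg]
  have e5 : th4 (2 * -β2c + ηc) (2 * τ) = th4 ηc (2 * τ) := by
    rw [show 2 * -β2c + ηc = -(ηc + Real.pi) by rw [β2c]; ring, th4_neg, th4_add_pi]
  rw [e4] at e3
  rw [e5]
  norm_num [spinSign, singletC, -mul_eq_mul_right_iff]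
  linear_combination (th2 0 τ * th4 ηc (2 * τ)) * e3

lemma Tth_β2c (τ : ℂ) : Tth τ β2c = th4 ηc (2 * τ) * th4 0 (2 * τ) := by
  rw [Tth, show 2 * β2c - ηc = ηc + Real.pi by rw [β2c]; ring,
    show 2 * β2c + ηc = 0 + Real.pi + 3 * ηc by rw [β2c]; ring, three_ηc]
  simp only [th4_add_pi]

lemma Tth_eq_zero {x : ℂ} (hx : th4 (2 * x + ηc) (2 * τ) = 0) : Tth τ x = 0 := by
  rw [Tth, hx, mul_zero]

theorem Zs_singleton (h : PsiSol τ Ψ) (x : ℂ) :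
    Zs τ lam Ψ [x] = -(th2 (lam + ηc) τ / th4 0 (2 * τ)) * (Tth τ x * Dth τ x) := by
  have hτ := h.im_pos
  have h4 := th4_zero_ne (two_mul_im_pos hτ)
  have hmem := Tth_mul_Dth_pow_mem hτ (Nat.zero_le 1)
  simp only [pow_zero, one_mul, Nat.sub_zero, pow_one] at hmem
  have hG := Submodule.sub_mem _ (Zs_mem (lam := lam) h [])
    (Submodule.smul_mem _ (-(th2 (lam + ηc) τ / th4 0 (2 * τ))) hmem)
  have key := evenTheta_eq_zero_of_list hτ (by simp) hG ?_
    (l := [a3c τ, a3c τ + Real.pi / 2, β2c]) (by simp) ?_ ?_ ?_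
  · exact sub_eq_zero.1 (congrFun key x)
  · simp [Zs_η h, Dth_η]
  · simp only [List.forall_mem_cons]
    exact ⟨Dth_a3c_ne hτ, Dth_a4c_ne hτ, Dth_β2c_ne hτ, by simp⟩
  · simp only [List.pairwise_cons, List.forall_mem_cons]
    refine ⟨⟨sep_a3c_a4c hτ, sep_of_im_eq_zero hτ a3c_im β2c_im, by simp⟩,
      ⟨sep_of_im_eq_zero hτ (by simp [a3c_im]) β2c_im, by simp⟩, by simp⟩
  · simp only [List.forall_mem_cons]
    refine ⟨?_, ?_, ?_, by simp⟩
    · simp [Zs_eq_zero (th4_a3c τ), Tth_eq_zero (th4_a3c τ)]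
    · simp [Zs_eq_zero (th4_a4c τ), Tth_eq_zero (th4_a4c τ)]
    · simp only [Pi.sub_apply, Pi.smul_apply, smul_eq_mul, Zs_singleton_β2c h, Tth_β2c, Dth_β2c]
      field_simp
      ring

end

/-! ### The polynomials `H` -/

/-- Polynomial functions in several variables. -/
def IsPolyFun {σ : Type*} (f : (σ → ℂ) → ℂ) : Prop :=
  ∃ P : MvPolynomial σ ℂ, ∀ w, f w = MvPolynomial.eval w P

namespace IsPolyFun
variable {σ : Type*} {f g : (σ → ℂ) → ℂ}

lemma const (c : ℂ) : IsPolyFun fun _ : σ → ℂ => c :=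
  ⟨MvPolynomial.C c, fun w => by simp⟩

lemma var (i : σ) : IsPolyFun fun w : σ → ℂ => w i :=
  ⟨MvPolynomial.X i, fun w => by simp⟩

lemma add (hf : IsPolyFun f) (hg : IsPolyFun g) : IsPolyFun fun w => f w + g w := by
  obtain ⟨P, hP⟩ := hf
  obtain ⟨Q, hQ⟩ := hg
  exact ⟨P + Q, fun w => by beta_reduce; rw [hP, hQ, map_add]⟩

lemma mul (hf : IsPolyFun f) (hg : IsPolyFun g) : IsPolyFun fun w => f w * g w := by
  obtain ⟨P, hP⟩ := hf
  obtain ⟨Q, hQ⟩ := hg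
  exact ⟨P * Q, fun w => by beta_reduce; rw [hP, hQ, map_mul]⟩

lemma sub (hf : IsPolyFun f) (hg : IsPolyFun g) : IsPolyFun fun w => f w - g w := by
  obtain ⟨P, hP⟩ := hf
  obtain ⟨Q, hQ⟩ := hg
  exact ⟨P - Q, fun w => by beta_reduce; rw [hP, hQ, map_sub]⟩

lemma pow (hf : IsPolyFun f) (n : ℕ) : IsPolyFun fun w => f w ^ n := by
  obtain ⟨P, hP⟩ := hf
  exact ⟨P ^ n, fun w => by beta_reduce; rw [hP, map_pow]⟩

lemma prod {ι : Type*} (s : Finset ι) {F : ι → (σ → ℂ) → ℂ} (hF : ∀ i ∈ s, IsPolyFun (F i)) :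
    IsPolyFun fun w => ∏ i ∈ s, F i w := by
  choose! P hP using hF
  exact ⟨∏ i ∈ s, P i, fun w => by rw [map_prod]; exact Finset.prod_congr rfl fun i hi => hP i hi w⟩

lemma sum {ι : Type*} (s : Finset ι) {F : ι → (σ → ℂ) → ℂ} (hF : ∀ i ∈ s, IsPolyFun (F i)) :
    IsPolyFun fun w => ∑ i ∈ s, F i w := by
  choose! P hP using hF
  exact ⟨∑ i ∈ s, P i, fun w => by rw [map_sum]; exact Finset.sum_congr rfl fun i hi => hP i hi w⟩

lemma det {n : ℕ} {F : Fin n → Fin n → (σ → ℂ) → ℂ} (hF : ∀ i j, IsPolyFun (F i j)) :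
    IsPolyFun fun w => Matrix.det (Matrix.of fun i j => F i j w) := by
  simp only [Matrix.det_apply', Matrix.of_apply]
  exact sum _ fun p _ => (const _).mul (prod _ fun i _ => hF _ _)

lemma eq_zero_or_eq_zero (hf : IsPolyFun f) (hg : IsPolyFun g) (h : ∀ w, f w * g w = 0) :
    (∀ w, f w = 0) ∨ ∀ w, g w = 0 := by
  obtain ⟨P, hP⟩ := hf
  obtain ⟨Q, hQ⟩ := hg
  have : P * Q = 0 := MvPolynomial.funext fun w => by rw [map_mul, ← hP, ← hQ, h, map_zero]
  rcases mul_eq_zero.1 this with rfl | rfl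
  · exact Or.inl fun w => by rw [hP, map_zero]
  · exact Or.inr fun w => by rw [hQ, map_zero]

lemma comp {κ : Type*} (hf : IsPolyFun f) {F : σ → (κ → ℂ) → ℂ} (hF : ∀ i, IsPolyFun (F i)) :
    IsPolyFun fun w => f fun i => F i w := by
  obtain ⟨P, hP⟩ := hf
  choose Q hQ using hF
  refine ⟨MvPolynomial.bind₁ Q P, fun w => ?_⟩
  beta_reduce
  rw [hP, ← MvPolynomial.coe_aeval_eq_eval, ← MvPolynomial.coe_aeval_eq_eval]
  simp only [RingHom.coe_coe, MvPolynomial.aeval_bind₁]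
  congr 2
  funext i
  rw [hQ, ← MvPolynomial.coe_aeval_eq_eval, RingHom.coe_coe]

end IsPolyFun

/-- The numerator matrix in the determinant formula for `H`. -/
def Nmat (ζ : ℂ) {k : ℕ} (f g : Fin k → ℂ) : Matrix (Fin k) (Fin k) ℂ :=
  Matrix.of fun i j => ∏ l ∈ Finset.univ.erase j, hpol ζ (f i) (g l)

section
variable {ζ : ℂ} {Hz : (k : ℕ) → (Fin (2 * k) → ℂ) → ℂ}

lemma vdm_ne_zero {k : ℕ} {y : Fin k → ℂ} (hy : Function.Injective y) : vdm y ≠ 0 := by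
  refine Finset.prod_ne_zero_iff.2 fun i _ => Finset.prod_ne_zero_iff.2 fun j _ => ?_
  split_ifs with h
  · exact sub_ne_zero.2 fun e => h.ne (hy e).symm
  · exact one_ne_zero

lemma vdm_eq_zero {k : ℕ} {y : Fin k → ℂ} {i j : Fin k} (hij : i ≠ j) (h : y i = y j) :
    vdm y = 0 := by
  wlog hlt : i < j generalizing i j
  · exact this hij.symm h.symm (lt_of_le_of_ne (not_lt.1 hlt) hij.symm)
  · refine Finset.prod_eq_zero (Finset.mem_univ i) (Finset.prod_eq_zero (Finset.mem_univ j) ?_)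
    rw [if_pos hlt, h, sub_self]

lemma isPolyFun_vdm {σ : Type*} {k : ℕ} {F : Fin k → (σ → ℂ) → ℂ} (hF : ∀ i, IsPolyFun (F i)) :
    IsPolyFun fun w => vdm fun i => F i w := by
  refine IsPolyFun.prod _ fun i _ => IsPolyFun.prod _ fun j _ => ?_
  split_ifs
  · exact (hF j).sub (hF i)
  · exact IsPolyFun.const 1

lemma isPolyFun_hpol {σ : Type*} {f g e : (σ → ℂ) → ℂ} (he : IsPolyFun e) (hf : IsPolyFun f)
    (hg : IsPolyFun g) : IsPolyFun fun w => hpol (e w) (f w) (g w) := by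
  refine ((IsPolyFun.const 1).sub ((((IsPolyFun.const 3).add (he.pow 2)).mul hf).mul hg)).add
    (((((IsPolyFun.const 1).sub (he.pow 2)).mul hf).mul hg).mul (hf.add hg))

lemma isPolyFun_det_Nmat {σ : Type*} {k : ℕ} {e : (σ → ℂ) → ℂ} {F G : Fin k → (σ → ℂ) → ℂ}
    (he : IsPolyFun e) (hF : ∀ i, IsPolyFun (F i)) (hG : ∀ i, IsPolyFun (G i)) :
    IsPolyFun fun w => (Nmat (e w) (fun i => F i w) fun i => G i w).det :=
  IsPolyFun.det fun _ _ => IsPolyFun.prod _ fun _ _ => isPolyFun_hpol he (hF _) (hG _)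

/-- The determinant formula for `H`, cleared of denominators. -/
theorem H_mul_vdm (hH : IsHFamily ζ Hz) (k : ℕ) (w : Fin (2 * k) → ℂ) :
    Hz k w * (vdm (firstHalf w) * vdm (secondHalf w))
      = (Nmat ζ (firstHalf w) (secondHalf w)).det := by
  have hp1 (i : Fin k) : IsPolyFun fun w : Fin (2 * k) → ℂ => firstHalf w i := IsPolyFun.var _
  have hp2 (i : Fin k) : IsPolyFun fun w : Fin (2 * k) → ℂ => secondHalf w i := IsPolyFun.var _
  have hV : IsPolyFun fun w : Fin (2 * k) → ℂ => vdm (firstHalf w) * vdm (secondHalf w) :=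
    (isPolyFun_vdm hp1).mul (isPolyFun_vdm hp2)
  have hP : IsPolyFun fun w : Fin (2 * k) → ℂ =>
      ∏ i : Fin k, ∏ j : Fin k, hpol ζ (firstHalf w i) (secondHalf w j) :=
    IsPolyFun.prod _ fun i _ => IsPolyFun.prod _ fun j _ =>
      isPolyFun_hpol (IsPolyFun.const _) (hp1 i) (hp2 j)
  have hf : IsPolyFun fun w : Fin (2 * k) → ℂ => Hz k w * (vdm (firstHalf w) * vdm (secondHalf w))
      - (Nmat ζ (firstHalf w) (secondHalf w)).det :=
    (IsPolyFun.mul (hH.2.1 k) hV).sub (isPolyFun_det_Nmat (IsPolyFun.const ζ) hp1 hp2)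
  have key (w : Fin (2 * k) → ℂ) : (Hz k w * (vdm (firstHalf w) * vdm (secondHalf w))
      - (Nmat ζ (firstHalf w) (secondHalf w)).det) * ((vdm (firstHalf w) * vdm (secondHalf w))
      * ∏ i : Fin k, ∏ j : Fin k, hpol ζ (firstHalf w i) (secondHalf w j)) = 0 := by
    by_cases hv : vdm (firstHalf w) * vdm (secondHalf w) = 0
    · rw [hv, zero_mul, mul_zero]
    by_cases hh : ∏ i : Fin k, ∏ j : Fin k, hpol ζ (firstHalf w i) (secondHalf w j) = 0
    · rw [hh, mul_zero, mul_zero]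
    have hh' (i j : Fin k) : hpol ζ (firstHalf w i) (secondHalf w j) ≠ 0 :=
      Finset.prod_ne_zero_iff.1 (Finset.prod_ne_zero_iff.1 hh i (Finset.mem_univ _)) j
        (Finset.mem_univ _)
    have hd : HratioDefined ζ k w :=
      ⟨fun i j hij e => hv (by rw [vdm_eq_zero hij e, zero_mul]),
        fun i j hij e => hv (by rw [vdm_eq_zero hij e, mul_zero]), hh'⟩
    have hN : (Nmat ζ (firstHalf w) (secondHalf w)).det
        = (∏ i : Fin k, ∏ j : Fin k, hpol ζ (firstHalf w i) (secondHalf w j))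
          * Matrix.det (Matrix.of fun i j : Fin k => (hpol ζ (firstHalf w i) (secondHalf w j))⁻¹) := by
      rw [← Matrix.det_mul_column]
      congr 1
      ext i j
      simp only [Nmat, Matrix.of_apply]
      rw [← Finset.prod_erase_mul _ _ (Finset.mem_univ j), mul_assoc, mul_inv_cancel₀ (hh' i j),
        mul_one]
    rw [hH.2.2 k w hd, Hratio, hN, div_mul_eq_mul_div, div_mul_cancel₀ _ hv, sub_self, zero_mul]
  have h1 : ¬ ∀ w : Fin (2 * k) → ℂ, (vdm (firstHalf w) * vdm (secondHalf w)
      * ∏ i : Fin k, ∏ j : Fin k, hpol ζ (firstHalf w i) (secondHalf w j)) = 0 := by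
    intro h0
    rcases IsPolyFun.eq_zero_or_eq_zero hV hP h0 with h | h
    · refine mul_ne_zero (vdm_ne_zero ?_) (vdm_ne_zero ?_) (h fun j => (j : ℕ))
      · intro i j hij
        simpa [firstHalf, Fin.ext_iff] using hij
      · intro i j hij
        simpa [secondHalf, Fin.ext_iff] using hij
    · simpa [firstHalf, secondHalf, hpol] using h 0
  exact sub_eq_zero.1 ((IsPolyFun.eq_zero_or_eq_zero hf (hV.mul hP) key).resolve_right h1 w)

end

/-! ### Symmetry, reduction and degree of the polynomials `H` -/

section
variable {ζ : ℂ} {Hz : (k : ℕ) → (Fin (2 * k) → ℂ) → ℂ}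

lemma firstHalf_padded {k : ℕ} {A : List ℂ} (hA : A.length = k) (B : List ℂ) :
    firstHalf (padded (A ++ B) : Fin (2 * k) → ℂ) = padded A := by
  funext i
  exact List.getD_append _ _ _ _ (by rw [hA]; exact i.2)

lemma secondHalf_padded {k : ℕ} {A : List ℂ} (hA : A.length = k) (B : List ℂ) :
    secondHalf (padded (A ++ B) : Fin (2 * k) → ℂ) = padded B := by
  funext i
  simp only [secondHalf, padded]
  rw [List.getD_append_right _ _ _ _ (by rw [hA]; exact Nat.le_add_right _ _), hA,
    Nat.add_sub_cancel_left]

lemma padded_cons {k : ℕ} (x : ℂ) (A : List ℂ) :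
    (padded (x :: A) : Fin (k + 1) → ℂ) = Fin.cons x (padded A) := by
  funext i
  induction i using Fin.cases with
  | zero => rfl
  | succ i => rfl

lemma injective_padded {k : ℕ} {A : List ℂ} (hA : A.length = k) (hn : A.Nodup) :
    Function.Injective (padded A : Fin k → ℂ) := by
  subst hA
  intro i j hij
  simp only [padded, List.getD_eq_getElem _ _ i.2, List.getD_eq_getElem _ _ j.2] at hij
  exact Fin.ext ((List.Nodup.getElem_inj_iff hn).1 hij)

lemma prod_padded {k : ℕ} {A : List ℂ} (hA : A.length = k) (f : ℂ → ℂ) :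
    ∏ i : Fin k, f (padded A i) = (A.map f).prod := by
  subst hA
  induction A with
  | nil => simp
  | cons x A ih =>
    have : ∏ i : Fin (A.length + 1), f (padded (x :: A) i) = ((x :: A).map f).prod := by
      rw [padded_cons, Fin.prod_univ_succ, List.map_cons, List.prod_cons, ← ih]
      simp
    exact this

lemma exists_perm_padded {A A' : List ℂ} (h : A.Perm A') :
    ∀ k, A.length = k → ∃ σ : Equiv.Perm (Fin k), (padded A : Fin k → ℂ) = padded A' ∘ σ := by
  induction h with
  | nil => exact fun k _ => ⟨1, rfl⟩
  | @cons x l l' _ ih =>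
    intro k hk
    obtain ⟨m, rfl⟩ : ∃ m, k = m + 1 := ⟨l.length, by simpa using hk.symm⟩
    obtain ⟨σ, hσ⟩ := ih m (by simpa using hk)
    refine ⟨Equiv.Perm.decomposeFin.symm (0, σ), ?_⟩
    funext i
    induction i using Fin.cases with
    | zero => simp [padded_cons]
    | succ i => simp [padded_cons, hσ]
  | swap x y l =>
    intro k hk
    obtain ⟨m, rfl⟩ : ∃ m, k = m + 1 + 1 := ⟨l.length, by simpa using hk.symm⟩
    refine ⟨Equiv.swap 0 1, ?_⟩
    funext i
    simp only [padded_cons, Function.comp_apply]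
    induction i using Fin.cases with
    | zero => rw [Equiv.swap_apply_left]; rfl
    | succ i =>
      induction i using Fin.cases with
      | zero => simp
      | succ i =>
        rw [Equiv.swap_apply_of_ne_of_ne (by simp [Fin.ext_iff]) (by simp [Fin.ext_iff])]
        simp
  | @trans l₁ l₂ l₃ h₁ _ ih₁ ih₂ =>
    intro k hk
    obtain ⟨σ, hσ⟩ := ih₁ k hk
    obtain ⟨ρ, hρ⟩ := ih₂ k (h₁.length_eq ▸ hk)
    exact ⟨σ.trans ρ, by rw [hσ, hρ]; rfl⟩

lemma vdm_eq_det {k : ℕ} (y : Fin k → ℂ) : vdm y = (Matrix.vandermonde y).det := by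
  rw [Matrix.det_vandermonde, vdm]
  refine Finset.prod_congr rfl fun i _ => ?_
  rw [← Finset.prod_filter]
  refine Finset.prod_congr ?_ fun _ _ => rfl
  ext j
  simp

lemma vdm_comp_perm {k : ℕ} (y : Fin k → ℂ) (σ : Equiv.Perm (Fin k)) :
    vdm (y ∘ σ) = Equiv.Perm.sign σ * vdm y := by
  rw [vdm_eq_det, vdm_eq_det, ← Matrix.det_permute]
  rfl

lemma det_Nmat_comp_perm {k : ℕ} (f g : Fin k → ℂ) (σ ρ : Equiv.Perm (Fin k)) :
    (Nmat ζ (f ∘ σ) (g ∘ ρ)).det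
      = Equiv.Perm.sign σ * (Equiv.Perm.sign ρ * (Nmat ζ f g).det) := by
  rw [← Matrix.det_permute', ← Matrix.det_permute]
  congr 1
  ext i j
  simp only [Nmat, Matrix.of_apply, Matrix.submatrix_apply, Function.comp_apply, id_eq]
  exact Finset.prod_equiv ρ (by simp) (by simp)

lemma H_mul_vdm_padded (hH : IsHFamily ζ Hz) {k : ℕ} {A B : List ℂ} (hA : A.length = k) :
    Hz k (padded (A ++ B)) * (vdm (padded A : Fin k → ℂ) * vdm (padded B : Fin k → ℂ))
      = (Nmat ζ (padded A : Fin k → ℂ) (padded B)).det := by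
  have := H_mul_vdm hH k (padded (A ++ B))
  rwa [firstHalf_padded hA, secondHalf_padded hA] at this

lemma H_perm (hH : IsHFamily ζ Hz) {k : ℕ} {A A' B B' : List ℂ} (hA : A.length = k)
    (hB : B.length = k) (hAA : A.Perm A') (hBB : B.Perm B') (hnA : A.Nodup) (hnB : B.Nodup) :
    Hz k (padded (A ++ B)) = Hz k (padded (A' ++ B')) := by
  obtain ⟨σ, hσ⟩ := exists_perm_padded hAA k hA
  obtain ⟨ρ, hρ⟩ := exists_perm_padded hBB k hB
  have hv : vdm (padded A : Fin k → ℂ) * vdm (padded B : Fin k → ℂ) ≠ 0 :=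
    mul_ne_zero (vdm_ne_zero (injective_padded hA hnA)) (vdm_ne_zero (injective_padded hB hnB))
  refine mul_right_cancel₀ hv ?_
  have h1 := H_mul_vdm_padded hH (B := B) hA
  have h2 := H_mul_vdm_padded hH (B := B') (hAA.length_eq ▸ hA)
  rw [h1, hσ, hρ, det_Nmat_comp_perm, vdm_comp_perm, vdm_comp_perm, ← h2]
  ring

lemma vdm_cons {k : ℕ} (x : ℂ) (f : Fin k → ℂ) :
    vdm (Fin.cons x f : Fin (k + 1) → ℂ) = (∏ i, (f i - x)) * vdm f := by
  simp [vdm, Fin.prod_univ_succ]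

lemma hpol_comm (ζ x y : ℂ) : hpol ζ x y = hpol ζ y x := by
  rw [hpol, hpol]
  ring

lemma hpol_factor {w₁ w₂ w₃ : ℂ} (hζ : 1 - ζ ^ 2 ≠ 0)
    (hs : w₁ + w₂ + w₃ = (3 + ζ ^ 2) / (1 - ζ ^ 2)) (hp : w₁ * w₂ * w₃ = 1 / (1 - ζ ^ 2)) (v : ℂ) :
    hpol ζ v w₂ = (1 - ζ ^ 2) * w₂ * ((v - w₁) * (v - w₃)) := by
  rw [eq_div_iff hζ] at hs hp
  rw [hpol]
  linear_combination v * w₂ * hs - hp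

lemma det_Nmat_cons {k : ℕ} {x y : ℂ} (f g : Fin k → ℂ) (hxy : hpol ζ x y = 0) :
    (Nmat ζ (Fin.cons x f : Fin (k + 1) → ℂ) (Fin.cons y g)).det
      = (∏ l, hpol ζ x (g l)) * ((∏ i, hpol ζ (f i) y) * (Nmat ζ f g).det) := by
  have hN (i : Fin k) (j : Fin k) : Nmat ζ (Fin.cons x f : Fin (k + 1) → ℂ) (Fin.cons y g)
      i.succ j.succ = hpol ζ (f i) y * Nmat ζ f g i j := by
    simp only [Nmat, Matrix.of_apply, Fin.cons_succ]
    rw [← Finset.mul_prod_erase _ _ (Finset.mem_erase.2 ⟨(Fin.succ_ne_zero j).symm, Finset.mem_univ 0⟩),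
      Fin.cons_zero]
    congr 1
    have : (Finset.univ.erase j.succ).erase 0 = (Finset.univ.erase j).map (Fin.succEmb k) := by
      ext l
      induction l using Fin.cases with
      | zero => simp
      | succ l => simp
    rw [this, Finset.prod_map]
    simp
  rw [Matrix.det_succ_row_zero, Fin.sum_univ_succ, Finset.sum_eq_zero, add_zero]
  · rw [← Matrix.det_mul_column]
    have h0 : Nmat ζ (Fin.cons x f : Fin (k + 1) → ℂ) (Fin.cons y g) 0 0
        = ∏ l, hpol ζ x (g l) := by
      have : (Finset.univ.erase (0 : Fin (k + 1))) = Finset.univ.map (Fin.succEmb k) := by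
        ext l
        induction l using Fin.cases with
        | zero => simp
        | succ l => simp
      simp only [Nmat, Matrix.of_apply, Fin.cons_zero, this, Finset.prod_map]
      simp
    rw [h0]
    simp only [Fin.val_zero, pow_zero, one_mul]
    congr 2
    ext i j
    simp [hN]
  · intro j _
    have : Nmat ζ (Fin.cons x f : Fin (k + 1) → ℂ) (Fin.cons y g) 0 j.succ = 0 := by
      refine Finset.prod_eq_zero (Finset.mem_erase.2 ⟨(Fin.succ_ne_zero j).symm, Finset.mem_univ 0⟩) ?_
      simpa using hxy
    rw [this]
    ring

theorem H_reduce (hH : IsHFamily ζ Hz) {w₁ w₂ w₃ : ℂ} (hζ : 1 - ζ ^ 2 ≠ 0)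
    (hs : w₁ + w₂ + w₃ = (3 + ζ ^ 2) / (1 - ζ ^ 2)) (hp : w₁ * w₂ * w₃ = 1 / (1 - ζ ^ 2))
    {k : ℕ} {A B : List ℂ} (hA : A.length = k) (hB : B.length = k) (hnA : (w₁ :: A).Nodup)
    (hnB : (w₂ :: B).Nodup) :
    Hz (k + 1) (padded ((w₁ :: A) ++ (w₂ :: B)))
      = ((1 - ζ ^ 2) / w₃) ^ k * ((A ++ B).map fun v => v - w₃).prod * Hz k (padded (A ++ B)) := by
  have hA' : (w₁ :: A).length = k + 1 := by simp [hA]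
  have hB' : (w₂ :: B).length = k + 1 := by simp [hB]
  have hv : vdm (padded (w₁ :: A) : Fin (k + 1) → ℂ) * vdm (padded (w₂ :: B) : Fin (k + 1) → ℂ) ≠ 0 :=
    mul_ne_zero (vdm_ne_zero (injective_padded hA' hnA)) (vdm_ne_zero (injective_padded hB' hnB))
  refine mul_right_cancel₀ hv ?_
  have h1 := H_mul_vdm_padded hH (B := w₂ :: B) hA'
  have h2 := H_mul_vdm_padded hH (B := B) hA
  have h3 := hpol_factor hζ hs hp
  have h4 := hpol_factor (w₁ := w₂) (w₂ := w₁) (w₃ := w₃) hζ (by linear_combination hs)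
    (by linear_combination hp)
  have hw3 : w₃ ≠ 0 := by
    rintro rfl
    rw [mul_zero] at hp
    exact one_div_ne_zero hζ hp.symm
  have hc : (1 - ζ ^ 2) / w₃ = (1 - ζ ^ 2) * w₁ * ((1 - ζ ^ 2) * w₂) := by
    rw [eq_div_iff hζ] at hp
    rw [div_eq_iff hw3]
    linear_combination -(1 - ζ ^ 2) * hp
  rw [h1, padded_cons, padded_cons, det_Nmat_cons _ _ (by rw [h3]; ring), ← h2, vdm_cons, vdm_cons,
    prod_padded hB (fun v => hpol ζ w₁ v), prod_padded hA (fun v => hpol ζ v w₂),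
    prod_padded hA (fun v => v - w₁), prod_padded hB (fun v => v - w₂), List.map_append,
    List.prod_append, hc, mul_pow]
  have e1 : (A.map fun v => hpol ζ v w₂).prod
      = ((1 - ζ ^ 2) * w₂) ^ k * ((A.map fun v => v - w₁).prod * (A.map fun v => v - w₃).prod) := by
    simp only [h3, List.prod_map_mul, List.map_const', List.prod_replicate, hA]
  have e2 : (B.map fun v => hpol ζ w₁ v).prod
      = ((1 - ζ ^ 2) * w₁) ^ k * ((B.map fun v => v - w₂).prod * (B.map fun v => v - w₃).prod) := by
    simp only [hpol_comm ζ w₁, h4, List.prod_map_mul, List.map_const', List.prod_replicate, hB]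
  rw [e1, e2]
  ring

lemma H_one (hH : IsHFamily ζ Hz) (w : Fin (2 * 1) → ℂ) : Hz 1 w = 1 := by
  have := H_mul_vdm hH 1 w
  simpa [vdm, Nmat] using this

lemma H_two (hH : IsHFamily ζ Hz) (a b c d : ℂ) :
    Hz 2 (padded [a, b, c, d])
      = 3 + ζ ^ 2 - (1 - ζ ^ 2) * (a + b + c + d) + (1 - ζ ^ 2) ^ 2 * (a * b * c * d) := by
  have hp (i : Fin (2 * 2)) : IsPolyFun fun w : Fin (2 * 2) → ℂ => w i := IsPolyFun.var i
  have h1 : IsPolyFun fun w : Fin (2 * 2) → ℂ => Hz 2 w - (3 + ζ ^ 2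
      - (1 - ζ ^ 2) * (w 0 + w 1 + w 2 + w 3) + (1 - ζ ^ 2) ^ 2 * (w 0 * w 1 * w 2 * w 3)) :=
    IsPolyFun.sub (hH.2.1 2) (((IsPolyFun.const _).sub ((IsPolyFun.const _).mul
      ((((hp 0).add (hp 1)).add (hp 2)).add (hp 3)))).add ((IsPolyFun.const _).mul
      ((((hp 0).mul (hp 1)).mul (hp 2)).mul (hp 3))))
  have h2 : IsPolyFun fun w : Fin (2 * 2) → ℂ => (w 1 - w 0) * (w 3 - w 2) :=
    ((hp 1).sub (hp 0)).mul ((hp 3).sub (hp 2))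
  have key := (IsPolyFun.eq_zero_or_eq_zero h1 h2 fun w => ?_).resolve_right fun h => ?_
  · simpa [padded, sub_eq_zero] using key (padded [a, b, c, d])
  · have := H_mul_vdm hH 2 w
    have e0 : (Finset.univ.erase (0 : Fin 2)) = {1} := by decide
    have e1 : (Finset.univ.erase (1 : Fin 2)) = {0} := by decide
    simp only [vdm, Matrix.det_fin_two, Nmat, Matrix.of_apply, Fin.prod_univ_two, e0, e1,
      Finset.prod_singleton] at this
    simp [firstHalf, secondHalf] at this
    simp only [hpol] at this
    linear_combination this
  · have := h (padded [0, 1, 0, 1])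
    simp [padded] at this

end

section
variable {ζ : ℂ} {Hz : (k : ℕ) → (Fin (2 * k) → ℂ) → ℂ}

lemma eval_aeval_polynomial {σ : Type*} (g : σ → Polynomial ℂ) (P : MvPolynomial σ ℂ) (v : ℂ) :
    (MvPolynomial.aeval g P).eval v = MvPolynomial.eval (fun i => (g i).eval v) P := by
  induction P using MvPolynomial.induction_on with
  | C a => simp
  | add P Q hP hQ => simp [hP, hQ]
  | mul_X P i hP => simp [hP]

lemma exists_polynomial_hpol (ζ y : ℂ) :
    ∃ q : Polynomial ℂ, q.natDegree ≤ 2 ∧ ∀ v, q.eval v = hpol ζ v y := by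
  refine ⟨Polynomial.C ((1 - ζ ^ 2) * y) * Polynomial.X ^ 2
    + Polynomial.C (-(3 + ζ ^ 2) * y + (1 - ζ ^ 2) * y ^ 2) * Polynomial.X + Polynomial.C 1,
    Polynomial.natDegree_quadratic_le, fun v => ?_⟩
  simp [hpol]
  ring

lemma exists_polynomial_det_Nmat {k : ℕ} (f : Fin k → ℂ) (g : Fin (k + 1) → ℂ) :
    ∃ q : Polynomial ℂ, q.natDegree ≤ 2 * k ∧
      ∀ v, q.eval v = (Nmat ζ (Fin.cons v f : Fin (k + 1) → ℂ) g).det := by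
  choose h hd he using exists_polynomial_hpol ζ
  refine ⟨∑ j : Fin (k + 1), Polynomial.C ((-1) ^ (j : ℕ)) * (∏ l ∈ Finset.univ.erase j, h (g l))
    * Polynomial.C (((Nmat ζ (Fin.cons 0 f : Fin (k + 1) → ℂ) g).submatrix Fin.succ
        j.succAbove).det), Polynomial.natDegree_sum_le_of_forall_le _ _ fun j _ => ?_, fun v => ?_⟩
  · refine (Polynomial.natDegree_mul_C_le _ _).trans ((Polynomial.natDegree_C_mul_le _ _).trans
      ((Polynomial.natDegree_prod_le _ _).trans ?_))
    refine (Finset.sum_le_card_nsmul _ _ 2 fun l _ => hd _).trans ?_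
    simp [mul_comm]
  · rw [Matrix.det_succ_row_zero, Polynomial.eval_finsetSum]
    refine Finset.sum_congr rfl fun j _ => ?_
    simp only [Polynomial.eval_mul, Polynomial.eval_C, Polynomial.eval_prod, he]
    rfl

theorem H_degree (hH : IsHFamily ζ Hz) {k : ℕ} {A B : List ℂ} (hA : A.length = k)
    (hB : B.length = k + 1) (hnA : A.Nodup) (hnB : B.Nodup) :
    ∃ p : Polynomial ℂ, p.natDegree ≤ k ∧
      ∀ v, Hz (k + 1) (padded ((v :: A) ++ B)) = p.eval v := by
  obtain ⟨P, hP⟩ := hH.2.1 (k + 1)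
  obtain ⟨q, hq, hqe⟩ := exists_polynomial_det_Nmat (ζ := ζ) (padded A : Fin k → ℂ) (padded B)
  set p : Polynomial ℂ := MvPolynomial.aeval (fun i : Fin (2 * (k + 1)) =>
    ([Polynomial.X] ++ (A ++ B).map Polynomial.C).getD i 0) P with hp
  have hpe (v : ℂ) : Hz (k + 1) (padded ((v :: A) ++ B)) = p.eval v := by
    rw [hP, hp, eval_aeval_polynomial]
    congr 2
    funext i
    rw [padded, ← List.getD_map (f := Polynomial.eval v)]
    simp [Function.comp_def]
  refine ⟨p, ?_, hpe⟩
  by_cases hp0 : p = 0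
  · simp [hp0]
  set c := vdm (padded A : Fin k → ℂ) * vdm (padded B : Fin (k + 1) → ℂ) with hc
  have hc0 : c ≠ 0 :=
    mul_ne_zero (vdm_ne_zero (injective_padded hA hnA)) (vdm_ne_zero (injective_padded hB hnB))
  have hne (a : ℂ) : Polynomial.C a - Polynomial.X ≠ 0 := by
    rw [← neg_sub]
    exact neg_ne_zero.2 (Polynomial.X_sub_C_ne_zero a)
  have hmul : p * (∏ i : Fin k, (Polynomial.C (padded A i) - Polynomial.X)) * Polynomial.C c = q := by
    refine Polynomial.funext fun v => ?_
    have := H_mul_vdm_padded hH (k := k + 1) (A := v :: A) (B := B) (by simp [hA])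
    rw [padded_cons, vdm_cons] at this
    rw [hqe, ← this, hpe]
    simp only [Polynomial.eval_mul, Polynomial.eval_prod, Polynomial.eval_sub, Polynomial.eval_C,
      Polynomial.eval_X, hc]
    ring
  have hdeg := congrArg Polynomial.natDegree hmul
  rw [Polynomial.natDegree_mul_C hc0, Polynomial.natDegree_mul hp0
    (Finset.prod_ne_zero_iff.2 fun i _ => hne _), Polynomial.natDegree_prod _ _ fun i _ => hne _]
    at hdeg
  have h1 (a : ℂ) : (Polynomial.C a - Polynomial.X).natDegree = 1 := by
    rw [← neg_sub, Polynomial.natDegree_neg, Polynomial.natDegree_X_sub_C]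
  simp only [h1, Finset.sum_const, Finset.card_univ, Fintype.card_fin, smul_eq_mul, mul_one] at hdeg
  omega

end

/-! ### The reduction relation in determinantal form -/

section
variable {τ lam : ℂ} {Ψ : PsiFam}

/-- The constant produced by removing two variables from a list of length `N + 2`. -/
def kap (τ lam : ℂ) (N : ℕ) : ℂ :=
  (Kth τ ^ 2 / th1 ηc τ ^ 4) ^ (N + 1)
    * (th2 0 τ * th2 ηc τ * Dth τ (lam + ηc) / th4 0 (2 * τ) ^ 2)

lemma Dth_neg (τ x : ℂ) : Dth τ (-x) = Dth τ x := by
  rw [Dth, Dth, show -x - ηc = -(x + ηc) by ring, show -x + ηc = -(x - ηc) by ring, th1_neg,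
    th1_neg]
  ring

lemma Dth_add_pi (τ x : ℂ) : Dth τ (x + Real.pi) = Dth τ x := by
  rw [Dth, Dth, show x + Real.pi - ηc = x - ηc + Real.pi by ring,
    show x + Real.pi + ηc = x + ηc + Real.pi by ring, th1_add_pi, th1_add_pi]
  ring

lemma wfun_neg (τ x : ℂ) : wfun τ (-x) = wfun τ x := by
  rw [wfun_eq, wfun_eq, Dth_neg, th1_neg, neg_sq]

lemma Tth_neg (τ x : ℂ) : Tth τ (-x) = Tth τ x := by
  rw [Tth, Tth, show 2 * -x - ηc = -(2 * x + ηc) by ring, show 2 * -x + ηc = -(2 * x - ηc) by ring,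
    th4_neg, th4_neg, mul_comm]

lemma Tth_add_pi (τ x : ℂ) : Tth τ (x + Real.pi) = Tth τ x := by
  rw [Tth, Tth, show 2 * (x + (Real.pi : ℂ)) - ηc = 2 * x - ηc + Real.pi + Real.pi by ring,
    show 2 * (x + (Real.pi : ℂ)) + ηc = 2 * x + ηc + Real.pi + Real.pi by ring, th4_add_pi,
    th4_add_pi, th4_add_pi, th4_add_pi]

lemma Tth_mul_Tth (τ z : ℂ) :
    Tth τ (z + ηc) * Tth τ (ηc - z)
      = th4 (2 * z + ηc) (2 * τ) * th4 (2 * z - ηc) (2 * τ) * th4 (2 * z) (2 * τ) ^ 2 := by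
  rw [Tth, Tth, show 2 * (z + ηc) - ηc = 2 * z + ηc by ring,
    show 2 * (z + ηc) + ηc = 2 * z + Real.pi by rw [← three_ηc]; ring,
    show 2 * (ηc - z) - ηc = -(2 * z - ηc) by ring,
    show 2 * (ηc - z) + ηc = -(2 * z - Real.pi) by rw [← three_ηc]; ring, th4_neg, th4_neg,
    th4_add_pi, th4_sub_pi]
  ring

lemma Dth_mul_Dth (τ z : ℂ) : Dth τ (z + ηc) * Dth τ (ηc - z) = th1 z τ ^ 2 * Dth τ z := by
  rw [Dth, Dth, Dth, show z + ηc - ηc = z by ring,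
    show z + ηc + ηc = z - ηc + Real.pi by rw [← three_ηc]; ring,
    show ηc - z - ηc = -z by ring,
    show ηc - z + ηc = -(z + ηc - Real.pi) by rw [← three_ηc]; ring, th1_neg, th1_neg,
    th1_add_pi, th1_sub_pi]
  ring

lemma Dth_mul_th1_β2c (hτ : 0 < τ.im) (z : ℂ) :
    Dth τ z * (th1 (z + β2c) τ * th1 (z - β2c) τ)
      = - th4 0 (2 * τ) ^ 2 * (th1 (2 * z + ηc) (2 * τ) * th1 (2 * z - ηc) (2 * τ)) := by
  have h1 := th1_mul_th2_self hτ (z + ηc)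
  have h2 := th1_mul_th2_self hτ (z - ηc)
  rw [show 2 * (z + ηc) = 2 * z - ηc + Real.pi by rw [← three_ηc]; ring, th1_add_pi] at h1
  rw [show 2 * (z - ηc) = 2 * z + ηc - Real.pi by rw [← three_ηc]; ring, th1_sub_pi] at h2
  rw [Dth, β2c, show z + (ηc + (Real.pi : ℂ) / 2) = z + ηc + Real.pi / 2 by ring,
    show z - (ηc + (Real.pi : ℂ) / 2) = z - ηc + Real.pi / 2 - Real.pi by ring, th1_sub_pi,
    th1_add_half_pi, th1_add_half_pi]
  linear_combination -(th1 (z + ηc) τ * th2 (z + ηc) τ) * h2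
    + th4 0 (2 * τ) * th1 (2 * z + ηc) (2 * τ) * h1

lemma prod_Dth_sq_mul (hτ : 0 < τ.im) {z : ℂ} (hz : Dth τ z ≠ 0) {s : List ℂ}
    (hs : ∀ x ∈ s, Dth τ x ≠ 0) :
    (s.map fun x => Dth τ x ^ 2 * (wfun τ x - wfun τ z) ^ 2).prod
      = (Kth τ ^ 2 * th1 ηc τ ^ 4 / Dth τ z ^ 2) ^ s.length
        * (s.map fun x => (th1 (z + x) τ * th1 (z - x) τ) ^ 2).prod := by
  induction s with
  | nil => simp
  | cons x s ih =>
    have hx := hs x (by simp)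
    rw [List.map_cons, List.prod_cons, ih fun y hy => hs y (by simp [hy]), List.map_cons,
      List.prod_cons, wfun_sub_wfun hτ hx hz, List.length_cons, pow_succ _ s.length,
      show x - z = -(z - x) by ring, th1_neg, add_comm x z]
    generalize (s.map fun x => (th1 (z + x) τ * th1 (z - x) τ) ^ 2).prod = X
    generalize (Kth τ ^ 2 * th1 ηc τ ^ 4 / Dth τ z ^ 2) ^ s.length = Y
    field_simp

theorem Zs_step (h : PsiSol τ Ψ) (hβ : Dth τ (lam + ηc) ≠ 0) {z : ℂ} (hz : Dth τ z ≠ 0)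
    (hz0 : th1 z τ ≠ 0) {s : List ℂ} (hs : ∀ x ∈ s, Dth τ x ≠ 0) :
    Zs τ lam Ψ ((z + ηc) :: (ηc - z) :: s)
      = kap τ lam s.length * (Tth τ (z + ηc) * Dth τ (z + ηc) ^ (s.length + 2))
        * (Tth τ (ηc - z) * Dth τ (ηc - z) ^ (s.length + 2))
        * (((1 - zet τ ^ 2) / wfun τ z) ^ (s.length + 1)
          * ((J2c - wfun τ z) * (wfun τ (lam + ηc) - wfun τ z)))
        * (s.map fun x => Dth τ x ^ 2 * (wfun τ x - wfun τ z) ^ 2).prod * Zs τ lam Ψ s := by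
  have hτ := h.im_pos
  have hK := Kth_ne_zero hτ
  have hη := th1_η_ne hτ
  have h2 := th2_zero_ne hτ
  have h2η := th2_η_ne hτ
  have h4 := th4_zero_ne (two_mul_im_pos hτ)
  have hT := Tth_mul_Tth τ z
  have hD := Dth_mul_Dth τ z
  have hB := Dth_mul_th1_β2c hτ z
  rw [Zs_reduce h, prod_Dth_sq_mul hτ hz hs, ← wfun_β2c hτ,
    wfun_sub_wfun hτ (Dth_β2c_ne hτ) hz, wfun_sub_wfun hτ hβ hz, one_sub_zet_sq hτ, kap,
    Dth_β2c, wfun_eq]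
  generalize (s.map fun x => (th1 (z + x) τ * th1 (z - x) τ) ^ 2).prod = X
  generalize Zs τ lam Ψ s = Y
  generalize s.length = N
  rw [show lam + ηc - z = -(z - (lam + ηc)) by ring, show lam + ηc + z = z + (lam + ηc) by ring,
    show β2c - z = -(z - β2c) by ring, show β2c + z = z + β2c by ring, th1_neg, th1_neg]
  have e : Tth τ (z + ηc) * Dth τ (z + ηc) ^ (N + 2) * (Tth τ (ηc - z) * Dth τ (ηc - z) ^ (N + 2))
      = th4 (2 * z + ηc) (2 * τ) * th4 (2 * z - ηc) (2 * τ) * th4 (2 * z) (2 * τ) ^ 2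
        * (th1 z τ ^ 2 * Dth τ z) ^ (N + 2) := by
    rw [← hT, ← hD]
    ring
  have e2 : ((Kth τ ^ 3)⁻¹ / (Kth τ * th1 z τ ^ 2 / Dth τ z)) = Dth τ z / (Kth τ ^ 4 * th1 z τ ^ 2) := by
    field_simp
  have e3 : th1 (z + β2c) τ * th1 (z - β2c) τ
      = - th4 0 (2 * τ) ^ 2 * (th1 (2 * z + ηc) (2 * τ) * th1 (2 * z - ηc) (2 * τ)) / Dth τ z := by
    rw [← hB]
    field_simp
  rw [mul_assoc _ (Tth τ (z + ηc) * _) (Tth τ (ηc - z) * _), e, e2, mul_comm (-th1 (z - β2c) τ),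
    mul_neg, e3]
  have e4 : (Kth τ ^ 2 / th1 ηc τ ^ 4) ^ N * (th1 z τ ^ 2 * Dth τ z) ^ N
      * (Dth τ z / (Kth τ ^ 4 * th1 z τ ^ 2)) ^ N * (Kth τ ^ 2 * th1 ηc τ ^ 4 / Dth τ z ^ 2) ^ N
      = 1 := by
    rw [← mul_pow, ← mul_pow, ← mul_pow]
    convert one_pow N using 2
    field_simp
  rw [pow_succ _ N, pow_add _ N 2, pow_succ _ N]
  generalize (Kth τ ^ 2 / th1 ηc τ ^ 4) ^ N = A₁ at *
  generalize (th1 z τ ^ 2 * Dth τ z) ^ N = A₂ at *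
  generalize (Dth τ z / (Kth τ ^ 4 * th1 z τ ^ 2)) ^ N = A₃ at *
  generalize (Kth τ ^ 2 * th1 ηc τ ^ 4 / Dth τ z ^ 2) ^ N = A₄ at *
  field_simp
  linear_combination -(th1 (z + (lam + ηc)) τ * th1 (z - (lam + ηc)) τ * th1 (z * 2 + ηc) (2 * τ)
    * th4 (z * 2 + ηc) (2 * τ) * th1 (z * 2 - ηc) (2 * τ) * th4 (z * 2 - ηc) (2 * τ) * X
    * th4 (z * 2) (2 * τ) ^ 2 * Y) * e4

end

/-! ### Generic points and interpolation -/

section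
variable {τ lam : ℂ} {Ψ : PsiFam}

lemma wfun_triple_of_eq (hτ : 0 < τ.im) {x δ : ℂ} (hδ : δ = ηc ∨ δ = -ηc) (h0 : th1 x τ ≠ 0)
    (h1 : th1 (x + ηc) τ ≠ 0) (h2 : th1 (x - ηc) τ ≠ 0) :
    wfun τ (x + δ) + wfun τ x + wfun τ (x - δ) = (3 + zet τ ^ 2) / (1 - zet τ ^ 2) ∧
    wfun τ (x + δ) * wfun τ x * wfun τ (x - δ) = 1 / (1 - zet τ ^ 2) := by
  obtain ⟨hs, hp⟩ := wfun_triple hτ h0 h1 h2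
  rcases hδ with rfl | rfl
  · exact ⟨by linear_combination hs, by linear_combination hp⟩
  · rw [← sub_eq_add_neg, sub_neg_eq_add]
    exact ⟨by linear_combination hs, by linear_combination hp⟩

/-- The reduction relation for the pair `x + δ`, `x` with `δ = ± η`. -/
theorem Zs_step_of_eq (h : PsiSol τ Ψ) (hβ : Dth τ (lam + ηc) ≠ 0) {x δ : ℂ}
    (hδ : δ = ηc ∨ δ = -ηc) (hz : Dth τ (x - δ) ≠ 0)
    (hz0 : th1 (x - δ) τ ≠ 0) {s : List ℂ} (hs : ∀ x ∈ s, Dth τ x ≠ 0) :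
    Zs τ lam Ψ ((x + δ) :: x :: s)
      = kap τ lam s.length * (Tth τ (x + δ) * Dth τ (x + δ) ^ (s.length + 2))
        * (Tth τ x * Dth τ x ^ (s.length + 2))
        * (((1 - zet τ ^ 2) / wfun τ (x - δ)) ^ (s.length + 1)
          * ((J2c - wfun τ (x - δ)) * (wfun τ (lam + ηc) - wfun τ (x - δ))))
        * (s.map fun t => Dth τ t ^ 2 * (wfun τ t - wfun τ (x - δ)) ^ 2).prod * Zs τ lam Ψ s := by
  rcases hδ with rfl | rfl
  · have hneg : ηc - x = -(x - ηc) := by ring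
    have hadd : ηc - x + ηc = -(x + ηc) + Real.pi := by rw [← three_ηc]; ring
    have := Zs_step h hβ (z := ηc - x) (by rwa [hneg, Dth_neg])
      (by rwa [hneg, th1_neg, neg_ne_zero]) hs
    rwa [hadd, Zs_add_pi h, Zs_neg h, Tth_add_pi, Tth_neg, Dth_add_pi, Dth_neg, sub_sub_cancel,
      hneg, wfun_neg] at this
  · rw [sub_neg_eq_add] at *
    have hadd : x + ηc + ηc = x + -ηc + Real.pi := by rw [← three_ηc]; ring
    have := Zs_step h hβ (z := x + ηc) hz hz0 hs
    rwa [hadd, Zs_add_pi h, Tth_add_pi, Dth_add_pi, show ηc - (x + ηc) = -x by ring, Tth_neg,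
      Dth_neg, Zs_perm h (List.Perm.swap _ _ _), Zs_neg h, Zs_perm h (List.Perm.swap _ _ _)] at this

/-- `x` and `y` stay in different `w`-fibres under shifts by multiples of `η`. -/
def Gen (τ x y : ℂ) : Prop :=
  ∀ e : ℤ, th1 (x - y + e * ηc) τ ≠ 0 ∧ th1 (x + y + e * ηc) τ ≠ 0

lemma Gen.symm {x y : ℂ} (h : Gen τ x y) : Gen τ y x := by
  intro e
  refine ⟨?_, by rw [add_comm y x]; exact (h e).2⟩
  have := (h (-e)).1
  rwa [show x - y + ((-e : ℤ) : ℂ) * ηc = -(y - x + e * ηc) by push_cast; ring, th1_neg,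
    neg_ne_zero] at this

lemma Gen.shift {x y : ℂ} (h : Gen τ x y) (d : ℤ) : Gen τ (x + d * ηc) y := by
  intro e
  have := h (d + e)
  push_cast at this
  rwa [show x + d * ηc - y + e * ηc = x - y + (d + e) * ηc by ring,
    show x + d * ηc + y + e * ηc = x + y + (d + e) * ηc by ring]

lemma Gen.wsep {x y : ℂ} (h : Gen τ x y) : WSep τ x y := by
  simpa [WSep] using h 0

lemma Gen.th1_ne {x : ℂ} (h : Gen τ x 0) : th1 x τ ≠ 0 := by
  simpa using (h 0).1

lemma Gen.Dth_ne {x : ℂ} (h : Gen τ x 0) : Dth τ x ≠ 0 := by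
  have h1 := h.shift 1
  have h2 := h.shift (-1)
  push_cast at h1 h2
  rw [one_mul] at h1
  rw [neg_one_mul, ← sub_eq_add_neg] at h2
  exact mul_ne_zero h2.th1_ne h1.th1_ne

/-- Genericity conditions on a single variable. -/
structure Adm (τ β x : ℂ) : Prop where
  zero : Gen τ x 0
  beta : Gen τ x β
  beta2 : Gen τ x β2c
  a3 : Gen τ x (a3c τ)
  a4 : Gen τ x (a3c τ + Real.pi / 2)
  two : ∀ e : ℤ, th1 (2 * x + e * ηc) τ ≠ 0

lemma exists_int_of_eq {δ : ℂ} (hδ : δ = ηc ∨ δ = -ηc) : ∃ e : ℤ, δ = e * ηc := by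
  rcases hδ with rfl | rfl
  · exact ⟨1, by simp⟩
  · exact ⟨-1, by simp⟩

lemma Gen.add {x y δ : ℂ} (h : Gen τ x y) (hδ : δ = ηc ∨ δ = -ηc) : Gen τ (x + δ) y := by
  obtain ⟨e, rfl⟩ := exists_int_of_eq hδ
  exact h.shift e

lemma Gen.sub {x y δ : ℂ} (h : Gen τ x y) (hδ : δ = ηc ∨ δ = -ηc) : Gen τ (x - δ) y := by
  rw [sub_eq_add_neg]
  refine h.add ?_
  rcases hδ with rfl | rfl <;> simp

lemma Adm.wsep_add {β x δ : ℂ} (hτ : 0 < τ.im) (h : Adm τ β x) (hδ : δ = ηc ∨ δ = -ηc) :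
    WSep τ (x + δ) x := by
  refine ⟨?_, ?_⟩
  · rw [add_sub_cancel_left]
    rcases hδ with rfl | rfl
    · exact th1_η_ne hτ
    · rw [th1_neg, neg_ne_zero]
      exact th1_η_ne hτ
  · obtain ⟨e, rfl⟩ := exists_int_of_eq hδ
    rw [show x + e * ηc + x = 2 * x + e * ηc by ring]
    exact h.two e

/-- A list of generic points. -/
def GoodList (τ β : ℂ) (l : List ℂ) : Prop := (∀ x ∈ l, Adm τ β x) ∧ l.Pairwise (Gen τ)

lemma GoodList.sublist {β : ℂ} {l l' : List ℂ} (h : GoodList τ β l') (hl : l.Sublist l') :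
    GoodList τ β l :=
  ⟨fun x hx => h.1 x (hl.subset hx), h.2.sublist hl⟩

lemma GoodList.perm {β : ℂ} {l l' : List ℂ} (h : GoodList τ β l') (hl : l.Perm l') :
    GoodList τ β l :=
  ⟨fun x hx => h.1 x (hl.subset hx), (hl.pairwise_iff fun h => h.symm).2 h.2⟩

lemma Tth_mul_eval_mem (hτ : 0 < τ.im) {n : ℕ} {p : Polynomial ℂ} (hp : p.natDegree < n) (C : ℂ) :
    (fun z => C * (Tth τ z * Dth τ z ^ n) * p.eval (wfun τ z)) ∈ evenTheta τ (n + 2) := by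
  have : (fun z => C * (Tth τ z * Dth τ z ^ n) * p.eval (wfun τ z))
      = ∑ j ∈ Finset.range n, (C * p.coeff j * Kth τ ^ j)
        • fun z => Tth τ z * ((th1 z τ ^ 2) ^ j * Dth τ z ^ (n - j)) := by
    funext z
    rw [Polynomial.eval_eq_sum_range' hp, Finset.mul_sum, Finset.sum_apply]
    refine Finset.sum_congr rfl fun j hj => ?_
    have hj' := Finset.mem_range.1 hj
    rw [Pi.smul_apply, smul_eq_mul, wfun_eq]
    by_cases hD : Dth τ z = 0
    · rw [hD, zero_pow (by omega), zero_pow (by omega : n - j ≠ 0)]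
      ring
    · rw [← Nat.sub_add_cancel hj'.le, pow_add _ (n - j) j, Nat.add_sub_cancel, div_pow, mul_pow]
      field_simp
  rw [this]
  exact Submodule.sum_mem _ fun j hj => Submodule.smul_mem _ _
    (Tth_mul_Dth_pow_mem hτ (Finset.mem_range.1 hj).le)

/-- Interpolation of the partition function in one variable. -/
theorem Zs_eq_of_forall (h : PsiSol τ Ψ) {β : ℂ} {rest b : List ℂ} (hb : GoodList τ β b)
    (hlen : rest.length + 1 ≤ 2 * b.length) {p : Polynomial ℂ} (hp : p.natDegree < rest.length + 1)
    (C : ℂ) (hx : ∀ x ∈ b, ∀ δ, (δ = ηc ∨ δ = -ηc) → Zs τ lam Ψ ((x + δ) :: rest)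
      = C * (Tth τ (x + δ) * Dth τ (x + δ) ^ (rest.length + 1)) * p.eval (wfun τ (x + δ))) (u : ℂ) :
    Zs τ lam Ψ (u :: rest)
      = C * (Tth τ u * Dth τ u ^ (rest.length + 1)) * p.eval (wfun τ u) := by
  have hτ := h.im_pos
  have hη : (ηc = ηc ∨ ηc = -ηc) := Or.inl rfl
  have hη' : (-ηc = ηc ∨ -ηc = -ηc) := Or.inr rfl
  have hG := Submodule.sub_mem _ (Zs_mem (lam := lam) h rest) (Tth_mul_eval_mem hτ hp C)
  have key := evenTheta_eq_zero_of_list hτ (by omega) hG ?_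
    (l := a3c τ :: (a3c τ + Real.pi / 2) :: b.flatMap fun x => [x + ηc, x + -ηc]) ?_ ?_ ?_ ?_
  · exact sub_eq_zero.1 (congrFun key u)
  · simp [Zs_η h, Dth_η]
  · simp [List.length_flatMap]
    omega
  · simp only [List.mem_cons, List.mem_flatMap, List.not_mem_nil, or_false]
    rintro x (rfl | rfl | ⟨y, hy, rfl | rfl⟩)
    · exact Dth_a3c_ne hτ
    · exact Dth_a4c_ne hτ
    · exact ((hb.1 y hy).zero.add hη).Dth_ne
    · exact ((hb.1 y hy).zero.add hη').Dth_ne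
  · simp only [List.pairwise_cons, List.mem_cons, List.mem_flatMap, List.not_mem_nil, or_false]
    refine ⟨?_, ?_, ?_⟩
    · rintro x (rfl | ⟨y, hy, rfl | rfl⟩)
      · exact sep_a3c_a4c hτ
      · exact ((hb.1 y hy).a3.add hη).wsep.symm
      · exact ((hb.1 y hy).a3.add hη').wsep.symm
    · rintro x ⟨y, hy, rfl | rfl⟩
      · exact ((hb.1 y hy).a4.add hη).wsep.symm
      · exact ((hb.1 y hy).a4.add hη').wsep.symm
    · rw [List.pairwise_flatMap]
      refine ⟨fun x hx => ?_, hb.2.imp fun {x y} hxy => ?_⟩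
      · simp only [List.pairwise_cons, List.mem_cons, List.not_mem_nil, or_false, forall_eq,
          IsEmpty.forall_iff, implies_true, List.Pairwise.nil, and_true]
        refine ⟨?_, ?_⟩
        · rw [show x + ηc - (x + -ηc) = 2 * ηc by ring, th1_two_η]
          exact th1_η_ne hτ
        · rw [show x + ηc + (x + -ηc) = 2 * x by ring]
          simpa using (hb.1 x hx).two 0
      · simp only [List.mem_cons, List.not_mem_nil, or_false]
        rintro s (rfl | rfl) t (rfl | rfl)
        · exact ((hxy.add hη).symm.add hη).symm.wsep
        · exact ((hxy.add hη).symm.add hη').symm.wsep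
        · exact ((hxy.add hη').symm.add hη).symm.wsep
        · exact ((hxy.add hη').symm.add hη').symm.wsep
  · simp only [List.mem_cons, List.mem_flatMap, List.not_mem_nil, or_false]
    rintro x (rfl | rfl | ⟨y, hy, rfl | rfl⟩)
    · simp [Zs_eq_zero (th4_a3c τ), Tth_eq_zero (th4_a3c τ)]
    · simp [Zs_eq_zero (th4_a4c τ), Tth_eq_zero (th4_a4c τ)]
    · exact sub_eq_zero.2 (hx y hy _ hη)
    · exact sub_eq_zero.2 (hx y hy _ hη')

end

/-! ### The determinant formula at generic points -/

section
variable {τ lam : ℂ} {Ψ : PsiFam} {Hz : (k : ℕ) → (Fin (2 * k) → ℂ) → ℂ}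

/-- The product of two polynomials `H` entering the determinant formula. -/
def detForm (τ : ℂ) (Hz : (k : ℕ) → (Fin (2 * k) → ℂ) → ℂ) (P Q R : List ℂ) (m : ℕ)
    (a b : List ℂ) : ℂ :=
  Hz (P.length + m) (padded ((a.map (wfun τ) ++ P) ++ (b.map (wfun τ) ++ Q)))
    * Hz (m + 1) (padded ((a.map (wfun τ) ++ R) ++ b.map (wfun τ)))

lemma Gen.th1_add_ne {x : ℂ} (h : Gen τ x 0) : th1 (x + ηc) τ ≠ 0 :=
  (h.add (Or.inl rfl)).th1_ne

lemma Gen.th1_sub_ne {x : ℂ} (h : Gen τ x 0) : th1 (x - ηc) τ ≠ 0 :=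
  (h.sub (Or.inl rfl)).th1_ne

lemma nodup_wfun_of_good (hτ : 0 < τ.im) (hβ : Dth τ (lam + ηc) ≠ 0)
    (hββ : WSep τ β2c (lam + ηc)) {x δ : ℂ} (hδ : δ = ηc ∨ δ = -ηc) {s : List ℂ}
    (hs : GoodList τ (lam + ηc) (x :: s)) :
    (wfun τ (x + δ) :: wfun τ x :: J2c :: wfun τ (lam + ηc) :: s.map (wfun τ)).Nodup := by
  have hx := hs.1 x (by simp)
  have hs' (y : ℂ) (hy : y ∈ s) := hs.1 y (by simp [hy])
  have hp := List.pairwise_cons.1 hs.2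
  have := nodup_map_wfun hτ (l := (x + δ) :: x :: β2c :: (lam + ηc) :: s) ?_ ?_
  · simpa only [List.map_cons, wfun_β2c hτ] using this
  · simp only [List.mem_cons]
    rintro y (rfl | rfl | rfl | rfl | hy)
    · exact (hx.zero.add hδ).Dth_ne
    · exact hx.zero.Dth_ne
    · exact Dth_β2c_ne hτ
    · exact hβ
    · exact (hs' y hy).zero.Dth_ne
  · simp only [List.pairwise_cons, List.mem_cons]
    refine ⟨?_, ?_, ?_, ?_, hp.2.imp fun h => h.wsep⟩
    · rintro y (rfl | rfl | rfl | hy)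
      · exact hx.wsep_add hτ hδ
      · exact (hx.beta2.add hδ).wsep
      · exact (hx.beta.add hδ).wsep
      · exact ((hp.1 y hy).add hδ).wsep
    · rintro y (rfl | rfl | hy)
      · exact hx.beta2.wsep
      · exact hx.beta.wsep
      · exact (hp.1 y hy).wsep
    · rintro y (rfl | hy)
      · exact hββ
      · exact (hs' y hy).beta2.wsep.symm
    · exact fun y hy => (hs' y hy).beta.wsep.symm

/-- The lists `P`, `Q`, `R` of additional arguments are compatible with the variables `ex`. -/
structure ArgData (τ lam : ℂ) (P Q R ex : List ℂ) : Prop where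
  lenPQ : P.length = Q.length + 1
  lenP : P.length = ex.length + 1
  lenR : R.length = 1
  lenEx : ex.length ≤ 1
  subP : P.Sublist (J2c :: wfun τ (lam + ηc) :: ex.map (wfun τ))
  subQ : Q.Sublist (J2c :: wfun τ (lam + ηc) :: ex.map (wfun τ))
  subR : R.Sublist (J2c :: wfun τ (lam + ηc) :: ex.map (wfun τ))
  prod_eq : ∀ v : ℂ, (P.map fun t => t - v).prod * (Q.map fun t => t - v).prod
      * (R.map fun t => t - v).prod
    = (J2c - v) * (wfun τ (lam + ηc) - v) * (ex.map fun x => (wfun τ x - v) ^ 2).prod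

lemma nodup_args (hτ : 0 < τ.im) (hβ : Dth τ (lam + ηc) ≠ 0)
    (hββ : WSep τ β2c (lam + ηc)) {x δ : ℂ} (hδ : δ = ηc ∨ δ = -ηc) {a b ex : List ℂ}
    (hs : GoodList τ (lam + ηc) (x :: (a ++ (b ++ ex)))) :
    (wfun τ (x + δ) :: wfun τ x :: (a.map (wfun τ) ++ (b.map (wfun τ)
      ++ (J2c :: wfun τ (lam + ηc) :: ex.map (wfun τ))))).Nodup := by
  refine (List.Perm.nodup_iff ?_).1 (nodup_wfun_of_good hτ hβ hββ hδ hs)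
  refine List.Perm.cons _ (List.Perm.cons _ ?_)
  simp only [List.map_append, ← List.append_assoc]
  exact (List.perm_middle.trans (List.Perm.cons _ List.perm_middle)).symm

theorem detForm_reduce (h : PsiSol τ Ψ) (hH : IsHFamily (zet τ) Hz) (hβ : Dth τ (lam + ηc) ≠ 0)
    (hββ : WSep τ β2c (lam + ηc)) {P Q R ex : List ℂ} (hA : ArgData τ lam P Q R ex) {m n : ℕ}
    {a b : List ℂ} (ha : a.length = m) (hb : b.length = m + 1) (hn : n = (a ++ (b ++ ex)).length)
    {x δ c : ℂ} (hδ : δ = ηc ∨ δ = -ηc) (hs : GoodList τ (lam + ηc) (x :: (a ++ (b ++ ex))))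
    (ih : Zs τ lam Ψ (a ++ (b ++ ex)) = c * ((a ++ (b ++ ex)).map
      fun t => Tth τ t * Dth τ t ^ n).prod * detForm τ Hz P Q R m a b) :
    Zs τ lam Ψ ((x + δ) :: x :: (a ++ (b ++ ex)))
      = kap τ lam n * c * (Tth τ (x + δ) * Dth τ (x + δ) ^ (n + 2))
        * (Tth τ x * Dth τ x ^ (n + 2))
        * ((a ++ (b ++ ex)).map fun t => Tth τ t * Dth τ t ^ (n + 2)).prod
        * detForm τ Hz P Q R (m + 1) ((x + δ) :: a) (x :: b) := by
  have hτ := h.im_pos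
  have hx := hs.1 x (by simp)
  have hN := nodup_args hτ hβ hββ hδ hs
  obtain ⟨hsum, hprod⟩ := wfun_triple_of_eq hτ hδ hx.zero.th1_ne hx.zero.th1_add_ne
    hx.zero.th1_sub_ne
  have hζ := one_sub_zet_sq_ne hτ
  have hlP := hA.lenP
  have hlPQ := hA.lenPQ
  have hlR := hA.lenR
  have r1 := H_reduce hH hζ hsum hprod (k := P.length + m) (A := a.map (wfun τ) ++ P)
    (B := b.map (wfun τ) ++ Q) (by simp [ha]; omega) (by simp [hb]; omega)
    (hN.sublist (((List.sublist_cons_of_sublist _ ((List.Sublist.refl _).append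
      (hA.subP.trans (List.sublist_append_right _ _))))).cons_cons _))
    (hN.sublist (List.sublist_cons_of_sublist _ ((((List.Sublist.refl _).append
      hA.subQ).trans (List.sublist_append_right _ _)).cons_cons _)))
  have r2 := H_reduce hH hζ hsum hprod (k := m + 1) (A := a.map (wfun τ) ++ R)
    (B := b.map (wfun τ)) (by simp [ha]; omega) (by simp [hb])
    (hN.sublist (((List.sublist_cons_of_sublist _ ((List.Sublist.refl _).append
      (hA.subR.trans (List.sublist_append_right _ _))))).cons_cons _))
    (hN.sublist (List.sublist_cons_of_sublist _ (((List.sublist_append_left _ _).trans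
      (List.sublist_append_right _ _)).cons_cons _)))
  have hd : detForm τ Hz P Q R (m + 1) ((x + δ) :: a) (x :: b)
      = (((1 - zet τ ^ 2) / wfun τ (x - δ)) ^ (n + 1)
          * ((J2c - wfun τ (x - δ)) * (wfun τ (lam + ηc) - wfun τ (x - δ))))
        * ((a ++ (b ++ ex)).map fun t => (wfun τ t - wfun τ (x - δ)) ^ 2).prod
        * detForm τ Hz P Q R m a b := by
    have hnn : n + 1 = (P.length + m) + (m + 1) := by
      rw [hn]
      simp [ha, hb]
      omega
    have hpe := hA.prod_eq (wfun τ (x - δ))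
    simp only [List.map_append, List.prod_append, List.map_map] at r1 r2 ⊢
    rw [hnn, pow_add]
    simp only [detForm]
    rw [show P.length + (m + 1) = P.length + m + 1 from rfl]
    simp only [List.map_cons, List.cons_append] at r1 r2 ⊢
    rw [r1, r2]
    have sq (l : List ℂ) : (l.map fun t => (wfun τ t - wfun τ (x - δ)) ^ 2).prod
        = (l.map ((fun t => t - wfun τ (x - δ)) ∘ wfun τ)).prod ^ 2 := by
      simp only [pow_two, List.prod_map_mul, Function.comp_def]
    rw [sq a, sq b]
    linear_combination ((1 - zet τ ^ 2) / wfun τ (x - δ)) ^ (P.length + m)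
      * ((1 - zet τ ^ 2) / wfun τ (x - δ)) ^ (m + 1)
      * (a.map ((fun t => t - wfun τ (x - δ)) ∘ wfun τ)).prod ^ 2
      * (b.map ((fun t => t - wfun τ (x - δ)) ∘ wfun τ)).prod ^ 2
      * Hz (P.length + m) (padded ((a.map (wfun τ) ++ P) ++ (b.map (wfun τ) ++ Q)))
      * Hz (m + 1) (padded ((a.map (wfun τ) ++ R) ++ b.map (wfun τ))) * hpe
  rw [Zs_step_of_eq h hβ hδ (hx.zero.sub hδ).Dth_ne (hx.zero.sub hδ).th1_ne
    (fun y hy => (hs.1 y (List.mem_cons_of_mem _ hy)).zero.Dth_ne), ← hn, ih, hd]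
  have hm : ((a ++ (b ++ ex)).map fun t => Tth τ t * Dth τ t ^ (n + 2)).prod
      * ((a ++ (b ++ ex)).map fun t => (wfun τ t - wfun τ (x - δ)) ^ 2).prod
      = ((a ++ (b ++ ex)).map fun t => Dth τ t ^ 2 * (wfun τ t - wfun τ (x - δ)) ^ 2).prod
        * ((a ++ (b ++ ex)).map fun t => Tth τ t * Dth τ t ^ n).prod := by
    rw [← List.prod_map_mul, ← List.prod_map_mul]
    congr 2
    funext t
    ring
  linear_combination -(kap τ lam n * (Tth τ (x + δ) * Dth τ (x + δ) ^ (n + 2))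
        * (Tth τ x * Dth τ x ^ (n + 2))
        * (((1 - zet τ ^ 2) / wfun τ (x - δ)) ^ (n + 1)
          * ((J2c - wfun τ (x - δ)) * (wfun τ (lam + ηc) - wfun τ (x - δ))))
        * c * detForm τ Hz P Q R m a b) * hm

end

section
variable {τ lam : ℂ} {Ψ : PsiFam} {Hz : (k : ℕ) → (Fin (2 * k) → ℂ) → ℂ}

theorem detForm_step (h : PsiSol τ Ψ) (hH : IsHFamily (zet τ) Hz) (hβ : Dth τ (lam + ηc) ≠ 0)
    (hββ : WSep τ β2c (lam + ηc)) {P Q R ex : List ℂ} (hA : ArgData τ lam P Q R ex) {m n : ℕ}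
    (hn : n = 2 * m + 1 + ex.length) {c : ℂ}
    (ih : ∀ a b : List ℂ, a.length = m → b.length = m + 1 →
      GoodList τ (lam + ηc) (a ++ (b ++ ex)) →
      Zs τ lam Ψ (a ++ (b ++ ex)) = c * ((a ++ (b ++ ex)).map
        fun t => Tth τ t * Dth τ t ^ n).prod * detForm τ Hz P Q R m a b)
    {a b : List ℂ} (ha : a.length = m + 1) (hb : b.length = m + 1 + 1)
    (hg : GoodList τ (lam + ηc) (a ++ (b ++ ex))) :
    Zs τ lam Ψ (a ++ (b ++ ex)) = kap τ lam n * c * ((a ++ (b ++ ex)).map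
      fun t => Tth τ t * Dth τ t ^ (n + 2)).prod * detForm τ Hz P Q R (m + 1) a b := by
  have hτ := h.im_pos
  have hlP := hA.lenP
  have hlPQ := hA.lenPQ
  have hlR := hA.lenR
  have hlex := hA.lenEx
  obtain ⟨z, a, rfl⟩ := List.exists_cons_of_length_eq_add_one ha
  rw [List.length_cons, Nat.add_right_cancel_iff] at ha
  rw [List.cons_append] at hg ⊢
  have hN := (List.nodup_cons.1 (List.nodup_cons.1 (nodup_args hτ hβ hββ (Or.inl rfl) hg)).2).2
  obtain ⟨p, hpd, hp⟩ := H_degree hH (k := P.length + m) (A := a.map (wfun τ) ++ P)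
    (B := b.map (wfun τ) ++ Q) (by simp [ha]; omega) (by simp [hb]; omega)
    (hN.sublist ((List.Sublist.refl _).append (hA.subP.trans (List.sublist_append_right _ _))))
    (hN.sublist (((List.Sublist.refl _).append hA.subQ).trans (List.sublist_append_right _ _)))
  obtain ⟨q, hqd, hq⟩ := H_degree hH (k := m + 1) (A := a.map (wfun τ) ++ R)
    (B := b.map (wfun τ)) (by simp [ha]; omega) (by simp [hb])
    (hN.sublist ((List.Sublist.refl _).append (hA.subR.trans (List.sublist_append_right _ _))))
    (hN.sublist ((List.sublist_append_left _ _).trans (List.sublist_append_right _ _)))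
  have hlen : (a ++ (b ++ ex)).length + 1 = n + 2 := by
    simp [ha, hb]
    omega
  have hgb : GoodList τ (lam + ηc) b := hg.sublist (List.sublist_cons_of_sublist _
    ((List.sublist_append_left _ _).trans (List.sublist_append_right _ _)))
  have key := Zs_eq_of_forall (lam := lam) h hgb (rest := a ++ (b ++ ex)) ?_ (p := p * q) ?_
    (kap τ lam n * c * ((a ++ (b ++ ex)).map fun t => Tth τ t * Dth τ t ^ (n + 2)).prod) ?_ z
  · rw [key, hlen, Polynomial.eval_mul, ← hp, ← hq, List.map_cons, List.prod_cons]
    simp only [detForm, List.map_cons]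
    rw [show P.length + (m + 1) = P.length + m + 1 from rfl]
    simp only [List.cons_append]
    ring
  · rw [hb, hlen]
    omega
  · rw [hlen]
    have := Polynomial.natDegree_mul_le (p := p) (q := q)
    omega
  · intro x hx δ hδ
    have hperm := List.perm_cons_erase hx
    set b' := b.erase x with hb'
    have hlb : b'.length = m + 1 := by
      have := hperm.length_eq
      rw [List.length_cons] at this
      omega
    have hrest : (a ++ (b ++ ex)).Perm (x :: (a ++ (b' ++ ex))) :=
      ((hperm.append_right ex).append_left a).trans List.perm_middle
    have hgx : GoodList τ (lam + ηc) (x :: (a ++ (b' ++ ex))) :=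
      (hg.sublist (List.sublist_cons_self _ _)).perm hrest.symm
    have hNx := nodup_args hτ hβ hββ hδ hgx
    have red := detForm_reduce h hH hβ hββ hA ha hlb (n := n) (by simp [ha, hlb]; omega) hδ hgx
      (ih a b' ha hlb (hgx.sublist (List.sublist_cons_self _ _)))
    rw [Zs_perm h (hrest.cons _), red, hlen, Polynomial.eval_mul, ← hp, ← hq,
      (hrest.map _).prod_eq, List.map_cons, List.prod_cons]
    have e1 := H_perm hH (k := P.length + m + 1) (A := wfun τ (x + δ) :: (a.map (wfun τ) ++ P))
      (B := (x :: b').map (wfun τ) ++ Q) (B' := b.map (wfun τ) ++ Q)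
      (by simp [ha]; omega) (by simp [hlb]; omega) (List.Perm.refl _)
      ((hperm.symm.map _).append_right _)
      (hNx.sublist (((List.sublist_cons_of_sublist _ ((List.Sublist.refl _).append
        (hA.subP.trans (List.sublist_append_right _ _))))).cons_cons _))
      (hNx.sublist (List.sublist_cons_of_sublist _ ((((List.Sublist.refl _).append
        hA.subQ).trans (List.sublist_append_right _ _)).cons_cons _)))
    have e2 := H_perm hH (k := m + 1 + 1) (A := wfun τ (x + δ) :: (a.map (wfun τ) ++ R))
      (B := (x :: b').map (wfun τ)) (B' := b.map (wfun τ))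
      (by simp [ha]; omega) (by simp [hlb]) (List.Perm.refl _)
      (hperm.symm.map _)
      (hNx.sublist (((List.sublist_cons_of_sublist _ ((List.Sublist.refl _).append
        (hA.subR.trans (List.sublist_append_right _ _))))).cons_cons _))
      (hNx.sublist (List.sublist_cons_of_sublist _ (((List.sublist_append_left _ _).trans
        (List.sublist_append_right _ _)).cons_cons _)))
    rw [← e1, ← e2]
    simp only [detForm, List.map_cons]
    rw [show P.length + (m + 1) = P.length + m + 1 from rfl]
    simp only [List.cons_append]
    ring

/-- The overall constant of the determinant formula, for `e` additional variables. -/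
def detConst (τ lam c : ℂ) (e : ℕ) : ℕ → ℂ
  | 0 => c
  | m + 1 => kap τ lam (2 * m + 1 + e) * detConst τ lam c e m

theorem Zs_eq_detForm (h : PsiSol τ Ψ) (hH : IsHFamily (zet τ) Hz) (hβ : Dth τ (lam + ηc) ≠ 0)
    (hββ : WSep τ β2c (lam + ηc)) {P Q R ex : List ℂ} (hA : ArgData τ lam P Q R ex) {c : ℂ}
    (h0 : ∀ x : ℂ, GoodList τ (lam + ηc) (x :: ex) → Zs τ lam Ψ (x :: ex)
      = c * ((x :: ex).map fun t => Tth τ t * Dth τ t ^ (1 + ex.length)).prod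
        * detForm τ Hz P Q R 0 [] [x]) (m : ℕ) :
    ∀ a b : List ℂ, a.length = m → b.length = m + 1 →
      GoodList τ (lam + ηc) (a ++ (b ++ ex)) →
      Zs τ lam Ψ (a ++ (b ++ ex)) = detConst τ lam c ex.length m * ((a ++ (b ++ ex)).map
        fun t => Tth τ t * Dth τ t ^ (2 * m + 1 + ex.length)).prod
        * detForm τ Hz P Q R m a b := by
  induction m with
  | zero =>
    intro a b ha hb hg
    obtain rfl := List.length_eq_zero_iff.1 ha
    obtain ⟨x, rfl⟩ := List.length_eq_one_iff.1 hb
    simpa [detConst] using h0 x hg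
  | succ m ih =>
    intro a b ha hb hg
    rw [detConst, detForm_step h hH hβ hββ hA rfl ih ha hb hg]
    congr 5
    funext t
    congr 2
    ring

lemma congrFun_padded {k k' : ℕ} (hk : k = k') (l : List ℂ) :
    Hz k (padded l) = Hz k' (padded l) := by
  subst hk
  rfl

lemma nodup_J2c_cons (hτ : 0 < τ.im) (hβ : Dth τ (lam + ηc) ≠ 0)
    (hββ : WSep τ β2c (lam + ηc)) {l : List ℂ} (hg : GoodList τ (lam + ηc) l) :
    (J2c :: wfun τ (lam + ηc) :: l.map (wfun τ)).Nodup := by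
  have := nodup_map_wfun hτ (l := β2c :: (lam + ηc) :: l) ?_ ?_
  · simpa only [List.map_cons, wfun_β2c hτ] using this
  · simp only [List.mem_cons]
    rintro y (rfl | rfl | hy)
    · exact Dth_β2c_ne hτ
    · exact hβ
    · exact (hg.1 y hy).zero.Dth_ne
  · simp only [List.pairwise_cons, List.mem_cons]
    refine ⟨?_, ?_, hg.2.imp fun h => h.wsep⟩
    · rintro y (rfl | hy)
      · exact hββ
      · exact (hg.1 y hy).beta2.wsep.symm
    · exact fun y hy => (hg.1 y hy).beta.wsep.symm

theorem Zs_odd (h : PsiSol τ Ψ) (hH : IsHFamily (zet τ) Hz) (hβ : Dth τ (lam + ηc) ≠ 0)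
    (hββ : WSep τ β2c (lam + ηc)) {m : ℕ} {l : List ℂ} (hl : l.length = 2 * m + 1)
    (hg : GoodList τ (lam + ηc) l) :
    Zs τ lam Ψ l = detConst τ lam (-(th2 (lam + ηc) τ / th4 0 (2 * τ))) 0 m
      * (l.map fun t => Tth τ t * Dth τ t ^ (2 * m + 1)).prod
      * (Hz (m + 1) (padded (J2c :: l.map (wfun τ)))
        * Hz (m + 1) (padded (wfun τ (lam + ηc) :: l.map (wfun τ)))) := by
  have hτ := h.im_pos
  have hA : ArgData τ lam [J2c] [] [wfun τ (lam + ηc)] [] :=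
    ⟨rfl, rfl, rfl, by simp, by simp, by simp, by simp, fun v => by simp⟩
  have hl' : l = l.take m ++ (l.drop m ++ []) := by simp
  have hN := nodup_map_wfun hτ (fun x hx => (hg.1 x hx).zero.Dth_ne) (hg.2.imp fun h => h.wsep)
  have key := Zs_eq_detForm h hH hβ hββ hA (c := -(th2 (lam + ηc) τ / th4 0 (2 * τ)))
    (fun x _ => by simp [Zs_singleton h, detForm, H_one hH]) m (l.take m) (l.drop m)
    (by rw [List.length_take]; omega) (by rw [List.length_drop]; omega) (by rwa [← hl'])
  rw [← hl'] at key
  have hlt : (l.take m).length = m := by rw [List.length_take]; omega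
  have hld : (l.drop m).length = m + 1 := by rw [List.length_drop]; omega
  have hN2 : (J2c :: wfun τ (lam + ηc) :: l.map (wfun τ)).Nodup := nodup_J2c_cons hτ hβ hββ hg
  have hsub : (J2c :: wfun τ (lam + ηc) :: (l.take m).map (wfun τ)).Nodup :=
    hN2.sublist ((((List.take_sublist _ _).map _).cons_cons _).cons_cons _)
  have hsd : ((l.drop m).map (wfun τ)).Nodup := hN.sublist ((List.drop_sublist _ _).map _)
  have e1 := H_perm hH (k := m + 1) (A := J2c :: (l.take m).map (wfun τ))
    (A' := (l.take m).map (wfun τ) ++ [J2c]) (B := (l.drop m).map (wfun τ))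
    (by rw [List.length_cons, List.length_map, hlt]) (by rw [List.length_map, hld]) (List.perm_append_singleton _ _).symm (List.Perm.refl _)
    (hsub.sublist ((List.sublist_cons_self _ _).cons_cons _)) hsd
  have e2 := H_perm hH (k := m + 1) (A := wfun τ (lam + ηc) :: (l.take m).map (wfun τ))
    (A' := (l.take m).map (wfun τ) ++ [wfun τ (lam + ηc)]) (B := (l.drop m).map (wfun τ))
    (by rw [List.length_cons, List.length_map, hlt]) (by rw [List.length_map, hld]) (List.perm_append_singleton _ _).symm (List.Perm.refl _)
    (hsub.sublist (List.sublist_cons_self _ _)) hsd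
  rw [List.cons_append, ← List.map_append, List.take_append_drop] at e1 e2
  rw [key, detForm, e1, e2, List.append_nil]
  congr 2
  exact congrFun_padded (by simp [add_comm]) _

lemma Zs_nil (h : PsiSol τ Ψ) : Zs τ lam Ψ [] = 1 := by
  simpa [Zs, ZL, Zp, contr_nil, flatU, PsiL] using h.zero _ _

/-- The determinant formula for two variables. -/
theorem Zs_two (h : PsiSol τ Ψ) (hH : IsHFamily (zet τ) Hz) (hβ : Dth τ (lam + ηc) ≠ 0)
    (hββ : WSep τ β2c (lam + ηc)) {x c : ℂ} (hg : GoodList τ (lam + ηc) [x, c]) :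
    Zs τ lam Ψ [x, c] = kap τ lam 0 * ([x, c].map fun t => Tth τ t * Dth τ t ^ 2).prod
      * Hz 2 (padded [J2c, wfun τ (lam + ηc), wfun τ x, wfun τ c]) := by
  have hτ := h.im_pos
  have hgx : GoodList τ (lam + ηc) [x] := hg.sublist (by simp)
  have hx := hgx.1 x (by simp)
  set p : Polynomial ℂ := Polynomial.C (3 + zet τ ^ 2 - (1 - zet τ ^ 2)
      * (J2c + wfun τ (lam + ηc) + wfun τ x))
    + Polynomial.C ((1 - zet τ ^ 2) ^ 2 * (J2c * wfun τ (lam + ηc) * wfun τ x)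
      - (1 - zet τ ^ 2)) * Polynomial.X with hpdef
  have hp (v : ℂ) : Hz 2 (padded [J2c, wfun τ (lam + ηc), wfun τ x, v]) = p.eval v := by
    rw [H_two hH]
    simp [hpdef]
    ring
  have key := Zs_eq_of_forall (lam := lam) h hgx (rest := [x]) (by simp) (p := p) ?_
    (kap τ lam 0 * (Tth τ x * Dth τ x ^ 2)) ?_ c
  · rw [Zs_perm h (List.Perm.swap c x []), key, hp]
    simp only [List.map_cons, List.map_nil, List.prod_cons, List.prod_nil, List.length_singleton]
    ring
  · rw [hpdef]
    compute_degree
    simp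
  · intro y hy δ hδ
    obtain rfl := List.mem_singleton.1 hy
    obtain ⟨hsum, hprod⟩ := wfun_triple_of_eq hτ hδ hx.zero.th1_ne hx.zero.th1_add_ne
      hx.zero.th1_sub_ne
    have hN := nodup_wfun_of_good hτ hβ hββ hδ hgx
    have r := H_reduce hH (one_sub_zet_sq_ne hτ) hsum hprod (k := 1) (A := [J2c])
      (B := [wfun τ (lam + ηc)]) rfl rfl
      (hN.sublist (by simp))
      (hN.sublist (by simp))
    rw [H_one hH, List.cons_append, List.singleton_append, H_two hH] at r
    rw [Zs_step_of_eq h hβ hδ (hx.zero.sub hδ).Dth_ne (hx.zero.sub hδ).th1_ne (by simp), ← hp,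
      H_two hH, Zs_nil h]
    simp only [List.map_cons, List.map_nil, List.prod_cons, List.prod_nil, List.length_singleton,
      List.length_nil, List.cons_append, List.nil_append, zero_add] at r ⊢
    linear_combination -(kap τ lam 0 * (Tth τ (y + δ) * Dth τ (y + δ) ^ 2)
      * (Tth τ y * Dth τ y ^ 2)) * r

theorem Zs_even (h : PsiSol τ Ψ) (hH : IsHFamily (zet τ) Hz) (hβ : Dth τ (lam + ηc) ≠ 0)
    (hββ : WSep τ β2c (lam + ηc)) {m : ℕ} {l : List ℂ} (hl : l.length = 2 * m + 2)
    (hg : GoodList τ (lam + ηc) l) :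
    Zs τ lam Ψ l = detConst τ lam (kap τ lam 0) 1 m
      * (l.map fun t => Tth τ t * Dth τ t ^ (2 * m + 2)).prod
      * (Hz (m + 2) (padded (J2c :: wfun τ (lam + ηc) :: l.map (wfun τ)))
        * Hz (m + 1) (padded (l.map (wfun τ)))) := by
  have hτ := h.im_pos
  have hlt : (l.take m).length = m := by rw [List.length_take]; omega
  obtain ⟨c, b, hb⟩ := List.exists_cons_of_length_eq_add_one
    (show (l.drop m).length = m + 1 + 1 by rw [List.length_drop]; omega)
  have hlb : b.length = m + 1 := by
    have := congrArg List.length hb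
    rw [List.length_drop, List.length_cons] at this
    omega
  have hl' : l = l.take m ++ c :: b := by rw [← hb, List.take_append_drop]
  set a := l.take m with ha
  have hperm : l.Perm (a ++ (b ++ [c])) := by
    rw [hl']
    exact (List.perm_append_singleton _ _).symm.append_left _
  have hA : ArgData τ lam [J2c, wfun τ (lam + ηc)] [wfun τ c] [wfun τ c] [c] :=
    ⟨rfl, rfl, rfl, by simp, by simp, by simp, by simp, fun v => by simp; ring⟩
  have hN : (J2c :: wfun τ (lam + ηc) :: l.map (wfun τ)).Nodup := nodup_J2c_cons hτ hβ hββ hg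
  have key := Zs_eq_detForm h hH hβ hββ hA (c := kap τ lam 0)
    (fun x hx => by simp [Zs_two h hH hβ hββ hx, detForm, H_one hH]) m a b
    hlt hlb (hg.perm hperm.symm)
  have hsub : (J2c :: wfun τ (lam + ηc) :: (a.map (wfun τ) ++ wfun τ c :: b.map (wfun τ))).Nodup := by
    rwa [hl', List.map_append, List.map_cons] at hN
  have e1 := H_perm hH (k := m + 2) (A := J2c :: wfun τ (lam + ηc) :: a.map (wfun τ))
    (A' := a.map (wfun τ) ++ [J2c, wfun τ (lam + ηc)]) (B := wfun τ c :: b.map (wfun τ))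
    (B' := b.map (wfun τ) ++ [wfun τ c])
    (by simp [hlt]) (by simp [hlb])
    (List.perm_append_comm (l₁ := [J2c, wfun τ (lam + ηc)])) (List.perm_append_singleton _ _).symm
    (hsub.sublist (((List.sublist_append_left _ _).cons_cons _).cons_cons _))
    (hsub.sublist (List.sublist_cons_of_sublist _ (List.sublist_cons_of_sublist _
      (List.sublist_append_right _ _))))
  have hsub2 := (List.nodup_cons.1 (List.nodup_cons.1 hsub).2).2
  have e2 : (padded (a.map (wfun τ) ++ wfun τ c :: b.map (wfun τ)) : Fin (2 * (m + 1)) → ℂ)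
      = padded ((a.map (wfun τ) ++ [wfun τ c]) ++ b.map (wfun τ)) := by simp
  rw [Zs_perm h hperm, key, detForm, (hperm.map _).prod_eq, hl',
    List.map_append (f := wfun τ), List.map_cons (f := wfun τ), e2]
  rw [show J2c :: wfun τ (lam + ηc) :: (a.map (wfun τ) ++ wfun τ c :: b.map (wfun τ))
    = (J2c :: wfun τ (lam + ηc) :: a.map (wfun τ)) ++ wfun τ c :: b.map (wfun τ) from rfl, e1]
  congr 2
  exact congrFun_padded (by simp [add_comm]) _

end

/-! ### Extension from generic points by continuity -/

lemma countable_zeros {f : ℂ → ℂ} (hf : Differentiable ℂ f) {z : ℂ} (hz : f z ≠ 0) :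
    {x | f x = 0}.Countable := by
  have hc := AnalyticOnNhd.preimage_zero_mem_codiscrete (fun z _ => hf.analyticAt z) hz
  have := (HereditarilyLindelofSpace.isLindelof _).countable_of_isDiscrete
    (isDiscrete_of_codiscreteWithin (s := {x | f x = 0}) (U := Set.univ) hc)
  rwa [Set.inter_univ] at this

section
variable {τ lam : ℂ} {Ψ : PsiFam} {Hz : (k : ℕ) → (Fin (2 * k) → ℂ) → ℂ}

lemma countable_th1_zeros (hτ : 0 < τ.im) {a : ℂ} (ha : a ≠ 0) (b : ℂ) :
    {z | th1 (a * z + b) τ = 0}.Countable := by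
  refine countable_zeros (f := fun z => th1 (a * z + b) τ) (z := (ηc - b) / a)
    ((differentiable_th1 hτ).comp (by fun_prop)) ?_
  rw [mul_div_cancel₀ _ ha, sub_add_cancel]
  exact th1_η_ne hτ

lemma countable_not_gen (hτ : 0 < τ.im) (y : ℂ) : {z | ¬ Gen τ z y}.Countable := by
  refine ((Set.countable_iUnion fun e : ℤ =>
    (countable_th1_zeros hτ one_ne_zero (-y + e * ηc)).union
      (countable_th1_zeros hτ one_ne_zero (y + e * ηc)))).mono ?_
  intro z hz
  simp only [Set.mem_ofPred_eq, Gen, not_forall, not_and_or, not_not] at hz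
  obtain ⟨e, he⟩ := hz
  refine Set.mem_iUnion.2 ⟨e, ?_⟩
  simpa only [Set.mem_union, Set.mem_ofPred_eq, one_mul, sub_eq_add_neg, add_assoc] using he

lemma countable_not_adm (hτ : 0 < τ.im) (β : ℂ) : {z | ¬ Adm τ β z}.Countable := by
  refine ((((((countable_not_gen hτ 0).union (countable_not_gen hτ β)).union
    (countable_not_gen hτ β2c)).union (countable_not_gen hτ (a3c τ))).union
    (countable_not_gen hτ (a3c τ + Real.pi / 2))).union
    (Set.countable_iUnion fun e : ℤ => countable_th1_zeros hτ two_ne_zero (e * ηc))).mono ?_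
  intro z hz
  by_contra hc
  simp only [Set.mem_union, Set.mem_ofPred_eq, Set.mem_iUnion, not_or, not_not, not_exists] at hc hz
  exact hz ⟨hc.1.1.1.1.1, hc.1.1.1.1.2, hc.1.1.1.2, hc.1.1.2, hc.1.2, hc.2⟩

lemma dense_good (hτ : 0 < τ.im) {β : ℂ} {s : List ℂ} (hs : GoodList τ β s) :
    Dense {z | GoodList τ β (z :: s)} := by
  have : ({z | ¬ Adm τ β z} ∪ ⋃ y ∈ {y | y ∈ s}, {z | ¬ Gen τ z y}).Countable :=
    (countable_not_adm hτ β).union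
      ((List.finite_toSet s).countable.biUnion fun y _ => countable_not_gen hτ y)
  refine (this.dense_compl ℂ).mono ?_
  intro z hz
  simp only [Set.mem_compl_iff, Set.mem_union, Set.mem_ofPred_eq, Set.mem_iUnion, not_or, not_not,
    not_exists] at hz
  refine ⟨?_, List.pairwise_cons.2 ⟨fun y hy => hz.2 y hy, hs.2⟩⟩
  simp only [List.mem_cons]
  rintro y (rfl | hy)
  · exact hz.1
  · exact hs.1 y hy

theorem eq_zero_of_forall_good (hτ : 0 < τ.im) (β : ℂ) {F : List ℂ → ℂ}
    (hF : ∀ l r, ContinuousOn (fun z => F (l ++ z :: r)) {z | Dth τ z ≠ 0}) {n : ℕ}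
    (hg : ∀ l, l.length = n → GoodList τ β l → F l = 0) {l : List ℂ} (hl : l.length = n)
    (hD : ∀ x ∈ l, Dth τ x ≠ 0) : F l = 0 := by
  have key (l : List ℂ) : ∀ s : List ℂ, l.length + s.length = n → (∀ x ∈ l, Dth τ x ≠ 0) →
      GoodList τ β s → F (l ++ s) = 0 := by
    induction l using List.reverseRecOn with
    | nil => exact fun s hs _ hgs => hg s (by simpa using hs) hgs
    | append_singleton l x ih =>
      intro s hs hD hgs
      rw [List.append_assoc, List.singleton_append]
      have hx : Dth τ x ≠ 0 := hD x (by simp)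
      have hopen : IsOpen {z | Dth τ z ≠ 0} :=
        isOpen_ne_fun (differentiable_Dth hτ).continuous continuous_const
      have hcl := (dense_good hτ hgs).open_subset_closure_inter hopen hx
      have hc : ContinuousWithinAt (fun z => F (l ++ z :: s))
          ({z | Dth τ z ≠ 0} ∩ {z | GoodList τ β (z :: s)}) x :=
        (hF l s x hx).mono Set.inter_subset_left
      have hm := hc.mem_closure hcl (t := {0}) fun z hz => ih (z :: s)
        (by simp at hs ⊢; omega) (fun y hy => hD y (by simp [hy])) hz.2
      simpa using hm
  simpa using key l [] (by simpa using hl) hD ⟨by simp, List.Pairwise.nil⟩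

lemma continuous_padded (n : ℕ) (A B : List ℂ) :
    Continuous fun v : ℂ => (padded (A ++ v :: B) : Fin n → ℂ) := by
  refine continuous_pi fun j => ?_
  simp only [padded]
  rcases lt_trichotomy (j : ℕ) A.length with hj | hj | hj
  · simp only [List.getD_append _ _ _ _ hj]
    fun_prop
  · have : (j : ℕ) - A.length = 0 := by omega
    simp only [List.getD_append_right _ _ _ _ hj.ge, this, List.getD_cons_zero]
    fun_prop
  · obtain ⟨i, hi⟩ := Nat.exists_eq_add_of_lt hj
    have : (j : ℕ) - A.length = i + 1 := by omega
    simp only [List.getD_append_right _ _ _ _ hj.le, this, List.getD_cons_succ]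
    fun_prop

lemma continuousOn_wfun (hτ : 0 < τ.im) : ContinuousOn (wfun τ) {z | Dth τ z ≠ 0} := by
  have : wfun τ = fun x => Kth τ * th1 x τ ^ 2 / Dth τ x := funext fun x => wfun_eq ..
  rw [this]
  exact (Continuous.continuousOn (((differentiable_th1 hτ).continuous.pow 2).const_smul (Kth τ))).div
    (differentiable_Dth hτ).continuous.continuousOn fun x hx => hx

lemma continuousOn_H (hτ : 0 < τ.im) (hH : IsHFamily (zet τ) Hz) (k : ℕ) (A l r : List ℂ) :
    ContinuousOn (fun z => Hz k (padded (A ++ (l ++ z :: r).map (wfun τ)))) {z | Dth τ z ≠ 0} := by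
  obtain ⟨P, hP⟩ := hH.2.1 k
  simp only [hP, List.map_append, List.map_cons, ← List.append_assoc]
  exact ((MvPolynomial.continuous_eval P).comp (continuous_padded _ _ _)).comp_continuousOn
    (continuousOn_wfun hτ)

lemma continuous_Zs (h : PsiSol τ Ψ) (l r : List ℂ) :
    Continuous fun z => Zs τ lam Ψ (l ++ z :: r) := by
  simp only [Zs, List.map_append, List.map_cons, List.prod_append, List.prod_cons]
  have h4 := (differentiable_th4 (two_mul_im_pos h.im_pos)).continuous
  have hZ := (differentiable_ZL h lam l r).continuous
  fun_prop

lemma continuous_Tth_mul_Dth_prod (hτ : 0 < τ.im) (n : ℕ) (l r : List ℂ) :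
    Continuous fun z => ((l ++ z :: r).map fun t => Tth τ t * Dth τ t ^ n).prod := by
  simp only [List.map_append, List.map_cons, List.prod_append, List.prod_cons, Tth]
  have h4 := (differentiable_th4 (two_mul_im_pos hτ)).continuous
  have hD := (differentiable_Dth hτ).continuous
  fun_prop

lemma wfun_zero (τ : ℂ) : wfun τ 0 = 0 := by simp [wfun, th1_zero]

lemma Dth_zero (τ : ℂ) : Dth τ 0 = -th1 ηc τ ^ 2 := by
  rw [Dth, zero_sub, zero_add, th1_neg]
  ring

lemma Dth_zero_ne (hτ : 0 < τ.im) : Dth τ 0 ≠ 0 := by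
  rw [Dth_zero]
  exact neg_ne_zero.2 (pow_ne_zero _ (th1_η_ne hτ))

lemma padded_append_replicate (n m : ℕ) (A : List ℂ) :
    (padded (A ++ List.replicate m 0) : Fin n → ℂ) = padded A := by
  funext j
  simp only [padded]
  rcases lt_or_ge (j : ℕ) A.length with hj | hj
  · rw [List.getD_append _ _ _ _ hj]
  · rw [List.getD_append_right _ _ _ _ hj, List.getD_eq_default _ _ hj]
    simp

lemma Zs_replicate_zero (n : ℕ) : Zs τ lam Ψ (List.replicate n 0)
    = ZL τ lam Ψ (List.replicate n 0) * th4 ηc (2 * τ) ^ n := by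
  simp [Zs]

lemma Tth_zero (τ : ℂ) : Tth τ 0 = th4 ηc (2 * τ) ^ 2 := by
  rw [Tth, mul_zero, zero_sub, zero_add, th4_neg]
  ring

lemma ZL_eq_of_forall_good (h : PsiSol τ Ψ) (hH : IsHFamily (zet τ) Hz) {n : ℕ} {C : ℂ} {β : ℂ}
    {k k' : ℕ} {A A' : List ℂ}
    (hg : ∀ l, l.length = n → GoodList τ β l → Zs τ lam Ψ l
      = C * (l.map fun t => Tth τ t * Dth τ t ^ n).prod
        * (Hz k (padded (A ++ l.map (wfun τ))) * Hz k' (padded (A' ++ l.map (wfun τ))))) :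
    ZL τ lam Ψ (List.replicate n 0) = C * (th4 ηc (2 * τ) * (-th1 ηc τ ^ 2) ^ n) ^ n
      * (Hz k (padded A) * Hz k' (padded A')) := by
  have hτ := h.im_pos
  have := eq_zero_of_forall_good hτ β (F := fun l => Zs τ lam Ψ l
      - C * (l.map fun t => Tth τ t * Dth τ t ^ n).prod
        * (Hz k (padded (A ++ l.map (wfun τ))) * Hz k' (padded (A' ++ l.map (wfun τ)))))
    (fun l r => (continuous_Zs h l r).continuousOn.sub
      ((continuous_const.mul (continuous_Tth_mul_Dth_prod hτ n l r)).continuousOn.mul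
        ((continuousOn_H hτ hH k A l r).mul (continuousOn_H hτ hH k' A' l r))))
    (fun l hl hgl => sub_eq_zero.2 (hg l hl hgl)) (l := List.replicate n 0) (by simp)
    (fun x hx => by
      rw [List.eq_of_mem_replicate hx]
      exact Dth_zero_ne hτ)
  simp only [List.map_replicate, wfun_zero, padded_append_replicate, List.prod_replicate, Tth_zero,
    Dth_zero, Zs_replicate_zero] at this
  have h4 := pow_ne_zero n (th4_η_ne (two_mul_im_pos hτ))
  refine mul_right_cancel₀ h4 ((sub_eq_zero.1 this).trans ?_)
  rw [pow_two, mul_assoc (th4 ηc (2 * τ)), mul_pow (th4 ηc (2 * τ))]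
  ring

end

/-! ### Evaluation of the constants -/

lemma norm_const_odd {θ t s : ℂ} (hθ : θ ≠ 0) (ht : t ≠ 0) (hs : s ≠ 0) (Y c : ℂ) (m : ℕ) :
    (-1 : ℂ) ^ ((2 * m + 1 + 1) / 2) * (θ ^ ((2 * m + 1) ^ 2))⁻¹
        * (s / t) ^ ((2 * m + 1) * (2 * m + 1 + 1) / 2)
      * (((t / s) ^ 2 / θ ^ 4) ^ (m * (m + 1)) * (-(2 * Y) / (t * s)) ^ m * c
        * (t * (-θ ^ 2) ^ (2 * m + 1)) ^ (2 * m + 1)) = (2 * Y) ^ m * (θ * s * c) := by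
  rw [show (2 * m + 1 + 1) / 2 = m + 1 by omega,
    show (2 * m + 1) * (2 * m + 1 + 1) / 2 = 2 * (m * (m + 1)) + (m + 1) by
      rw [show (2 * m + 1) * (2 * m + 1 + 1) = (2 * (m * (m + 1)) + (m + 1)) * 2 by ring]
      exact Nat.mul_div_cancel _ two_pos, mul_pow t, ← pow_mul,
    show (2 * m + 1) * (2 * m + 1) = 2 * (2 * (m * (m + 1))) + 1 by ring,
    show (2 * m + 1) ^ 2 = 4 * (m * (m + 1)) + 1 by ring, neg_pow (θ ^ 2),
    Odd.neg_one_pow ⟨_, rfl⟩, neg_div, neg_pow (2 * Y / (t * s))]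
  generalize m * (m + 1) = M
  have h1 : (-1 : ℂ) ^ m * (-1) ^ m = 1 := by rw [← mul_pow]; simp
  simp only [pow_succ, pow_mul, mul_pow, div_pow]
  field_simp
  linear_combination s * s ^ m * s ^ (M * 2) * t * t ^ m * t ^ (M * 2) * Y ^ m * c * h1

lemma norm_const_even {θ t s : ℂ} (hθ : θ ≠ 0) (ht : t ≠ 0) (hs : s ≠ 0) (Y : ℂ) (m : ℕ) :
    (-1 : ℂ) ^ ((2 * m + 1) / 2) * (θ ^ ((2 * m) ^ 2))⁻¹
        * (s / t) ^ ((2 * m) * (2 * m + 1) / 2)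
      * (((t / s) ^ 2 / θ ^ 4) ^ (m ^ 2) * (-(2 * Y) / (t * s)) ^ m
        * (t * (-θ ^ 2) ^ (2 * m)) ^ (2 * m)) = (2 * Y) ^ m := by
  rw [show (2 * m + 1) / 2 = m by omega,
    show (2 * m) * (2 * m + 1) / 2 = 2 * m ^ 2 + m by
      rw [show (2 * m) * (2 * m + 1) = (2 * m ^ 2 + m) * 2 by ring]
      exact Nat.mul_div_cancel _ two_pos, mul_pow t, ← pow_mul,
    show (2 * m) * (2 * m) = 2 * (2 * m ^ 2) by ring,
    show (2 * m) ^ 2 = 4 * m ^ 2 by ring, Even.neg_pow ⟨2 * m ^ 2, two_mul _⟩,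
    neg_div, neg_pow (2 * Y / (t * s))]
  generalize m ^ 2 = M
  have h1 : (-1 : ℂ) ^ m * (-1) ^ m = 1 := by rw [← mul_pow]; simp
  simp only [pow_mul, mul_pow, div_pow, pow_add]
  field_simp
  linear_combination Y ^ m * t ^ (m * 2) * θ ^ (M * 8) * h1

section
variable {τ lam : ℂ} {Ψ : PsiFam} {Hz : (k : ℕ) → (Fin (2 * k) → ℂ) → ℂ}

lemma detConst_zero (c : ℂ) (m : ℕ) : detConst τ lam c 0 m
    = (Kth τ ^ 2 / th1 ηc τ ^ 4) ^ (m * (m + 1))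
      * (th2 0 τ * th2 ηc τ * Dth τ (lam + ηc) / th4 0 (2 * τ) ^ 2) ^ m * c := by
  induction m with
  | zero => simp [detConst]
  | succ m ih =>
    rw [detConst, ih, kap]
    ring

lemma detConst_one (m : ℕ) : detConst τ lam (kap τ lam 0) 1 m
    = (Kth τ ^ 2 / th1 ηc τ ^ 4) ^ ((m + 1) ^ 2)
      * (th2 0 τ * th2 ηc τ * Dth τ (lam + ηc) / th4 0 (2 * τ) ^ 2) ^ (m + 1) := by
  induction m with
  | zero => simp [detConst, kap]
  | succ m ih =>
    rw [detConst, ih, kap]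
    ring

/-- The first weight at `x = 0`. -/
def fz (τ lam : ℂ) : ℂ := th1 lam (2 * τ) * th4 (lam + 2 * ηc) (2 * τ)
/-- The second weight at `x = 0`. -/
def gz (τ lam : ℂ) : ℂ := -(th1 (lam + 2 * ηc) (2 * τ) * th4 lam (2 * τ))

lemma kap_factor_eq (hτ : 0 < τ.im) :
    th2 0 τ * th2 ηc τ * Dth τ (lam + ηc) / th4 0 (2 * τ) ^ 2
      = -(2 * (fz τ lam * gz τ lam)) / (th4 ηc (2 * τ) * th4 0 (2 * τ)) := by
  have h0 := th4_zero_ne (two_mul_im_pos hτ)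
  have h1 := th4_η_ne (two_mul_im_pos hτ)
  have e1 := two_th1_mul_th4 hτ lam
  have e2 := two_th1_mul_th4 hτ (lam + 2 * ηc)
  have e3 := two_Kth_mul hτ
  have e4 : fz τ lam * gz τ lam = -(th2 0 τ ^ 2 * Dth τ (lam + ηc)) / 4 := by
    rw [fz, gz, Dth, show lam + ηc - ηc = lam by ring, show lam + ηc + ηc = lam + 2 * ηc by ring]
    linear_combination -(1/4 : ℂ) * (2 * (th1 lam (2 * τ) * th4 lam (2 * τ))) * e2
      - (1/4 : ℂ) * (th2 0 τ * th1 (lam + 2 * ηc) τ) * e1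
  rw [e4]
  rw [Kth] at e3
  field_simp at e3 ⊢
  linear_combination 2 * (th2 0 τ * Dth τ (lam + ηc)) * e3

lemma fz_add_gz (hτ : 0 < τ.im) : fz τ lam + gz τ lam = -(th1 ηc τ * th2 (lam + ηc) τ) := by
  have := chi_sum hτ 0 lam
  rw [zero_add, zero_sub, show -lam - 2 * ηc = -(lam + 2 * ηc) by ring, th4_neg, th1_neg,
    zero_sub, th1_neg] at this
  rw [fz, gz]
  linear_combination this

theorem Sfun_odd_generic (h : PsiSol τ Ψ) (hH : IsHFamily (zet τ) Hz)
    (hβ : Dth τ (lam + ηc) ≠ 0) (hββ : WSep τ β2c (lam + ηc)) (hf : fz τ lam ≠ 0) (m : ℕ) :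
    Sfun τ Ψ (2 * m + 1) (gz τ lam / fz τ lam)
      = (2 * (gz τ lam / fz τ lam)) ^ m * (gz τ lam / fz τ lam + 1)
        * Hz (m + 1) (padded [J2c]) * Hz (m + 1) (padded [wfun τ (lam + ηc)]) := by
  have hτ := h.im_pos
  have h0 := th4_zero_ne (two_mul_im_pos hτ)
  have hS := ZL_zero_eq_Sfun (τ := τ) Ψ (2 * m + 1) lam hf
  rw [ZL_eq_of_forall_good h hH (A := [J2c]) (A' := [wfun τ (lam + ηc)])
    fun l hl hg => Zs_odd h hH hβ hββ hl hg, detConst_zero, kap_factor_eq hτ] at hS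
  have hN := norm_const_odd (th1_η_ne hτ) (th4_η_ne (two_mul_im_pos hτ)) h0
    (fz τ lam * gz τ lam) (-(th2 (lam + ηc) τ / th4 0 (2 * τ))) m
  change _ = fz τ lam ^ (2 * m + 1) * Sfun τ Ψ (2 * m + 1) (gz τ lam / fz τ lam) at hS
  rw [Kth, Ncoef, ← mul_assoc, hN] at hS
  have e : th1 ηc τ * th4 0 (2 * τ) * -(th2 (lam + ηc) τ / th4 0 (2 * τ))
      = fz τ lam + gz τ lam := by
    rw [fz_add_gz hτ]
    field_simp
  rw [e] at hS
  refine mul_left_cancel₀ (pow_ne_zero (2 * m + 1) hf) (hS.symm.trans ?_)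
  rw [pow_succ, pow_mul]
  simp only [mul_pow, div_pow]
  field_simp
  ring

theorem Sfun_even_generic (h : PsiSol τ Ψ) (hH : IsHFamily (zet τ) Hz)
    (hβ : Dth τ (lam + ηc) ≠ 0) (hββ : WSep τ β2c (lam + ηc)) (hf : fz τ lam ≠ 0) (m : ℕ) :
    Sfun τ Ψ (2 * (m + 1)) (gz τ lam / fz τ lam)
      = (2 * (gz τ lam / fz τ lam)) ^ (m + 1) * Hz (m + 1) (padded [])
        * Hz (m + 2) (padded [J2c, wfun τ (lam + ηc)]) := by
  have hτ := h.im_pos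
  have h0 := th4_zero_ne (two_mul_im_pos hτ)
  have hS := ZL_zero_eq_Sfun (τ := τ) Ψ (2 * (m + 1)) lam hf
  rw [ZL_eq_of_forall_good h hH (n := 2 * (m + 1)) (A := [J2c, wfun τ (lam + ηc)]) (A' := [])
    fun l hl hg => Zs_even h hH hβ hββ hl hg, detConst_one, kap_factor_eq hτ] at hS
  have hN := norm_const_even (th1_η_ne hτ) (th4_η_ne (two_mul_im_pos hτ)) h0
    (fz τ lam * gz τ lam) (m + 1)
  change _ = fz τ lam ^ (2 * (m + 1)) * Sfun τ Ψ (2 * (m + 1)) (gz τ lam / fz τ lam) at hS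
  rw [Kth, Ncoef, ← mul_assoc, hN] at hS
  refine mul_left_cancel₀ (pow_ne_zero (2 * (m + 1)) hf) (hS.symm.trans ?_)
  rw [pow_mul]
  simp only [mul_pow, div_pow]
  field_simp
  ring

end

/-! ### From generic to arbitrary values of `μ` -/

section
variable {τ : ℂ} {Ψ : PsiFam} {Hz : (k : ℕ) → (Fin (2 * k) → ℂ) → ℂ}

lemma exists_polynomial_Sfun (τ : ℂ) (Ψ : PsiFam) (n : ℕ) :
    ∃ s : Polynomial ℂ, s.natDegree ≤ n ∧ ∀ μ, Sfun τ Ψ n μ = s.eval μ := by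
  refine ⟨∑ α : Fin (2 * n + 1) → Fin 2,
    (∏ m : Fin n,
      (if α ⟨2*(m:ℕ), by have := m.2; omega⟩ = 0 ∧ α ⟨2*(m:ℕ)+1, by have := m.2; omega⟩ = 1
        then (1 : Polynomial ℂ)
       else if α ⟨2*(m:ℕ), by have := m.2; omega⟩ = 1 ∧ α ⟨2*(m:ℕ)+1, by have := m.2; omega⟩ = 0
        then Polynomial.X
       else 0))
      * Polynomial.C ((if α ⟨2*n, by omega⟩ = 0 then (1:ℂ) else 0) * psiH τ Ψ n α), ?_, ?_⟩
  · refine Polynomial.natDegree_sum_le_of_forall_le _ _ fun α _ => ?_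
    refine (Polynomial.natDegree_mul_C_le _ _).trans ((Polynomial.natDegree_prod_le _ _).trans ?_)
    calc _ ≤ ∑ _m : Fin n, 1 := Finset.sum_le_sum fun m _ => by
            split_ifs <;> simp
      _ = n := by simp
  · intro μ
    simp only [Sfun, Polynomial.eval_finsetSum, Polynomial.eval_mul, Polynomial.eval_prod,
      Polynomial.eval_C, mul_assoc]
    refine Finset.sum_congr rfl fun α _ => ?_
    congr 1
    refine Finset.prod_congr rfl fun m _ => ?_
    split_ifs <;> simp

lemma fz_zero (τ : ℂ) : fz τ 0 = 0 := by
  simp [fz, th1_zero]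

lemma gz_zero_ne (hτ : 0 < τ.im) : gz τ 0 ≠ 0 := by
  have h1 := th1_rat_ne_zero (two_mul_im_pos hτ) (2 / 3) fun n h => by
    have h3 : (2 : ℚ) = ((3 * n : ℤ) : ℚ) := by push_cast; linear_combination 3 * h
    have : (2 : ℤ) = 3 * n := by exact_mod_cast h3
    omega
  rw [show (((2 / 3 : ℚ) : ℂ) * Real.pi) = 0 + 2 * ηc by rw [ηc]; push_cast; ring] at h1
  rw [gz]
  exact neg_ne_zero.2 (mul_ne_zero h1 (th4_zero_ne (two_mul_im_pos hτ)))

lemma infinite_ratio (hτ : 0 < τ.im) :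
    {v : ℂ | v ≠ 0 ∧ ∃ lam, Dth τ (lam + ηc) ≠ 0 ∧ WSep τ β2c (lam + ηc) ∧ fz τ lam ≠ 0 ∧
      v = gz τ lam / fz τ lam}.Infinite := by
  have hdf : Differentiable ℂ (fz τ) := by
    have h1 := differentiable_th1 (two_mul_im_pos hτ)
    have h4 := differentiable_th4 (two_mul_im_pos hτ)
    unfold fz
    fun_prop
  have hdg : Differentiable ℂ (gz τ) := by
    have h1 := differentiable_th1 (two_mul_im_pos hτ)
    have h4 := differentiable_th4 (two_mul_im_pos hτ)
    unfold gz
    fun_prop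
  intro hfin
  have hcount : ({lam : ℂ | Dth τ (lam + ηc) = 0} ∪ {lam | ¬ WSep τ β2c (lam + ηc)} ∪
      {lam | fz τ lam = 0} ∪ {lam | gz τ lam = 0} ∪
      ⋃ v ∈ {v : ℂ | v ≠ 0 ∧ ∃ lam, Dth τ (lam + ηc) ≠ 0 ∧ WSep τ β2c (lam + ηc) ∧
        fz τ lam ≠ 0 ∧ v = gz τ lam / fz τ lam}, {lam | gz τ lam - v * fz τ lam = 0}).Countable := by
    refine Set.Countable.union (Set.Countable.union (Set.Countable.union
      (Set.Countable.union ?_ ?_) ?_) ?_) ?_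
    · refine countable_zeros (z := -ηc) (f := fun lam => Dth τ (lam + ηc))
        ((differentiable_Dth hτ).comp (differentiable_id.add_const ηc)) ?_
      simpa using Dth_zero_ne hτ
    · refine ((countable_th1_zeros hτ (neg_ne_zero.2 one_ne_zero) (β2c - ηc)).union
        (countable_th1_zeros hτ one_ne_zero (β2c + ηc))).mono fun lam hl => ?_
      by_contra hc
      simp only [Set.mem_union, Set.mem_ofPred_eq, not_or] at hc hl
      refine hl ⟨?_, ?_⟩
      · convert hc.1 using 2; ring_nf
      · convert hc.2 using 2; ring_nf
    · refine countable_zeros (z := ηc) hdf (mul_ne_zero (th1_η_ne (two_mul_im_pos hτ))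
        (th4_real_ne_zero (two_mul_im_pos hτ) ?_))
      rw [ηc, show (Real.pi : ℂ) / 3 + 2 * (Real.pi / 3) = (Real.pi : ℂ) by ring]
      exact Complex.ofReal_im _
    · exact countable_zeros hdg (gz_zero_ne hτ)
    · refine hfin.countable.biUnion fun v _ => ?_
      refine countable_zeros (z := 0) (hdg.sub (hdf.const_mul v)) ?_
      simpa [fz_zero] using gz_zero_ne hτ
  obtain ⟨lam, hlam⟩ := (hcount.dense_compl ℂ).nonempty
  refine hlam ?_
  simp only [Set.mem_union, Set.mem_ofPred_eq, Set.mem_iUnion]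
  by_contra! hc
  obtain ⟨⟨⟨⟨h1, h2⟩, h3⟩, h4⟩, h5⟩ := hc
  refine h5 (gz τ lam / fz τ lam) ⟨div_ne_zero h4 h3, lam, h1, h2, h3, rfl⟩ ?_
  rw [div_mul_cancel₀ _ h3, sub_self]

lemma exists_clear (c : ℂ) (p : Polynomial ℂ) :
    ∃ (N : ℕ) (q : Polynomial ℂ), ∀ μ : ℂ, μ ≠ 0 →
      p.eval ((μ - 1) ^ 2 / (c * μ)) * μ ^ N = q.eval μ := by
  refine ⟨p.natDegree, ∑ i ∈ Finset.range (p.natDegree + 1),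
    Polynomial.C (p.coeff i * c⁻¹ ^ i) * ((Polynomial.X - 1) ^ 2) ^ i
      * Polynomial.X ^ (p.natDegree - i), fun μ hμ => ?_⟩
  rw [Polynomial.eval_eq_sum_range, Finset.sum_mul, Polynomial.eval_finsetSum]
  refine Finset.sum_congr rfl fun i hi => ?_
  have hi : i ≤ p.natDegree := by simpa [Nat.lt_succ_iff] using hi
  simp only [Polynomial.eval_mul, Polynomial.eval_C, Polynomial.eval_pow, Polynomial.eval_sub,
    Polynomial.eval_X, Polynomial.eval_one]
  rw [← Nat.sub_add_cancel hi, pow_add, Nat.sub_add_cancel hi, div_eq_mul_inv, mul_inv]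
  simp only [mul_pow, inv_pow]
  field_simp

lemma exists_polynomial_H_padded (hH : IsHFamily (zet τ) Hz) (k : ℕ) (A : List ℂ) :
    ∃ p : Polynomial ℂ, ∀ v, Hz k (padded (A ++ [v])) = p.eval v := by
  obtain ⟨P, hP⟩ := hH.2.1 k
  refine ⟨MvPolynomial.aeval (fun j : Fin (2 * k) => (A.map Polynomial.C ++ [Polynomial.X]).getD
    (j : ℕ) 0) P, fun v => ?_⟩
  rw [eval_aeval_polynomial, hP]
  congr 2
  funext j
  have : ∀ (B : List (Polynomial ℂ)) (i : ℕ), (B.getD i 0).eval v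
      = (B.map fun b => b.eval v).getD i 0 := by
    intro B i
    rw [show (0 : ℂ) = (0 : Polynomial ℂ).eval v by simp, List.getD_map]
  rw [this, padded]
  simp [Function.comp_def]

lemma eq_of_forall_ratio (hτ : 0 < τ.im) (hH : IsHFamily (zet τ) Hz) {F : ℂ → ℂ}
    {s r : Polynomial ℂ} (hs : ∀ μ, F μ = s.eval μ) (k : ℕ) (A : List ℂ)
    (hg : ∀ lam, Dth τ (lam + ηc) ≠ 0 → WSep τ β2c (lam + ηc) → fz τ lam ≠ 0 →
      F (gz τ lam / fz τ lam) = r.eval (gz τ lam / fz τ lam)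
        * Hz k (padded (A ++ [wfun τ (lam + ηc)]))) {μ : ℂ} (hμ : μ ≠ 0) :
    F μ = r.eval μ * Hz k (padded (A ++ [mubar (zet τ) μ])) := by
  obtain ⟨p, hp⟩ := exists_polynomial_H_padded hH k A
  obtain ⟨N, q, hq⟩ := exists_clear (zet τ ^ 2 - 1) p
  have key : s * Polynomial.X ^ N - r * q = 0 := by
    refine Polynomial.eq_zero_of_infinite_isRoot _ ((infinite_ratio hτ).mono ?_)
    rintro v ⟨hv, lam, h1, h2, h3, rfl⟩
    have hgz : gz τ lam ≠ 0 := fun h => hv (by simp [h])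
    have hw : mubar (zet τ) (gz τ lam / fz τ lam) = wfun τ (lam + ηc) :=
      mubar_eq_wfun hτ h3 (by simpa [gz] using hgz)
    have := hg lam h1 h2 h3
    rw [← hw, hp, hs] at this
    simp only [Set.mem_ofPred_eq, Polynomial.IsRoot.def, Polynomial.eval_sub, Polynomial.eval_mul,
      Polynomial.eval_pow, Polynomial.eval_X]
    rw [this, ← hq _ hv, mubar]
    ring
  have h1 := congrArg (Polynomial.eval μ) key
  simp only [Polynomial.eval_sub, Polynomial.eval_mul, Polynomial.eval_pow, Polynomial.eval_X,
    Polynomial.eval_zero, ← hq μ hμ] at h1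
  rw [hs, hp, mubar]
  refine mul_right_cancel₀ (pow_ne_zero N hμ) ?_
  linear_combination h1

theorem Sfun_odd (h : PsiSol τ Ψ) (hH : IsHFamily (zet τ) Hz) (k : ℕ) {μ : ℂ} (hμ : μ ≠ 0) :
    Sfun τ Ψ (2 * k + 1) μ = (2 * μ) ^ k * (μ + 1) * Hz (k + 1) (padded [J2c])
      * Hz (k + 1) (padded [mubar (zet τ) μ]) := by
  obtain ⟨s, -, hs⟩ := exists_polynomial_Sfun τ Ψ (2 * k + 1)
  have := eq_of_forall_ratio h.im_pos hH hs (k + 1) [] (μ := μ)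
    (r := (Polynomial.C 2 * Polynomial.X) ^ k * (Polynomial.X + 1)
      * Polynomial.C (Hz (k + 1) (padded [J2c]))) ?_ hμ
  · simpa using this
  · intro lam h1 h2 h3
    simpa using Sfun_odd_generic h hH h1 h2 h3 k

lemma Sfun_zero (h : PsiSol τ Ψ) (μ : ℂ) : Sfun τ Ψ 0 μ = 1 := by
  have h0 : ∀ α, psiH τ Ψ 0 α = 1 := fun α => by simp [psiH, Ncoef, h.zero _ α]
  simp only [Sfun, h0]
  rw [Fintype.sum_eq_single (fun _ => 0)]
  · simp
  · intro α hα
    have : α ⟨0, by omega⟩ ≠ 0 := fun h => hα (funext fun i => by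
      rw [← h]; congr 1; exact Subsingleton.elim (α := Fin 1) _ _)
    simpa using this

theorem Sfun_even (h : PsiSol τ Ψ) (hH : IsHFamily (zet τ) Hz) (k : ℕ) {μ : ℂ} (hμ : μ ≠ 0) :
    Sfun τ Ψ (2 * k) μ = (2 * μ) ^ k * Hz k (fun _ => 0)
      * Hz (k + 1) (padded [J2c, mubar (zet τ) μ]) := by
  cases k with
  | zero => rw [H_one hH, hH.1]; simpa using Sfun_zero h μ
  | succ k =>
    obtain ⟨s, -, hs⟩ := exists_polynomial_Sfun τ Ψ (2 * (k + 1))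
    have := eq_of_forall_ratio h.im_pos hH hs (k + 2) [J2c] (μ := μ)
      (r := (Polynomial.C 2 * Polynomial.X) ^ (k + 1) * Polynomial.C (Hz (k + 1) fun _ => 0)) ?_ hμ
    · simpa using this
    · intro lam h1 h2 h3
      have hp : (padded [] : Fin (2 * (k + 1)) → ℂ) = fun _ => 0 := by funext; simp [padded]
      simpa [hp] using Sfun_even_generic h hH h1 h2 h3 k

end

/-! ### Polynomial dependence on `ζ` -/

section

/-- Concatenation of two tuples of length `k`. -/
def joinH {R : Type*} {k : ℕ} (f g : Fin k → R) : Fin (2 * k) → R := fun i =>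
  if h : (i : ℕ) < k then f ⟨i, h⟩ else g ⟨i - k, by have := i.2; omega⟩

lemma firstHalf_joinH {k : ℕ} (f g : Fin k → ℂ) : firstHalf (joinH f g) = f := by
  funext i; simp [firstHalf, joinH]

lemma secondHalf_joinH {k : ℕ} (f g : Fin k → ℂ) : secondHalf (joinH f g) = g := by
  funext i; simp [secondHalf, joinH]

lemma joinH_halves {k : ℕ} (w : Fin (2 * k) → ℂ) : joinH (firstHalf w) (secondHalf w) = w := by
  funext i
  by_cases h : (i : ℕ) < k
  · simp [firstHalf, joinH, h]
  · have : k + ((i : ℕ) - k) = i := by omega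
    simp [secondHalf, joinH, h, this]

lemma comp_joinH {R R' : Type*} {k : ℕ} (φ : R → R') (f g : Fin k → R) (i : Fin (2 * k)) :
    φ (joinH f g i) = joinH (fun i => φ (f i)) (fun i => φ (g i)) i := by
  simp only [joinH]; split_ifs <;> rfl

/-- Evaluation of a polynomial in `t` with coefficients polynomial in `ζ`. -/
def biEval (ζ t : ℂ) : Polynomial (Polynomial ℂ) →+* ℂ :=
  (Polynomial.evalRingHom t).comp (Polynomial.mapRingHom (Polynomial.evalRingHom ζ))

/-- `F ζ t` is polynomial in `t` and `ζ`, with a nonzero constant as leading coefficient in `t`. -/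
def HasConstLead (F : ℂ → ℂ → ℂ) : Prop :=
  ∃ C : ℂ, C ≠ 0 ∧ ∃ P : Polynomial (Polynomial ℂ), P.Monic ∧ ∀ ζ t, F ζ t = C * biEval ζ t P

lemma HasConstLead.mul {F G : ℂ → ℂ → ℂ} (hF : HasConstLead F) (hG : HasConstLead G) :
    HasConstLead fun ζ t => F ζ t * G ζ t := by
  obtain ⟨C, hC, P, hP, h⟩ := hF
  obtain ⟨C', hC', P', hP', h'⟩ := hG
  refine ⟨C * C', mul_ne_zero hC hC', P * P', hP.mul hP', fun ζ t => ?_⟩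
  beta_reduce
  rw [h, h', map_mul]; ring

lemma HasConstLead.one : HasConstLead fun _ _ => 1 :=
  ⟨1, one_ne_zero, 1, Polynomial.monic_one, fun ζ t => by simp⟩

lemma HasConstLead.prod {ι : Type*} (s : Finset ι) {F : ι → ℂ → ℂ → ℂ}
    (hF : ∀ i ∈ s, HasConstLead (F i)) : HasConstLead fun ζ t => ∏ i ∈ s, F i ζ t := by
  classical
  induction s using Finset.induction_on with
  | empty => simpa using HasConstLead.one
  | insert a s ha ih =>
    simp only [Finset.prod_insert ha]
    exact (hF a (by simp)).mul (ih fun i hi => hF i (by simp [hi]))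

lemma HasConstLead.linear {b : ℂ} (hb : b ≠ 0) (a : ℂ) : HasConstLead fun _ t => a + b * t := by
  refine ⟨b, hb, Polynomial.X + Polynomial.C (Polynomial.C (a / b)), Polynomial.monic_X_add_C _,
    fun ζ t => ?_⟩
  simp [biEval]
  field_simp
  ring

lemma HasConstLead.quadratic (a b W : ℂ) :
    HasConstLead fun ζ t => (ζ ^ 2 - 1) * (a + b * t) - (W + t ^ 2) := by
  refine ⟨-1, by simp, Polynomial.X ^ 2
    + (Polynomial.C (Polynomial.C (-b) * (Polynomial.X ^ 2 - 1)) * Polynomial.X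
      + Polynomial.C (Polynomial.C W - Polynomial.C a * (Polynomial.X ^ 2 - 1))),
    Polynomial.monic_X_pow_add Polynomial.degree_linear_lt, fun ζ t => ?_⟩
  simp [biEval]
  ring

lemma HasConstLead.vdm {k : ℕ} (a : Fin k → ℂ) :
    HasConstLead fun _ t => vdm fun i : Fin k => a i + ((i : ℕ) : ℂ) * t := by
  refine HasConstLead.prod _ fun i _ => HasConstLead.prod _ fun j _ => ?_
  by_cases hij : i < j
  · have hb : (((j : ℕ) : ℂ) - ((i : ℕ) : ℂ)) ≠ 0 := by
      rw [sub_ne_zero, Ne, Nat.cast_inj]; exact fun h => hij.ne' (Fin.ext h)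
    have := HasConstLead.linear hb (a j - a i)
    simp only [hij, if_true]
    convert this using 3
    ring
  · simpa [hij] using HasConstLead.one

/-- A function that is polynomial in `t` and a quotient by a polynomial with constant leading
coefficient depends polynomially on the parameter. -/
theorem exists_polynomial_at_zero {S : Set ℂ} {f F : ℂ → ℂ → ℂ}
    (hf : ∀ ζ ∈ S, ∃ p : Polynomial ℂ, ∀ t, f ζ t = p.eval t) (hF : HasConstLead F)
    {N : (Fin 2 → ℂ) → ℂ} (hN : IsPolyFun N) (h : ∀ ζ ∈ S, ∀ t, f ζ t * F ζ t = N ![ζ, t]) :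
    ∃ q : Polynomial ℂ, ∀ ζ ∈ S, f ζ 0 = q.eval ζ := by
  obtain ⟨C, hC, P, hP, hFP⟩ := hF
  obtain ⟨Q, hQ⟩ := (IsPolyFun.const C⁻¹).mul hN
  let R : Polynomial (Polynomial ℂ) :=
    MvPolynomial.eval₂ (Polynomial.C.comp Polynomial.C) ![Polynomial.C Polynomial.X, Polynomial.X] Q
  have hR : ∀ ζ t, biEval ζ t R = C⁻¹ * N ![ζ, t] := by
    intro ζ t
    refine Eq.trans ?_ (hQ ![ζ, t]).symm
    simp only [R]
    rw [MvPolynomial.hom_eval₂, ← MvPolynomial.coe_eval₂Hom, MvPolynomial.eval]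
    congr 2
    · ext x; simp [biEval]
    · funext i; fin_cases i <;> simp [biEval]
  refine ⟨(R /ₘ P).eval 0, fun ζ hζ => ?_⟩
  obtain ⟨p, hp⟩ := hf ζ hζ
  have key : p * P.map (Polynomial.evalRingHom ζ) = R.map (Polynomial.evalRingHom ζ) := by
    refine Polynomial.funext fun t => ?_
    have h1 := h ζ hζ t
    rw [hFP, hp] at h1
    have h2 := hR ζ t
    rw [← h1] at h2
    rw [Polynomial.eval_mul]
    change p.eval t * biEval ζ t P = biEval ζ t R
    rw [h2]
    field_simp
  have h3 : (R /ₘ P).map (Polynomial.evalRingHom ζ) = p := by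
    rw [Polynomial.map_divByMonic _ hP, ← key, mul_comm,
      Polynomial.mul_divByMonic_cancel_left _ (hP.map _)]
  rw [hp, ← h3, ← Polynomial.coe_evalRingHom ζ, Polynomial.eval_map]
  simp [Polynomial.eval₂_at_zero, ← Polynomial.coeff_zero_eq_eval_zero]

end

section
variable {H : ℂ → (k : ℕ) → (Fin (2 * k) → ℂ) → ℂ}

lemma exists_polynomial_H_joinH {ζ : ℂ} {Hz : (k : ℕ) → (Fin (2 * k) → ℂ) → ℂ}
    (hH : IsHFamily ζ Hz) {k : ℕ} (f g : Fin k → Polynomial ℂ) :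
    ∃ p : Polynomial ℂ, ∀ t, Hz k (joinH (fun i => (f i).eval t) fun i => (g i).eval t)
      = p.eval t := by
  obtain ⟨P, hP⟩ := hH.2.1 k
  refine ⟨MvPolynomial.aeval (joinH f g) P, fun t => ?_⟩
  rw [eval_aeval_polynomial, hP]
  congr 2
  funext i
  rw [comp_joinH (Polynomial.eval t)]

theorem H_polynomial_param (hH : ∀ ζ, IsHFamily ζ (H ζ)) (k : ℕ) (w : Fin (2 * k) → ℂ) :
    ∃ q : Polynomial ℂ, ∀ ζ, H ζ k w = q.eval ζ := by
  have hex := exists_polynomial_at_zero (S := Set.univ)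
    (f := fun ζ t => H ζ k (joinH (fun i => firstHalf w i + ((i : ℕ) : ℂ) * t)
      fun i => secondHalf w i + ((i : ℕ) : ℂ) * t))
    (N := fun v => (Nmat (v 0) (fun i => firstHalf w i + ((i : ℕ) : ℂ) * v 1)
      fun i => secondHalf w i + ((i : ℕ) : ℂ) * v 1).det)
    (fun ζ _ => ?_) ((HasConstLead.vdm (firstHalf w)).mul (HasConstLead.vdm (secondHalf w)))
    (isPolyFun_det_Nmat (.var 0) (fun i => (IsPolyFun.const _).add ((IsPolyFun.const _).mul (.var 1)))
      fun i => (IsPolyFun.const _).add ((IsPolyFun.const _).mul (.var 1)))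
    (fun ζ _ t => ?_)
  · obtain ⟨q, hq⟩ := hex
    refine ⟨q, fun ζ => ?_⟩
    rw [← hq ζ (Set.mem_univ _)]
    simp [joinH_halves]
  · obtain ⟨p, hp⟩ := exists_polynomial_H_joinH (hH ζ)
      (fun i => Polynomial.C (firstHalf w i) + Polynomial.C ((i : ℕ) : ℂ) * Polynomial.X)
      (fun i => Polynomial.C (secondHalf w i) + Polynomial.C ((i : ℕ) : ℂ) * Polynomial.X)
    exact ⟨p, fun t => by rw [← hp]; simp⟩
  · have := H_mul_vdm (hH ζ) k (joinH (fun i => firstHalf w i + ((i : ℕ) : ℂ) * t)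
      fun i => secondHalf w i + ((i : ℕ) : ℂ) * t)
    rw [firstHalf_joinH, secondHalf_joinH] at this
    simpa using this

/-- Clearing the denominators of `det Nmat` in the first row. -/
lemma det_Nmat_cons_div {ζ c : ℂ} (hc : c ≠ 0) (hζ : c = ζ ^ 2 - 1) {k : ℕ} (U : ℂ)
    (f : Fin k → ℂ) (g : Fin (k + 1) → ℂ) :
    c ^ k * (Nmat ζ (Fin.cons (U / c) f : Fin (k + 1) → ℂ) g).det
      = Matrix.det (Matrix.of fun i j : Fin (k + 1) => (Fin.cons
          (∏ l ∈ Finset.univ.erase j, (c - (3 + ζ ^ 2) * U * g l - U * g l * (U + c * g l)))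
          (fun i' => ∏ l ∈ Finset.univ.erase j, hpol ζ (f i') (g l)) : Fin (k + 1) → ℂ) i) := by
  have hd : c ^ k = ∏ i, (Fin.cons (c ^ k) (fun _ => 1) : Fin (k + 1) → ℂ) i := by
    simp [Fin.prod_univ_succ]
  rw [hd, ← Matrix.det_mul_column]
  congr 1
  ext i j
  refine Fin.cases ?_ (fun i' => ?_) i
  · have hcard : (Finset.univ.erase j).card = k := by simp
    simp only [Matrix.of_apply, Fin.cons_zero, Nmat]
    nth_rewrite 1 [← hcard]
    rw [← Finset.prod_const, ← Finset.prod_mul_distrib]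
    refine Finset.prod_congr rfl fun l _ => ?_
    rw [hpol, show 1 - ζ ^ 2 = -c by rw [hζ]; ring]
    field_simp
    ring
  · simp [Nmat]

theorem H_polynomial_param_div (hH : ∀ ζ, IsHFamily ζ (H ζ)) {k : ℕ} (a : Fin k → ℂ)
    (b : Fin (k + 1) → ℂ) (W : ℂ) :
    ∃ q : Polynomial ℂ, ∀ ζ, ζ ^ 2 - 1 ≠ 0 →
      H ζ (k + 1) (joinH (Fin.cons (W / (ζ ^ 2 - 1)) a) b) = q.eval ζ := by
  have hex := exists_polynomial_at_zero (S := {ζ | ζ ^ 2 - 1 ≠ 0})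
    (f := fun ζ t => H ζ (k + 1) (joinH
      (Fin.cons ((W + t ^ 2) / (ζ ^ 2 - 1)) fun i => a i + ((i : ℕ) : ℂ) * t)
      fun i => b i + ((i : ℕ) : ℂ) * t))
    (N := fun v => Matrix.det (Matrix.of fun i j : Fin (k + 1) => (Fin.cons
      (fun v : Fin 2 → ℂ => ∏ l ∈ Finset.univ.erase j, ((v 0 ^ 2 - 1) - (3 + v 0 ^ 2) * (W + v 1 ^ 2)
        * (b l + ((l : ℕ) : ℂ) * v 1) - (W + v 1 ^ 2) * (b l + ((l : ℕ) : ℂ) * v 1)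
          * ((W + v 1 ^ 2) + (v 0 ^ 2 - 1) * (b l + ((l : ℕ) : ℂ) * v 1))))
      (fun i' v => ∏ l ∈ Finset.univ.erase j, hpol (v 0) (a i' + ((i' : ℕ) : ℂ) * v 1)
        (b l + ((l : ℕ) : ℂ) * v 1)) : Fin (k + 1) → (Fin 2 → ℂ) → ℂ) i v))
    (fun ζ _ => ?_)
    (((HasConstLead.prod Finset.univ fun i _ => HasConstLead.quadratic (a i) ((i : ℕ) : ℂ) W).mul
      (HasConstLead.vdm a)).mul (HasConstLead.vdm b))
    (IsPolyFun.det fun i j => ?_)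
    (fun ζ hζ t => ?_)
  · obtain ⟨q, hq⟩ := hex
    refine ⟨q, fun ζ hζ => ?_⟩
    rw [← hq ζ hζ]
    simp
  · obtain ⟨p, hp⟩ := exists_polynomial_H_joinH (hH ζ)
      (Fin.cons (Polynomial.C (ζ ^ 2 - 1)⁻¹ * (Polynomial.C W + Polynomial.X ^ 2))
        (fun i : Fin k => Polynomial.C (a i) + Polynomial.C ((i : ℕ) : ℂ) * Polynomial.X))
      (fun i => Polynomial.C (b i) + Polynomial.C ((i : ℕ) : ℂ) * Polynomial.X)
    refine ⟨p, fun t => ?_⟩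
    rw [← hp]
    congr 2
    · funext i
      refine Fin.cases ?_ (fun i' => ?_) i
      · simp [div_eq_inv_mul]
      · simp
    · simp
  · have hl (l : Fin (k + 1)) : IsPolyFun fun v : Fin 2 → ℂ => b l + ((l : ℕ) : ℂ) * v 1 :=
      (IsPolyFun.const _).add ((IsPolyFun.const _).mul (.var 1))
    have hU : IsPolyFun fun v : Fin 2 → ℂ => W + v 1 ^ 2 :=
      (IsPolyFun.const _).add ((IsPolyFun.var 1).pow 2)
    have hz : IsPolyFun fun v : Fin 2 → ℂ => v 0 ^ 2 := (IsPolyFun.var 0).pow 2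
    have hc : IsPolyFun fun v : Fin 2 → ℂ => v 0 ^ 2 - 1 := hz.sub (.const 1)
    refine Fin.cases ?_ (fun i' => ?_) i
    · simp only [Fin.cons_zero]
      exact IsPolyFun.prod _ fun l _ => (hc.sub ((((IsPolyFun.const 3).add hz).mul hU).mul (hl l))).sub
        ((hU.mul (hl l)).mul (hU.add (hc.mul (hl l))))
    · simp only [Fin.cons_succ]
      exact IsPolyFun.prod _ fun l _ => isPolyFun_hpol (.var 0)
        ((IsPolyFun.const _).add ((IsPolyFun.const _).mul (.var 1))) (hl l)
  · have h1 := H_mul_vdm (hH ζ) (k + 1) (joinH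
      (Fin.cons ((W + t ^ 2) / (ζ ^ 2 - 1)) fun i => a i + ((i : ℕ) : ℂ) * t)
      fun i => b i + ((i : ℕ) : ℂ) * t)
    rw [firstHalf_joinH, secondHalf_joinH, vdm_cons] at h1
    have h2 := det_Nmat_cons_div hζ rfl (W + t ^ 2) (fun i => a i + ((i : ℕ) : ℂ) * t)
      fun i => b i + ((i : ℕ) : ℂ) * t
    rw [← h1] at h2
    have h3 : ∏ i : Fin k, ((ζ ^ 2 - 1) * (a i + ((i : ℕ) : ℂ) * t) - (W + t ^ 2))
        = (ζ ^ 2 - 1) ^ k * ∏ i : Fin k, (a i + ((i : ℕ) : ℂ) * t - (W + t ^ 2) / (ζ ^ 2 - 1)) := by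
      rw [← Fin.prod_const k (ζ ^ 2 - 1), ← Finset.prod_mul_distrib]
      refine Finset.prod_congr rfl fun i _ => ?_
      have : ζ ^ 2 - 1 ≠ 0 := hζ
      field_simp
    rw [h3]
    have h4 : ∀ (i : Fin (k + 1)) (x : (Fin 2 → ℂ) → ℂ) (y : Fin k → (Fin 2 → ℂ) → ℂ) v,
        (Fin.cons x y : Fin (k + 1) → (Fin 2 → ℂ) → ℂ) i v
          = (Fin.cons (x v) fun i => y i v : Fin (k + 1) → ℂ) i := by
      intro i x y v
      refine Fin.cases ?_ (fun i' => ?_) i <;> simp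
    simp only [h4, Matrix.cons_val_zero, Matrix.cons_val_one]
    rw [← h2]
    ring

/-- Invariance of `H` under permutations of the first half of the variables. -/
lemma H_joinH_comp_perm {ζ : ℂ} {Hz : (k : ℕ) → (Fin (2 * k) → ℂ) → ℂ} (hH : IsHFamily ζ Hz)
    {k : ℕ} (σ : Equiv.Perm (Fin k)) (f g : Fin k → ℂ) :
    Hz k (joinH (f ∘ σ) g) = Hz k (joinH f g) := by
  have hH' : IsPolyFun (Hz k) := hH.2.1 k
  have hv (i : Fin k) : IsPolyFun fun w : Fin (2 * k) → ℂ => firstHalf w i := .var _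
  have hv' (i : Fin k) : IsPolyFun fun w : Fin (2 * k) → ℂ => secondHalf w i := .var _
  have hj (i : Fin (2 * k)) : IsPolyFun fun w : Fin (2 * k) → ℂ =>
      joinH (firstHalf w ∘ σ) (secondHalf w) i := by
    simp only [joinH]
    split_ifs
    · exact hv _
    · exact hv' _
  have := ((hH'.comp hj).sub hH').eq_zero_or_eq_zero
    ((isPolyFun_vdm hv).mul (isPolyFun_vdm hv')) fun w => ?_
  · rcases this with h | h
    · have := h (joinH f g)
      rw [firstHalf_joinH, secondHalf_joinH] at this
      exact sub_eq_zero.1 this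
    · refine absurd (h (joinH (fun i => ((i : ℕ) : ℂ)) fun i => ((i : ℕ) : ℂ))) ?_
      have hi : Function.Injective fun i : Fin k => ((i : ℕ) : ℂ) := fun i j hij =>
        Fin.ext (by simpa using hij)
      rw [firstHalf_joinH, secondHalf_joinH]
      exact mul_ne_zero (vdm_ne_zero hi) (vdm_ne_zero hi)
  · have h1 := H_mul_vdm hH k w
    have h2 := H_mul_vdm hH k (joinH (firstHalf w ∘ σ) (secondHalf w))
    rw [firstHalf_joinH, secondHalf_joinH, vdm_comp_perm] at h2
    have h3 := det_Nmat_comp_perm (ζ := ζ) (firstHalf w) (secondHalf w) σ 1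
    simp only [Equiv.Perm.coe_one, Function.comp_id, Equiv.Perm.sign_one, Units.val_one,
      Int.cast_one, one_mul] at h3
    rw [h3] at h2
    have hs : ((Equiv.Perm.sign σ : ℤ) : ℂ) ≠ 0 := by
      rcases Int.units_eq_one_or (Equiv.Perm.sign σ) with h | h <;> simp [h]
    refine mul_left_cancel₀ hs ?_
    linear_combination h2 - ((Equiv.Perm.sign σ : ℤ) : ℂ) * h1

end

section
variable {H : ℂ → (k : ℕ) → (Fin (2 * k) → ℂ) → ℂ}

/-- Lagrange interpolation in `μ` reduces joint polynomiality to polynomiality in `ζ`. -/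
lemma exists_joint_polynomial {T : Set ℂ} {z : ℂ → ℂ} {F : ℂ → ℂ → ℂ} {n : ℕ}
    (hF : ∀ τ ∈ T, ∃ s : Polynomial ℂ, s.natDegree ≤ n ∧ ∀ μ, F τ μ = s.eval μ)
    (hq : ∀ μ : ℂ, μ ≠ 0 → ∃ q : Polynomial ℂ, ∀ τ ∈ T, F τ μ = q.eval (z τ)) :
    ∃ P : MvPolynomial (Fin 2) ℂ, ∀ τ ∈ T, ∀ μ, F τ μ = MvPolynomial.eval ![μ, z τ] P := by
  have hne (j : ℕ) : ((j : ℂ) + 1) ≠ 0 := Nat.cast_add_one_ne_zero j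
  choose q hq using fun j : ℕ => hq _ (hne j)
  refine ⟨∑ j ∈ Finset.range (n + 1), Polynomial.aeval (MvPolynomial.X 1) (q j)
    * Polynomial.aeval (MvPolynomial.X 0)
      (Lagrange.basis (Finset.range (n + 1)) (fun j : ℕ => (j : ℂ) + 1) j), fun τ hτ μ => ?_⟩
  obtain ⟨s, hs, hsF⟩ := hF τ hτ
  have hinj : Set.InjOn (fun j : ℕ => (j : ℂ) + 1) (Finset.range (n + 1)) := by
    intro i _ j _ hij
    simpa using hij
  have hdeg : s.degree < (Finset.range (n + 1)).card := by
    rw [Finset.card_range]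
    exact (Polynomial.degree_le_of_natDegree_le hs).trans_lt (by exact_mod_cast Nat.lt_succ_self n)
  have hev (i : Fin 2) (p : Polynomial ℂ) : MvPolynomial.eval ![μ, z τ]
      (Polynomial.aeval (MvPolynomial.X i) p) = p.eval (![μ, z τ] i) := by
    rw [← MvPolynomial.coe_aeval_eq_eval]
    change MvPolynomial.aeval ![μ, z τ] (Polynomial.aeval (MvPolynomial.X i) p) = _
    rw [← Polynomial.aeval_algHom_apply, MvPolynomial.aeval_X, Polynomial.coe_aeval_eq_eval]
  rw [hsF, Lagrange.eq_interpolate hinj hdeg, Lagrange.interpolate_apply,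
    Polynomial.eval_finsetSum, map_sum]
  refine Finset.sum_congr rfl fun j _ => ?_
  rw [map_mul, hev, hev, Polynomial.eval_mul, Polynomial.eval_C, ← hsF, hq j τ hτ]
  rfl

lemma mubar_eq_div (ζ μ : ℂ) :
    mubar ζ μ = (μ - 1) ^ 2 / μ / (ζ ^ 2 - 1) := by
  rw [mubar, div_div, mul_comm]

lemma padded_eq_joinH {k : ℕ} {A : List ℂ} (hA : A.length ≤ k) :
    (padded A : Fin (2 * k) → ℂ) = joinH (padded A) fun _ => 0 := by
  funext i
  simp only [padded, joinH]
  split_ifs with h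
  · rfl
  · exact List.getD_eq_default _ _ (by omega)

lemma padded_pair_swap {k : ℕ} (x y : ℂ) :
    (padded [x, y] : Fin (k + 2) → ℂ) ∘ Equiv.swap 0 1 = padded [y, x] := by
  funext i
  refine Fin.cases ?_ (fun i => Fin.cases ?_ (fun i => ?_) i) i
  · simp [padded]
  · change padded [x, y] (Equiv.swap (0 : Fin (k + 2)) 1 1) = _
    simp [padded]
  · rw [Function.comp_apply, Equiv.swap_apply_of_ne_of_ne (Fin.succ_ne_zero _)
      (show i.succ.succ ≠ (1 : Fin (k + 2)) from fun h => Fin.succ_ne_zero _ (Fin.succ_injective _ h))]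
    simp [padded]

lemma exists_polynomial_H_mubar (hH : ∀ ζ, IsHFamily ζ (H ζ)) (k : ℕ) (μ : ℂ) :
    ∃ q : Polynomial ℂ, ∀ ζ, ζ ^ 2 - 1 ≠ 0 →
      H ζ (k + 1) (padded [mubar ζ μ]) = q.eval ζ := by
  obtain ⟨q, hq⟩ := H_polynomial_param_div hH (fun _ : Fin k => 0) (fun _ => 0) ((μ - 1) ^ 2 / μ)
  refine ⟨q, fun ζ hζ => ?_⟩
  rw [← hq ζ hζ, padded_eq_joinH (by simp), padded_cons, mubar_eq_div]
  rfl

lemma exists_polynomial_H_J2c_mubar (hH : ∀ ζ, IsHFamily ζ (H ζ)) (k : ℕ) (μ : ℂ) :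
    ∃ q : Polynomial ℂ, ∀ ζ, ζ ^ 2 - 1 ≠ 0 →
      H ζ (k + 2) (padded [J2c, mubar ζ μ]) = q.eval ζ := by
  obtain ⟨q, hq⟩ := H_polynomial_param_div hH (padded [J2c] : Fin (k + 1) → ℂ) (fun _ => 0)
    ((μ - 1) ^ 2 / μ)
  refine ⟨q, fun ζ hζ => ?_⟩
  rw [← hq ζ hζ, ← padded_cons, ← H_joinH_comp_perm (hH ζ) (Equiv.swap 0 1), padded_pair_swap,
    padded_eq_joinH (by simp), mubar_eq_div]

end

theorem stmt16 (Ψ : ℂ → PsiFam) (H : ℂ → (k : ℕ) → (Fin (2*k) → ℂ) → ℂ)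
    (hΨ : ∀ τ : ℂ, 0 < τ.im →
      PsiEntire (Ψ τ) ∧ PsiP1 τ (Ψ τ) ∧ PsiP2 τ (Ψ τ) ∧ PsiP3 τ (Ψ τ) ∧
        PsiP4 (Ψ τ) ∧ PsiP5 τ (Ψ τ) ∧ PsiP6 (Ψ τ))
    (hH : ∀ ζ, IsHFamily ζ (H ζ)) (k : ℕ) :
    (∃ P : MvPolynomial (Fin 2) ℂ, ∀ τ : ℂ, 0 < τ.im → preal τ → ∀ μ : ℂ,
        Sfun τ (Ψ τ) (2*k) μ = MvPolynomial.eval ![μ, zet τ] P) ∧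
    (∃ P : MvPolynomial (Fin 2) ℂ, ∀ τ : ℂ, 0 < τ.im → preal τ → ∀ μ : ℂ,
        Sfun τ (Ψ τ) (2*k+1) μ = MvPolynomial.eval ![μ, zet τ] P) ∧
    (∀ τ : ℂ, 0 < τ.im → preal τ → ∀ μ : ℂ, μ ≠ 0 →
      Sfun τ (Ψ τ) (2*k) μ
          = (2*μ)^k * H (zet τ) k (fun _ => 0)
            * H (zet τ) (k+1) (padded [J2c, mubar (zet τ) μ]) ∧
      Sfun τ (Ψ τ) (2*k+1) μ
          = (2*μ)^k * (μ+1) * H (zet τ) (k+1) (padded [J2c])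
            * H (zet τ) (k+1) (padded [mubar (zet τ) μ])) := by
  have sol (τ : ℂ) (hτ : 0 < τ.im) : PsiSol τ (Ψ τ) := by
    obtain ⟨h0, h1, h2, h3, -, h5, h6⟩ := hΨ τ hτ
    exact ⟨hτ, h0, h1, h2, h3, h5, h6⟩
  have hζ (τ : ℂ) (hτ : 0 < τ.im) : zet τ ^ 2 - 1 ≠ 0 := fun h =>
    one_sub_zet_sq_ne hτ (by linear_combination -h)
  refine ⟨?_, ?_, fun τ hτ _ μ hμ =>
    ⟨Sfun_even (sol τ hτ) (hH _) k hμ, Sfun_odd (sol τ hτ) (hH _) k hμ⟩⟩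
  · obtain ⟨P, hP⟩ := exists_joint_polynomial (T := {τ | 0 < τ.im}) (z := zet)
      (F := fun τ μ => Sfun τ (Ψ τ) (2 * k) μ)
      (fun τ _ => exists_polynomial_Sfun τ (Ψ τ) (2 * k)) fun μ hμ => by
        obtain ⟨q₁, h₁⟩ := H_polynomial_param hH k fun _ => 0
        obtain ⟨q₂, h₂⟩ : ∃ q : Polynomial ℂ, ∀ ζ, ζ ^ 2 - 1 ≠ 0 →
            H ζ (k + 1) (padded [J2c, mubar ζ μ]) = q.eval ζ := by
          cases k with
          | zero => exact ⟨1, fun ζ _ => by simpa using H_one (hH ζ) _⟩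
          | succ k => exact exists_polynomial_H_J2c_mubar hH k μ
        refine ⟨Polynomial.C ((2 * μ) ^ k) * q₁ * q₂, fun τ hτ => ?_⟩
        rw [Sfun_even (sol τ hτ) (hH _) k hμ, h₁, h₂ _ (hζ τ hτ)]
        simp
    exact ⟨P, fun τ hτ _ μ => hP τ hτ μ⟩
  · obtain ⟨P, hP⟩ := exists_joint_polynomial (T := {τ | 0 < τ.im}) (z := zet)
      (F := fun τ μ => Sfun τ (Ψ τ) (2 * k + 1) μ)
      (fun τ _ => exists_polynomial_Sfun τ (Ψ τ) (2 * k + 1)) fun μ hμ => by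
        obtain ⟨q₁, h₁⟩ := H_polynomial_param hH (k + 1) (padded [J2c])
        obtain ⟨q₂, h₂⟩ := exists_polynomial_H_mubar hH k μ
        refine ⟨Polynomial.C ((2 * μ) ^ k * (μ + 1)) * q₁ * q₂, fun τ hτ => ?_⟩
        rw [Sfun_odd (sol τ hτ) (hH _) k hμ, h₁, h₂ _ (hζ τ hτ)]
        simp
    exact ⟨P, fun τ hτ _ μ => hP τ hτ μ⟩

end
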